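/- Let u be a weak supersolution of ∂ₜu + 𝓛u = Δu in Ω × (0,T) with u ≥ 0 on all of ℝ^N × (t₀ − r², t₀ + r²), where B_R(x₀) × (t₀ − r², t₀ + r²) ⊂ Ω × (0,T), 0 < r ≤ 1 and r < R/2. Set κ = 2N/(N − 2) if N > 2 and κ = 4 if N = 2. Then for every q with 0 < q < 2 − 2/κ there exists a constant C > 0 depending only on N, s, Λ and q such that ( ⨍_{V⁻(r/2)} u^q dx dt )^{1/q} ≤ C · essinf_{V⁺(r/2)} u, where V⁻(r/2) = B_{r/2}(x₀) × (t₀ − r², t₀ − 3r²/4) and V⁺(r/2) = B_{r/2}(x₀) × (t₀ + 3r²/4, t₀ + r²). -/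

import Mathlib

open MeasureTheory Metric Set
open scoped RealInnerProductSpace ENNReal

noncomputable section

/-- Euclidean space `ℝ^N`. -/
abbrev E (N : ℕ) : Type := EuclideanSpace ℝ (Fin N)

/-- The kernel `K` is measurable, symmetric in its first two arguments, and comparable to
the fractional kernel `|x-y|^{-(N+2s)}` with constant `Λ`, uniformly for `t ∈ (0,T)`. -/
def KernelOK (N : ℕ) (s Λ T : ℝ) (K : E N → E N → ℝ → ℝ) : Prop :=
  Measurable (fun p : E N × E N × ℝ => K p.1 p.2.1 p.2.2) ∧
  (∀ x y t, K x y t = K y x t) ∧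
  ∀ x y : E N, x ≠ y → ∀ t ∈ Set.Ioo 0 T,
    Λ⁻¹ * ‖x - y‖ ^ (-((N : ℝ) + 2 * s)) ≤ K x y t ∧
      K x y t ≤ Λ * ‖x - y‖ ^ (-((N : ℝ) + 2 * s))

/-- `u` is a (bounded, measurable, smooth in `Ω × (0,T)`) weak supersolution of
`∂ₜ u + 𝓛 u = Δ u` in `Ω × (0,T)`. -/
def IsWeakSupersolution (N : ℕ) (T : ℝ) (K : E N → E N → ℝ → ℝ)
    (Ω : Set (E N)) (u : E N → ℝ → ℝ) : Prop :=
  Measurable (fun p : E N × ℝ => u p.1 p.2) ∧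
  (∃ M : ℝ, ∀ x t, t ∈ Set.Ioo 0 T → |u x t| ≤ M) ∧
  ContDiffOn ℝ (⊤ : ℕ∞) (fun p : E N × ℝ => u p.1 p.2) (Ω ×ˢ Set.Ioo 0 T) ∧
  ∀ φ : E N → ℝ → ℝ,
    ContDiff ℝ (⊤ : ℕ∞) (fun p : E N × ℝ => φ p.1 p.2) →
    HasCompactSupport (fun p : E N × ℝ => φ p.1 p.2) →
    tsupport (fun p : E N × ℝ => φ p.1 p.2) ⊆ Ω ×ˢ Set.Ioo 0 T →
    (∀ x t, 0 ≤ φ x t) →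
    0 ≤ -(∫ t in Set.Ioo 0 T, ∫ x in Ω, u x t * deriv (fun τ => φ x τ) t) +
        (∫ t in Set.Ioo 0 T, ∫ x in Ω,
          ⟪gradient (fun y => u y t) x, gradient (fun y => φ y t) x⟫) +
        ∫ t in Set.Ioo 0 T, ∫ x : E N, ∫ y : E N,
          (u x t - u y t) * (φ x t - φ y t) * K x y t

/-- The negative part `u₋ = max(-u, 0)`. -/
def uminus (N : ℕ) (u : E N → ℝ → ℝ) : E N → ℝ → ℝ := fun x t => max (-(u x t)) 0

/-- The parabolic tail `Tail_∞(w; x₀, ρ, t₁, t₂)`. -/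
def tailInfty (N : ℕ) (s : ℝ) (w : E N → ℝ → ℝ) (x₀ : E N) (ρ t₁ t₂ : ℝ) : ℝ :=
  ρ ^ 2 * essSup
      (fun t => ∫ y in (Metric.ball x₀ ρ)ᶜ, |w y t| * ‖y - x₀‖ ^ (-((N : ℝ) + 2 * s)))
      (volume.restrict (Set.Ioo t₁ t₂))

/-- The Sobolev exponent: `κ = 2N/(N-2)` for `N > 2` and `κ = 4` for `N = 2`. -/
def kappa (N : ℕ) : ℝ := if 2 < N then 2 * N / ((N : ℝ) - 2) else 4

lemma sob3 (N : ℕ) (hN : 3 ≤ N) : ∃ C : ℝ≥0∞, C ≠ ∞ ∧ ∀ w : E N → ℝ, ContDiff ℝ 1 w → HasCompactSupport w →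
    ∫⁻ x, ‖w x‖ₑ ^ (2 * (1 + 2 / (N : ℝ))) ≤
      C * ((∫⁻ x, ‖w x‖ₑ ^ (2:ℝ)) ^ (2 / (N : ℝ)) * ∫⁻ x, ‖fderiv ℝ w x‖ₑ ^ (2:ℝ)) := by
  have hN' : (3:ℝ) ≤ N := by exact_mod_cast hN
  have hN2 : (0:ℝ) < N - 2 := by linarith
  have hN0 : (0:ℝ) < N := by linarith
  let p' : NNReal := ⟨2 * N / (N - 2), by positivity⟩
  have hp'v : (p' : ℝ) = 2 * N / (N - 2) := rfl
  have hp'0 : (p' : ℝ) ≠ 0 := by rw [hp'v]; positivity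
  refine ⟨(SNormLESNormFDerivOfEqConst ℝ (volume : Measure (E N)) (2 : NNReal) : ℝ≥0∞) ^ (2:ℝ), by simp, ?_⟩
  intro w hw hc
  have key := eLpNorm_le_eLpNorm_fderiv_of_eq (volume : Measure (E N)) hw hc (p := 2) (p' := p')
    (by norm_num) (by simp; omega) (by
      rw [hp'v]; simp; field_simp; try ring)
  rw [eLpNorm_nnreal_eq_lintegral (by exact_mod_cast hp'0),
    eLpNorm_nnreal_eq_lintegral (by norm_num)] at key
  have hm : Measurable (fun x => ‖w x‖ₑ) := hw.continuous.enorm.measurable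
  have holder := ENNReal.lintegral_mul_le_Lp_mul_Lq (volume : Measure (E N))
    (p := N / (N - 2)) (q := N / 2) (f := fun x => ‖w x‖ₑ ^ (2:ℝ)) (g := fun x => ‖w x‖ₑ ^ (4 / (N:ℝ)))
    (by rw [Real.holderConjugate_iff]; constructor
        · rw [lt_div_iff₀ hN2]; linarith
        · field_simp; ring) (hm.pow_const _).aemeasurable (hm.pow_const _).aemeasurable
  have e1 : ∀ x, ‖w x‖ₑ ^ (2 * (1 + 2 / (N : ℝ))) = ‖w x‖ₑ ^ (2:ℝ) * ‖w x‖ₑ ^ (4 / (N:ℝ)) := by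
    intro x
    rw [← ENNReal.rpow_add_of_nonneg _ _ (by norm_num) (by positivity)]
    congr 1; field_simp; try ring
  calc ∫⁻ x, ‖w x‖ₑ ^ (2 * (1 + 2 / (N : ℝ)))
      = ∫⁻ x, ((fun x => ‖w x‖ₑ ^ (2:ℝ)) * (fun x => ‖w x‖ₑ ^ (4 / (N:ℝ)))) x := by
        simp only [e1, Pi.mul_apply]
    _ ≤ _ := holder
    _ = ((∫⁻ x, ‖w x‖ₑ ^ (p':ℝ)) ^ (1 / (p':ℝ))) ^ (2:ℝ) * (∫⁻ x, ‖w x‖ₑ ^ (2:ℝ)) ^ (2 / (N : ℝ)) := by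
        congr 1
        · rw [← ENNReal.rpow_mul]
          simp only [← ENNReal.rpow_mul]
          rw [hp'v]
          congr 1
          · congr 1; ext x; congr 1; field_simp
          · field_simp
        · simp only [← ENNReal.rpow_mul]
          congr 1
          · congr 1; ext x; congr 1; field_simp; norm_num
          · field_simp
    _ ≤ _ := by
        rw [mul_comm ((∫⁻ x, ‖w x‖ₑ ^ (2:ℝ)) ^ (2 / (N : ℝ))), ← mul_assoc]
        gcongr
        refine (ENNReal.rpow_le_rpow key (by norm_num)).trans ?_
        rw [ENNReal.mul_rpow_of_nonneg _ _ (by norm_num), ← ENNReal.rpow_mul (∫⁻ x, _)]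
        gcongr
        simp

lemma sob2 : ∃ C : ℝ≥0∞, C ≠ ∞ ∧ ∀ w : E 2 → ℝ, ContDiff ℝ 1 w → HasCompactSupport w →
    ∫⁻ x, ‖w x‖ₑ ^ (4:ℝ) ≤
      C * ((∫⁻ x, ‖w x‖ₑ ^ (2:ℝ)) * ∫⁻ x, ‖fderiv ℝ w x‖ₑ ^ (2:ℝ)) := by
  refine ⟨(lintegralPowLePowLIntegralFDerivConst (volume : Measure (E 2)) 2 : ℝ≥0∞) * 4, by
    exact ENNReal.mul_ne_top (by simp) (by norm_num), ?_⟩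
  intro w hw hc
  have hc2 : HasCompactSupport (fun x => w x ^ 2) := by
    have := hc.comp_left (g := fun y : ℝ => y ^ 2) (by simp)
    exact this
  have key := lintegral_pow_le_pow_lintegral_fderiv (volume : Measure (E 2)) (u := fun x => w x ^ 2)
    (hw.pow 2) hc2 (p := 2) (by rw [Real.holderConjugate_iff]; norm_num [E])
  have hm : Measurable (fun x => ‖w x‖ₑ) := hw.continuous.enorm.measurable
  have hm2 : Measurable (fun x => ‖fderiv ℝ w x‖ₑ) := (hw.continuous_fderiv (by norm_num)).enorm.measurable
  have hf : ∀ x, ‖fderiv ℝ (fun x => w x ^ 2) x‖ₑ = 2 * (‖w x‖ₑ * ‖fderiv ℝ w x‖ₑ) := by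
    intro x
    have := ((hw.differentiable (by norm_num)) x).hasFDerivAt.pow 2
    rw [this.fderiv, enorm_smul]
    simp [enorm_mul, mul_assoc]
    norm_num [enorm_eq_nnnorm]
  have holder := ENNReal.lintegral_mul_le_Lp_mul_Lq (volume : Measure (E 2))
    (p := 2) (q := 2) (f := fun x => ‖w x‖ₑ) (g := fun x => ‖fderiv ℝ w x‖ₑ)
    (by rw [Real.holderConjugate_iff]; norm_num) hm.aemeasurable hm2.aemeasurable
  calc ∫⁻ x, ‖w x‖ₑ ^ (4:ℝ) = ∫⁻ x, ‖w x ^ 2‖ₑ ^ (2:ℝ) := by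
        congr 1; ext x
        rw [enorm_pow, ← ENNReal.rpow_natCast, ← ENNReal.rpow_mul]; norm_num
    _ ≤ _ := key
    _ ≤ _ := by
        simp only [hf]
        rw [lintegral_const_mul _ (by fun_prop), mul_assoc]
        gcongr
        rw [ENNReal.mul_rpow_of_nonneg _ _ (by norm_num)]
        gcongr
        · norm_num
        · refine (ENNReal.rpow_le_rpow holder (by norm_num)).trans ?_
          rw [ENNReal.mul_rpow_of_nonneg _ _ (by norm_num), ← ENNReal.rpow_mul, ← ENNReal.rpow_mul]
          norm_num

lemma sobE (N : ℕ) (hN : 2 ≤ N) : ∃ C : ℝ≥0∞, C ≠ ∞ ∧ ∀ w : E N → ℝ, ContDiff ℝ 1 w → HasCompactSupport w →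
    ∫⁻ x, ‖w x‖ₑ ^ (2 * (1 + 2 / (N : ℝ))) ≤
      C * ((∫⁻ x, ‖w x‖ₑ ^ (2:ℝ)) ^ (2 / (N : ℝ)) * ∫⁻ x, ‖fderiv ℝ w x‖ₑ ^ (2:ℝ)) := by
  rcases hN.lt_or_eq with h | h
  · exact sob3 N h
  · subst h
    obtain ⟨C, hC, h⟩ := sob2
    refine ⟨C, hC, fun w hw hc => ?_⟩
    have h1 := h w hw hc
    have e1 : 2 * (1 + 2 / ((2:ℕ) : ℝ)) = 4 := by norm_num
    have e2 : 2 / ((2:ℕ) : ℝ) = 1 := by norm_num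
    rw [e1, e2, ENNReal.rpow_one]
    exact h1

lemma c1x (N : ℕ) (w : E N → ℝ) (hw : ContDiff ℝ 1 w) (hc : HasCompactSupport w) : Integrable (fun x => w x ^ 2) := by
  have k2 : HasCompactSupport (fun x => w x ^ 2) :=
      HasCompactSupport.comp_left (g := fun y : ℝ => y ^ 2) hc (by simp)
  exact (hw.continuous.pow 2).integrable_of_hasCompactSupport k2
lemma c2x (N : ℕ) (w : E N → ℝ) (hw : ContDiff ℝ 1 w) (hc : HasCompactSupport w) : Integrable (fun x => ‖fderiv ℝ w x‖ ^ 2) := by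
    have k1 : Continuous (fun x => ‖fderiv ℝ w x‖ ^ 2) := (hw.continuous_fderiv (by norm_num)).norm.pow 2
    have k2 : HasCompactSupport (fun x => ‖fderiv ℝ w x‖ ^ 2) :=
      HasCompactSupport.comp_left (g := fun y : E N →L[ℝ] ℝ => ‖y‖ ^ 2) (hc.fderiv (𝕜 := ℝ)) (by simp)
    exact k1.integrable_of_hasCompactSupport k2
lemma e0x (N : ℕ) (w : E N → ℝ) (hw : ContDiff ℝ 1 w) (m : ℝ) (hm : 0 < m) : ∫ x, |w x| ^ m = (∫⁻ x, ‖w x‖ₑ ^ m).toReal := by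
    rw [integral_eq_lintegral_of_nonneg_ae (.of_forall fun x => by positivity)]
    · congr 1; congr 1; ext x
      rw [← Real.norm_eq_abs, ← ENNReal.ofReal_rpow_of_nonneg (norm_nonneg _) (by positivity), ofReal_norm]
    · exact (hw.continuous.abs.rpow_const fun x => Or.inr (by positivity)).aestronglyMeasurable
lemma e1x (N : ℕ) (w : E N → ℝ) (c1 :  Integrable (fun x => w x ^ 2)) : ∫⁻ x, ‖w x‖ₑ ^ (2:ℝ) = ENNReal.ofReal (∫ x, w x ^ 2) := by
    rw [ofReal_integral_eq_lintegral_ofReal c1 (.of_forall fun x => by positivity)]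
    congr 1; ext x
    rw [← sq_abs, ← Real.norm_eq_abs, ENNReal.ofReal_pow (norm_nonneg _), ofReal_norm]; norm_num
lemma e2x (N : ℕ) (w : E N → ℝ) (c2 :  Integrable (fun x => ‖fderiv ℝ w x‖ ^ 2)) : ∫⁻ x, ‖fderiv ℝ w x‖ₑ ^ (2:ℝ) = ENNReal.ofReal (∫ x, ‖fderiv ℝ w x‖ ^ 2) := by
    rw [ofReal_integral_eq_lintegral_ofReal c2 (.of_forall fun x => by positivity)]
    congr 1; ext x
    rw [ENNReal.ofReal_pow (norm_nonneg _), ofReal_norm]; norm_num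

lemma sob (N : ℕ) (hN : 2 ≤ N) : ∃ C : ℝ, 0 < C ∧ ∀ w : E N → ℝ, ContDiff ℝ 1 w → HasCompactSupport w →
    ∫ x, |w x| ^ (2 * (1 + 2 / (N : ℝ))) ≤
      C * ((∫ x, w x ^ 2) ^ (2 / (N : ℝ)) * ∫ x, ‖fderiv ℝ w x‖ ^ 2) := by
  have hN0 : (0:ℝ) < N := by exact_mod_cast (by omega : 0 < N)
  obtain ⟨C, hC, h⟩ := sobE N hN
  refine ⟨C.toReal + 1, by positivity, fun w hw hc => ?_⟩
  have h0 := h w hw hc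
  have n1 : 0 ≤ ∫ x, w x ^ 2 := integral_nonneg fun x => by positivity
  have n2 : 0 ≤ ∫ x, ‖fderiv ℝ w x‖ ^ 2 := integral_nonneg fun x => by positivity
  rw [e0x N w hw _ (by positivity)]
  rw [e1x N w (c1x N w hw hc), e2x N w (c2x N w hw hc), ENNReal.ofReal_rpow_of_nonneg n1 (by positivity), ← ENNReal.ofReal_mul (by positivity),
    ← ENNReal.ofReal_toReal hC, ← ENNReal.ofReal_mul (by positivity)] at h0
  refine (ENNReal.toReal_le_of_le_ofReal (by positivity) h0).trans ?_
  gcongr; linarith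

/-- A smooth cutoff supported in the closed ball of radius `ρ` with gradient bounded by `L`. -/
structure Cut (N : ℕ) (Ψ : E N → ℝ) (ρ L : ℝ) : Prop where
  smooth : ContDiff ℝ (⊤ : ℕ∞) Ψ
  nonneg : ∀ x, 0 ≤ Ψ x
  le_one : ∀ x, Ψ x ≤ 1
  supp : ∀ x, x ∉ closedBall (0 : E N) ρ → Ψ x = 0
  grad : ∀ x, ‖fderiv ℝ Ψ x‖ ≤ L
  one_le : 1 ≤ L

lemma st_deriv_bound : ∃ D : ℝ, 1 ≤ D ∧ ∀ x, |deriv Real.smoothTransition x| ≤ D := by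
  have hc : Continuous (deriv Real.smoothTransition) :=
    (Real.smoothTransition.contDiff (n := 1)).continuous_deriv (by norm_num)
  obtain ⟨D, hD⟩ := isCompact_Icc.exists_bound_of_continuousOn (s := Icc (-1:ℝ) 2) hc.continuousOn
  refine ⟨max D 1, le_max_right _ _, fun x => ?_⟩
  by_cases h1 : x < 0
  · have : Real.smoothTransition =ᶠ[nhds x] fun _ => 0 := by
      filter_upwards [Iio_mem_nhds h1] with y hy
      exact Real.smoothTransition.zero_of_nonpos (le_of_lt hy)
    rw [this.deriv_eq]; simp
  by_cases h2 : 1 < x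
  · have : Real.smoothTransition =ᶠ[nhds x] fun _ => 1 := by
      filter_upwards [Ioi_mem_nhds h2] with y hy
      exact Real.smoothTransition.one_of_one_le (le_of_lt hy)
    rw [this.deriv_eq]; simp
  · exact (hD x ⟨by linarith, by linarith⟩).trans (le_max_left _ _)

lemma st_deriv_zero {x : ℝ} (h1 : x < 0) : deriv Real.smoothTransition x = 0 := by
  have : Real.smoothTransition =ᶠ[nhds x] fun _ => 0 := by
    filter_upwards [Iio_mem_nhds h1] with y hy
    exact Real.smoothTransition.zero_of_nonpos (le_of_lt hy)
  rw [this.deriv_eq]; simp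

lemma exists_cut (N : ℕ) : ∃ D : ℝ, 1 ≤ D ∧ ∀ ρ' ρ : ℝ, 0 < ρ' → ρ' < ρ → ρ ≤ 3 / 2 →
    ∃ Ψ : E N → ℝ, Cut N Ψ ρ (D / (ρ - ρ')) ∧ (∀ x ∈ closedBall (0 : E N) ρ', Ψ x = 1) ∧
      (∀ x y, ‖x‖ ≤ ‖y‖ → Ψ y ≤ Ψ x) := by
  obtain ⟨D, hD1, hD⟩ := st_deriv_bound
  refine ⟨2 * D, by linarith, fun ρ' ρ h0 h1 h2 => ?_⟩
  have hd : 0 < ρ ^ 2 - ρ' ^ 2 := by nlinarith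
  have hmono : Monotone Real.smoothTransition := Real.smoothTransition.monotone
  refine ⟨fun x => Real.smoothTransition ((ρ ^ 2 - ‖x‖ ^ 2) / (ρ ^ 2 - ρ' ^ 2)), ⟨?_, ?_, ?_, ?_, ?_, ?_⟩, ?_, ?_⟩
  · exact Real.smoothTransition.contDiff.comp ((contDiff_const.sub (contDiff_norm_sq ℝ)).div_const _)
  · exact fun x => Real.smoothTransition.nonneg _
  · exact fun x => Real.smoothTransition.le_one _
  · intro x hx
    simp only [mem_closedBall, dist_zero_right, not_le] at hx
    apply Real.smoothTransition.zero_of_nonpos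
    apply div_nonpos_of_nonpos_of_nonneg _ hd.le
    nlinarith
  · intro x
    have hg : HasFDerivAt (fun x : E N => (ρ ^ 2 - ‖x‖ ^ 2) / (ρ ^ 2 - ρ' ^ 2))
        ((ρ ^ 2 - ρ' ^ 2)⁻¹ • (-((2:ℕ) • (innerSL ℝ x : E N →L[ℝ] ℝ)) : E N →L[ℝ] ℝ)) x := by
      have := ((hasStrictFDerivAt_norm_sq x).hasFDerivAt.const_sub (ρ^2)).mul_const ((ρ ^ 2 - ρ' ^ 2)⁻¹)
      simpa [div_eq_mul_inv] using this
    have hs : HasDerivAt Real.smoothTransition (deriv Real.smoothTransition ((ρ ^ 2 - ‖x‖ ^ 2) / (ρ ^ 2 - ρ' ^ 2)))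
        ((ρ ^ 2 - ‖x‖ ^ 2) / (ρ ^ 2 - ρ' ^ 2)) :=
      ((Real.smoothTransition.contDiff (n := 1)).differentiable (by norm_num) _).hasDerivAt
    have hc := hs.comp_hasFDerivAt x hg
    have hc' : fderiv ℝ (fun x : E N => Real.smoothTransition ((ρ ^ 2 - ‖x‖ ^ 2) / (ρ ^ 2 - ρ' ^ 2))) x = _ := hc.fderiv
    rw [hc', norm_smul, norm_smul, norm_neg, Real.norm_eq_abs, Real.norm_eq_abs, abs_inv, abs_of_pos hd]
    have hn : ‖(2 : ℕ) • innerSL ℝ x‖ ≤ 2 * ‖x‖ := by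
      refine (norm_nsmul_le).trans ?_
      simp
    by_cases hx : ‖x‖ ≤ ρ
    · calc |deriv Real.smoothTransition ((ρ ^ 2 - ‖x‖ ^ 2) / (ρ ^ 2 - ρ' ^ 2))| * ((ρ ^ 2 - ρ' ^ 2)⁻¹ * ‖(2 : ℕ) • innerSL ℝ x‖)
          ≤ D * ((ρ ^ 2 - ρ' ^ 2)⁻¹ * (2 * ρ)) := by
            gcongr
            · exact hD _
            · exact hn.trans (by linarith)
        _ ≤ 2 * D / (ρ - ρ') := by
            have h3 : 0 < ρ - ρ' := by linarith
            have : ρ ^ 2 - ρ' ^ 2 = (ρ - ρ') * (ρ + ρ') := by ring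
            rw [this, le_div_iff₀ h3]
            have : 0 < ρ + ρ' := by linarith
            field_simp
            nlinarith
    · rw [st_deriv_zero]
      · have h3 : 0 < ρ - ρ' := by linarith
        simp; positivity
      · apply div_neg_of_neg_of_pos _ hd
        push Not at hx
        nlinarith [norm_nonneg x]
  · rw [le_div_iff₀ (by linarith)]; linarith
  · intro x hx
    simp only [mem_closedBall, dist_zero_right] at hx
    apply Real.smoothTransition.one_of_one_le
    rw [le_div_iff₀ hd]
    nlinarith [norm_nonneg x]
  · intro x y hxy
    apply hmono
    gcongr

section calc0
variable {N : ℕ}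

lemma cont_int {F : E N → ℝ → ℝ} (hF : Continuous (fun p : E N × ℝ => F p.1 p.2)) (ρ : ℝ) :
    Continuous (fun t => ∫ x in closedBall (0 : E N) ρ, F x t) :=
  continuous_parametric_integral_of_continuous (f := fun t x => F x t)
    (hF.comp (continuous_snd.prodMk continuous_fst)) (isCompact_closedBall 0 ρ)

lemma int_ball {F : E N → ℝ} (hF : Continuous F) (ρ : ℝ) :
    IntegrableOn F (closedBall (0 : E N) ρ) :=
  hF.continuousOn.integrableOn_compact (isCompact_closedBall 0 ρ)

lemma slice_x {F : E N → ℝ → ℝ} (hF : Continuous (fun p : E N × ℝ => F p.1 p.2)) (t : ℝ) :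
    Continuous (fun x => F x t) := hF.comp (continuous_id.prodMk continuous_const)

lemma hasDeriv_int {F F' : E N → ℝ → ℝ} (hF : Continuous (fun p : E N × ℝ => F p.1 p.2))
    (hF' : Continuous (fun p : E N × ℝ => F' p.1 p.2))
    (hd : ∀ x t, HasDerivAt (fun τ => F x τ) (F' x t) t) (ρ t : ℝ) :
    HasDerivAt (fun τ => ∫ x in closedBall (0 : E N) ρ, F x τ)
      (∫ x in closedBall (0 : E N) ρ, F' x t) t := by
  obtain ⟨M, hM⟩ := ((isCompact_closedBall (0 : E N) ρ).prod (isCompact_Icc (a := t - 1) (b := t + 1))).exists_bound_of_continuousOn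
    hF'.continuousOn
  refine (hasDerivAt_integral_of_dominated_loc_of_deriv_le (F := fun τ x => F x τ) (F' := fun τ x => F' x τ)
    (bound := fun _ => M) (s := Icc (t - 1) (t + 1)) (Icc_mem_nhds (by linarith) (by linarith)) ?_ ?_ ?_ ?_ ?_ ?_).2
  · exact .of_forall fun τ => (slice_x hF τ).aestronglyMeasurable
  · exact int_ball (slice_x hF t) ρ
  · exact (slice_x hF' t).aestronglyMeasurable
  · exact (ae_restrict_iff' measurableSet_closedBall).2 (.of_forall fun x hx τ hτ => hM (x, τ) ⟨hx, hτ⟩)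
  · exact integrableOn_const (measure_closedBall_lt_top.ne)
  · exact .of_forall fun x τ _ => hd x τ

/-- time derivative -/
abbrev ft (f : E N → ℝ → ℝ) (x : E N) (t : ℝ) : ℝ := deriv (fun τ => f x τ) t
/-- space derivative -/
abbrev fx (f : E N → ℝ → ℝ) (x : E N) (t : ℝ) : E N →L[ℝ] ℝ := fderiv ℝ (fun y => f y t) x

variable {f : E N → ℝ → ℝ}

lemma has_ft (hf : ContDiff ℝ (⊤ : ℕ∞) (fun p : E N × ℝ => f p.1 p.2)) (x : E N) (t : ℝ) :
    HasDerivAt (fun τ => f x τ) (fderiv ℝ (fun p : E N × ℝ => f p.1 p.2) (x, t) (0, 1)) t := by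
  have h1 := (hf.differentiable (by simp) (x, t)).hasFDerivAt
  have h2 : HasDerivAt (fun τ : ℝ => ((x, τ) : E N × ℝ)) ((0 : E N), (1 : ℝ)) t :=
    (hasDerivAt_const t x).prodMk (hasDerivAt_id t)
  exact h1.comp_hasDerivAt t h2

lemma has_ft' (hf : ContDiff ℝ (⊤ : ℕ∞) (fun p : E N × ℝ => f p.1 p.2)) (x : E N) (t : ℝ) :
    HasDerivAt (fun τ => f x τ) (ft f x t) t := (has_ft hf x t).differentiableAt.hasDerivAt

lemma has_fx (hf : ContDiff ℝ (⊤ : ℕ∞) (fun p : E N × ℝ => f p.1 p.2)) (x : E N) (t : ℝ) :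
    HasFDerivAt (fun y => f y t) ((fderiv ℝ (fun p : E N × ℝ => f p.1 p.2) (x, t)).comp
      (ContinuousLinearMap.inl ℝ (E N) ℝ)) x := by
  have h1 := (hf.differentiable (by simp) (x, t)).hasFDerivAt
  have h2 : HasFDerivAt (fun y : E N => ((y, t) : E N × ℝ)) (ContinuousLinearMap.inl ℝ (E N) ℝ) x :=
    hasFDerivAt_prodMk_left x t
  exact h1.comp x h2

lemma has_fx' (hf : ContDiff ℝ (⊤ : ℕ∞) (fun p : E N × ℝ => f p.1 p.2)) (x : E N) (t : ℝ) :
    HasFDerivAt (fun y => f y t) (fx f x t) x := (has_fx hf x t).differentiableAt.hasFDerivAt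

lemma cont_ft (hf : ContDiff ℝ (⊤ : ℕ∞) (fun p : E N × ℝ => f p.1 p.2)) :
    Continuous (fun p : E N × ℝ => ft f p.1 p.2) := by
  have : (fun p : E N × ℝ => ft f p.1 p.2) = fun p => fderiv ℝ (fun p : E N × ℝ => f p.1 p.2) p (0, 1) := by
    ext p; exact (has_ft hf p.1 p.2).deriv
  rw [this]
  exact (hf.continuous_fderiv (by simp)).clm_apply continuous_const

lemma cont_fx (hf : ContDiff ℝ (⊤ : ℕ∞) (fun p : E N × ℝ => f p.1 p.2)) :
    Continuous (fun p : E N × ℝ => fx f p.1 p.2) := by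
  have : (fun p : E N × ℝ => fx f p.1 p.2) = fun p => (fderiv ℝ (fun p : E N × ℝ => f p.1 p.2) p).comp
      (ContinuousLinearMap.inl ℝ (E N) ℝ) := by
    ext1 p; exact (has_fx hf p.1 p.2).fderiv
  rw [this]
  exact (hf.continuous_fderiv (by simp)).clm_comp continuous_const

lemma cont_pow (hf : ContDiff ℝ (⊤ : ℕ∞) (fun p : E N × ℝ => f p.1 p.2)) (hpos : ∀ x t, 0 < f x t) (e : ℝ) :
    Continuous (fun p : E N × ℝ => f p.1 p.2 ^ e) :=
  hf.continuous.rpow_const fun _ => Or.inl (hpos _ _).ne'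

end calc0

/-- The basic energy inequality. -/
structure GoodF (N : ℕ) (c C pb S : ℝ) (f : E N → ℝ → ℝ) : Prop where
  smooth : ContDiff ℝ (⊤ : ℕ∞) (fun p : E N × ℝ => f p.1 p.2)
  pos : ∀ x t, 0 < f x t
  ineq : ∀ p, 0 ≤ p → p ≤ pb → ∀ (Ψ : E N → ℝ) (ρ L : ℝ), Cut N Ψ ρ L → ρ ≤ 3 / 2 → ∀ t ∈ Icc 0 S,
    (∫ x in closedBall (0 : E N) ρ, f x t ^ (p - 1) * ft f x t * Ψ x ^ 2) +
      c * (∫ x in closedBall (0 : E N) ρ, f x t ^ (p - 2) * ‖fx f x t‖ ^ 2 * Ψ x ^ 2) ≤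
    C * L ^ 2 * ∫ x in closedBall (0 : E N) ρ, f x t ^ p

/-- lower time of the cylinder -/
def tau (θ : ℝ) : ℝ := 3 / 2 * (1 - θ)

/-- iterated integral of `f^p` over the cylinder -/
def Icyl (N : ℕ) (f : E N → ℝ → ℝ) (S θ p : ℝ) : ℝ :=
  ∫ t in (tau θ)..S, ∫ x in closedBall (0 : E N) θ, f x t ^ p

section step
variable {N : ℕ} {c C pb S : ℝ} {f : E N → ℝ → ℝ}

lemma GoodF.energy (hf : GoodF N c C pb S f) {p : ℝ} (hp : 0 < p) (hpb : p ≤ pb) {Ψ : E N → ℝ} {ρ L : ℝ}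
    (hΨ : Cut N Ψ ρ L) (hρ : ρ ≤ 3 / 2) {t1 t2 : ℝ} (h1 : 0 ≤ t1) (h12 : t1 ≤ t2) (h2 : t2 ≤ S) :
    (∫ x in closedBall (0 : E N) ρ, f x t2 ^ p * Ψ x ^ 2) +
      p * c * (∫ t in t1..t2, ∫ x in closedBall (0 : E N) ρ, f x t ^ (p - 2) * ‖fx f x t‖ ^ 2 * Ψ x ^ 2) ≤
    (∫ x in closedBall (0 : E N) ρ, f x t1 ^ p * Ψ x ^ 2) +
      p * (C * L ^ 2) * ∫ t in t1..t2, ∫ x in closedBall (0 : E N) ρ, f x t ^ p := by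
  have hcΨ : Continuous (fun p : E N × ℝ => Ψ p.1) := hΨ.smooth.continuous.comp continuous_fst
  have hcp := cont_pow hf.smooth hf.pos
  have hct := cont_ft hf.smooth
  have hcx := cont_fx hf.smooth
  have cg := cont_int (F := fun x t => f x t ^ p * Ψ x ^ 2) ((hcp p).mul (hcΨ.pow 2)) ρ
  have cg' := cont_int (F := fun x t => f x t ^ (p - 1) * ft f x t * Ψ x ^ 2) (((hcp _).mul hct).mul (hcΨ.pow 2)) ρ
  have ce := cont_int (F := fun x t => f x t ^ (p - 2) * ‖fx f x t‖ ^ 2 * Ψ x ^ 2)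
    (((hcp _).mul (hcx.norm.pow 2)).mul (hcΨ.pow 2)) ρ
  have cj := cont_int (F := fun x t => f x t ^ p) (hcp p) ρ
  have hd : ∀ t, HasDerivAt (fun τ => ∫ x in closedBall (0 : E N) ρ, f x τ ^ p * Ψ x ^ 2)
      (p * ∫ x in closedBall (0 : E N) ρ, f x t ^ (p - 1) * ft f x t * Ψ x ^ 2) t := by
    intro t
    have := hasDeriv_int (F := fun x t => f x t ^ p * Ψ x ^ 2)
      (F' := fun x t => p * (f x t ^ (p - 1) * ft f x t * Ψ x ^ 2)) ((hcp p).mul (hcΨ.pow 2))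
      (continuous_const.mul (((hcp _).mul hct).mul (hcΨ.pow 2))) (fun x t => by
        have := ((has_ft' hf.smooth x t).rpow_const (p := p) (Or.inl (hf.pos x t).ne')).mul_const (Ψ x ^ 2)
        exact this.congr_deriv (by ring)) ρ t
    simpa only [integral_const_mul] using this
  have cA : Continuous (fun t => p * ∫ x in closedBall (0 : E N) ρ, f x t ^ (p - 1) * ft f x t * Ψ x ^ 2) :=
    continuous_const.mul cg'
  have cB : Continuous (fun t => p * c * ∫ x in closedBall (0 : E N) ρ, f x t ^ (p - 2) * ‖fx f x t‖ ^ 2 * Ψ x ^ 2) :=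
    continuous_const.mul ce
  have cD : Continuous (fun t => p * (C * L ^ 2) * ∫ x in closedBall (0 : E N) ρ, f x t ^ p) :=
    continuous_const.mul cj
  have ftc := intervalIntegral.integral_eq_sub_of_hasDerivAt (a := t1) (b := t2) (fun t _ => hd t)
    (cA.intervalIntegrable _ _)
  have mono := intervalIntegral.integral_mono_on (μ := volume) h12
    ((cA.intervalIntegrable t1 t2).add (cB.intervalIntegrable t1 t2))
    (cD.intervalIntegrable t1 t2) (fun t ht => by
      have := hf.ineq p hp.le hpb Ψ ρ L hΨ hρ t ⟨h1.trans ht.1, ht.2.trans h2⟩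
      have := mul_le_mul_of_nonneg_left this hp.le
      linarith)
  rw [intervalIntegral.integral_add (cA.intervalIntegrable _ _)
    (cB.intervalIntegrable _ _), ftc, intervalIntegral.integral_const_mul (p * c),
    intervalIntegral.integral_const_mul (p * (C * L ^ 2))] at mono
  linarith

end step

section step2
variable {N : ℕ} {f : E N → ℝ → ℝ}

lemma slice_sob (hs : ContDiff ℝ (⊤ : ℕ∞) (fun p : E N × ℝ => f p.1 p.2)) (hpos : ∀ x t, 0 < f x t)
    (hN : 2 ≤ N) {Cs : ℝ} (hCs : 0 < Cs)
    (hsob : ∀ w : E N → ℝ, ContDiff ℝ 1 w → HasCompactSupport w →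
      ∫ x, |w x| ^ (2 * (1 + 2 / (N : ℝ))) ≤
      Cs * ((∫ x, w x ^ 2) ^ (2 / (N : ℝ)) * ∫ x, ‖fderiv ℝ w x‖ ^ 2))
    {p : ℝ} {Ψ : E N → ℝ} {ρ' ρ L : ℝ} (hρ : ρ' ≤ ρ)
    (hΨ : Cut N Ψ ρ L) (h1 : ∀ x ∈ closedBall (0 : E N) ρ', Ψ x = 1) (t : ℝ) :
    ∫ x in closedBall (0 : E N) ρ', f x t ^ ((1 + 2 / (N : ℝ)) * p) ≤
      Cs * ((∫ x in closedBall (0 : E N) ρ, f x t ^ p * Ψ x ^ 2) ^ (2 / (N : ℝ)) *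
        (p ^ 2 / 2 * (∫ x in closedBall (0 : E N) ρ, f x t ^ (p - 2) * ‖fx f x t‖ ^ 2 * Ψ x ^ 2) +
          2 * L ^ 2 * ∫ x in closedBall (0 : E N) ρ, f x t ^ p)) := by
  have hN0 : (0:ℝ) < N := by exact_mod_cast (by omega : 0 < N)
  have hsx : ContDiff ℝ (⊤ : ℕ∞) (fun x => f x t) := hs.comp (contDiff_id.prodMk contDiff_const)
  have hwc : ContDiff ℝ 1 (fun x => f x t ^ (p / 2) * Ψ x) := by
    apply ContDiff.mul
    · exact (hsx.rpow_const_of_ne fun x => (hpos x t).ne').of_le (by exact_mod_cast le_top)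
    · exact hΨ.smooth.of_le (by exact_mod_cast le_top)
  have hws : HasCompactSupport (fun x => f x t ^ (p / 2) * Ψ x) := by
    apply HasCompactSupport.intro (isCompact_closedBall (0 : E N) ρ)
    intro x hx; simp [hΨ.supp x hx]
  have key := hsob _ hwc hws
  have hcp : ∀ e : ℝ, Continuous (fun x => f x t ^ e) := fun e => slice_x (F := fun x t => f x t ^ e) (cont_pow hs hpos e) t
  have hcx : Continuous (fun x => fx f x t) := (cont_fx hs).comp (continuous_id.prodMk continuous_const)
  have hcΨ := hΨ.smooth.continuous
  have hsq : ∀ x, (f x t ^ (p / 2)) ^ 2 = f x t ^ p := by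
    intro x
    rw [← Real.rpow_natCast, ← Real.rpow_mul (hpos x t).le]; congr 1; push_cast; ring
  -- left
  have L1 : ∫ x in closedBall (0 : E N) ρ', f x t ^ ((1 + 2 / (N : ℝ)) * p) ≤
      ∫ x, |f x t ^ (p / 2) * Ψ x| ^ (2 * (1 + 2 / (N : ℝ))) := by
    rw [← setIntegral_eq_integral_of_forall_compl_eq_zero (s := closedBall (0 : E N) ρ)
      (f := fun x => |f x t ^ (p / 2) * Ψ x| ^ (2 * (1 + 2 / (N : ℝ))))]
    · refine le_trans (le_of_eq ?_) (setIntegral_mono_set (s := closedBall (0 : E N) ρ') ?_ ?_ ?_)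
      · apply setIntegral_congr_fun measurableSet_closedBall
        intro x hx
        simp only
        rw [h1 x hx, mul_one, abs_of_pos (Real.rpow_pos_of_pos (hpos x t) _), ← Real.rpow_mul (hpos x t).le]
        congr 1; ring
      · exact int_ball (hwc.continuous.abs.rpow_const fun x => Or.inr (by positivity)) ρ
      · exact .of_forall fun x => by simp only [Pi.zero_apply]; positivity
      · exact (closedBall_subset_closedBall hρ).eventuallyLE
    · intro x hx
      rw [hΨ.supp x hx, mul_zero, abs_zero, Real.zero_rpow (by positivity)]
  -- square
  have L2 : ∫ x, (f x t ^ (p / 2) * Ψ x) ^ 2 = ∫ x in closedBall (0 : E N) ρ, f x t ^ p * Ψ x ^ 2 := by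
    rw [← setIntegral_eq_integral_of_forall_compl_eq_zero (s := closedBall (0 : E N) ρ)]
    · apply setIntegral_congr_fun measurableSet_closedBall
      intro x hx
      simp only
      rw [mul_pow, hsq]
    · intro x hx; simp [hΨ.supp x hx]
  -- gradient
  have L3 : ∫ x, ‖fderiv ℝ (fun x => f x t ^ (p / 2) * Ψ x) x‖ ^ 2 ≤
      (p ^ 2 / 2 * (∫ x in closedBall (0 : E N) ρ, f x t ^ (p - 2) * ‖fx f x t‖ ^ 2 * Ψ x ^ 2) +
          2 * L ^ 2 * ∫ x in closedBall (0 : E N) ρ, f x t ^ p) := by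
    rw [← setIntegral_eq_integral_of_forall_compl_eq_zero (s := closedBall (0 : E N) ρ)]
    · have i1 := int_ball (F := fun x => f x t ^ (p - 2) * ‖fx f x t‖ ^ 2 * Ψ x ^ 2) (((hcp (p - 2)).mul (hcx.norm.pow 2)).mul (hcΨ.pow 2)) ρ
      have i2 := int_ball (hcp p) ρ
      rw [← integral_const_mul, ← integral_const_mul, ← integral_add (i1.const_mul _) (i2.const_mul _)]
      apply setIntegral_mono_on (int_ball ((hwc.continuous_fderiv (by norm_num)).norm.pow 2) ρ)
        ((i1.const_mul _).add (i2.const_mul _)) measurableSet_closedBall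
      intro x hx
      show ‖fderiv ℝ (fun x => f x t ^ (p / 2) * Ψ x) x‖ ^ 2 ≤
        p ^ 2 / 2 * (f x t ^ (p - 2) * ‖fx f x t‖ ^ 2 * Ψ x ^ 2) + 2 * L ^ 2 * f x t ^ p
      have d1 := (has_fx' hs x t).rpow_const (p := p / 2) (Or.inl (hpos x t).ne')
      have d2 := (hΨ.smooth.differentiable (by simp) x).hasFDerivAt
      have d3 : fderiv ℝ (fun x => f x t ^ (p / 2) * Ψ x) x = _ := (d1.mul d2).fderiv
      rw [d3]
      set a := f x t ^ (p / 2) with ha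
      have hb : (f x t ^ (p / 2 - 1)) ^ 2 = f x t ^ (p - 2) := by
        rw [← Real.rpow_natCast, ← Real.rpow_mul (hpos x t).le]; congr 1; push_cast; ring
      have n1 : ‖a • fderiv ℝ Ψ x + Ψ x • ((p / 2 * f x t ^ (p / 2 - 1)) • fx f x t)‖ ≤
          a * L + Ψ x * (|p| / 2 * f x t ^ (p / 2 - 1) * ‖fx f x t‖) := by
        refine (norm_add_le _ _).trans ?_
        have a0 : 0 ≤ a := Real.rpow_nonneg (hpos x t).le _
        have b0 : 0 ≤ f x t ^ (p / 2 - 1) := Real.rpow_nonneg (hpos x t).le _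
        rw [norm_smul, norm_smul, norm_smul, Real.norm_of_nonneg a0, Real.norm_of_nonneg (hΨ.nonneg x),
          norm_mul, Real.norm_of_nonneg b0, norm_div, Real.norm_eq_abs, Real.norm_two]
        gcongr
        exact hΨ.grad x
      have n2 := pow_le_pow_left₀ (norm_nonneg _) n1 2
      refine n2.trans ?_
      have hsqx : a ^ 2 = f x t ^ p := hsq x
      have e1 : f x t ^ (p - 2) * ‖fx f x t‖ ^ 2 * Ψ x ^ 2 = (Ψ x * (f x t ^ (p / 2 - 1) * ‖fx f x t‖)) ^ 2 := by
        rw [← hb]; ring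
      rw [e1, ← hsqx]
      have e2 : p ^ 2 = |p| ^ 2 := (sq_abs p).symm
      rw [e2]
      nlinarith [sq_nonneg (a * L - Ψ x * (|p| / 2 * f x t ^ (p / 2 - 1) * ‖fx f x t‖))]
    · intro x hx
      have : (fun x => f x t ^ (p / 2) * Ψ x) =ᶠ[nhds x] fun _ => 0 := by
        filter_upwards [isClosed_closedBall.isOpen_compl.mem_nhds hx] with y hy
        simp [hΨ.supp y hy]
      rw [this.fderiv_eq]; simp
  rw [L2] at key
  refine L1.trans (key.trans ?_)
  have : 0 ≤ ∫ x in closedBall (0 : E N) ρ, f x t ^ p * Ψ x ^ 2 :=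
    integral_nonneg fun x => by have := (hpos x t).le; positivity
  gcongr

end step2

section step3
variable {N : ℕ} {c C pb S : ℝ} {f : E N → ℝ → ℝ}

lemma Icyl_nonneg (hpos : ∀ x t, 0 < f x t) {θ : ℝ} (h : tau θ ≤ S) (p : ℝ) : 0 ≤ Icyl N f S θ p :=
  intervalIntegral.integral_nonneg h fun t _ => integral_nonneg fun x => Real.rpow_nonneg (hpos x t).le _

lemma tau_le {θ : ℝ} (h : 1 / 2 ≤ θ) (hS : 3 / 4 < S) : tau θ ≤ S := by unfold tau; linarith

lemma GoodF.sup_bound (hf : GoodF N c C pb S f) (hC : 0 < C) (hc : 0 < c) (hS : 3 / 4 < S)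
    {p : ℝ} (hp : 0 < p) (hpb : p ≤ pb)
    {Ψ : E N → ℝ} {θ' θ L : ℝ} (h0 : 1 / 2 ≤ θ') (h1 : θ' < θ) (h2 : θ ≤ 1) (hΨ : Cut N Ψ θ L) :
    ∀ t2 ∈ Icc (tau θ') S,
    (∫ x in closedBall (0 : E N) θ, f x t2 ^ p * Ψ x ^ 2) +
      p * c * (∫ t in (tau θ')..t2, ∫ x in closedBall (0 : E N) θ, f x t ^ (p - 2) * ‖fx f x t‖ ^ 2 * Ψ x ^ 2) ≤
    (1 / (θ - θ') + p * (C * L ^ 2)) * Icyl N f S θ p := by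
  intro t2 ht2
  have hcΨ : Continuous (fun p : E N × ℝ => Ψ p.1) := hΨ.smooth.continuous.comp continuous_fst
  have hcp := cont_pow hf.smooth hf.pos
  have hcx := cont_fx hf.smooth
  have cg := cont_int (F := fun x t => f x t ^ p * Ψ x ^ 2) ((hcp p).mul (hcΨ.pow 2)) θ
  have ce := cont_int (F := fun x t => f x t ^ (p - 2) * ‖fx f x t‖ ^ 2 * Ψ x ^ 2)
    (((hcp _).mul (hcx.norm.pow 2)).mul (hcΨ.pow 2)) θ
  have cj := cont_int (F := fun x t => f x t ^ p) (hcp p) θ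
  have htt : tau θ ≤ tau θ' := by unfold tau; linarith
  have ht0 : 0 ≤ tau θ := by unfold tau; linarith
  have ht'S : tau θ' ≤ S := tau_le h0 hS
  obtain ⟨t1, ht1, hmin⟩ := isCompact_Icc.exists_isMinOn (nonempty_Icc.2 htt) cg.continuousOn
  have hj0 : ∀ t, 0 ≤ ∫ x in closedBall (0 : E N) θ, f x t ^ p := fun t =>
    integral_nonneg fun x => Real.rpow_nonneg (hf.pos x t).le _
  have he0 : ∀ t, 0 ≤ ∫ x in closedBall (0 : E N) θ, f x t ^ (p - 2) * ‖fx f x t‖ ^ 2 * Ψ x ^ 2 := fun t =>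
    integral_nonneg fun x => by have := (hf.pos x t).le; positivity
  have hgj : ∀ t, (∫ x in closedBall (0 : E N) θ, f x t ^ p * Ψ x ^ 2) ≤ ∫ x in closedBall (0 : E N) θ, f x t ^ p := by
    intro t
    refine setIntegral_mono (int_ball (slice_x (F := fun x t => f x t ^ p * Ψ x ^ 2) ((hcp p).mul (hcΨ.pow 2)) t) θ)
      (int_ball (slice_x (F := fun x t => f x t ^ p) (hcp p) t) θ) fun x => ?_
    have := Real.rpow_nonneg (hf.pos x t).le p
    have h3 : Ψ x ^ 2 ≤ 1 := pow_le_one₀ (hΨ.nonneg x) (hΨ.le_one x)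
    simp only
    nlinarith
  have sub : ∀ a b, tau θ ≤ a → a ≤ b → b ≤ S → (∫ t in a..b, ∫ x in closedBall (0 : E N) θ, f x t ^ p) ≤ Icyl N f S θ p := by
    intro a b ha hab hb
    exact intervalIntegral.integral_mono_interval ha hab hb (.of_forall hj0) (cj.intervalIntegrable _ _)
  have avg : (θ - θ') * (∫ x in closedBall (0 : E N) θ, f x t1 ^ p * Ψ x ^ 2) ≤ Icyl N f S θ p := by
    have m1 := intervalIntegral.integral_mono_on (μ := volume) htt
      (intervalIntegrable_const (c := ∫ x in closedBall (0 : E N) θ, f x t1 ^ p * Ψ x ^ 2))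
      (cj.intervalIntegrable (tau θ) (tau θ')) (fun t ht => (hmin ht).trans (hgj t))
    rw [intervalIntegral.integral_const, smul_eq_mul] at m1
    have m2 := sub _ _ le_rfl htt ht'S
    have g0 : 0 ≤ ∫ x in closedBall (0 : E N) θ, f x t1 ^ p * Ψ x ^ 2 :=
      integral_nonneg fun x => by have := (hf.pos x t1).le; positivity
    have : θ - θ' ≤ tau θ' - tau θ := by unfold tau; linarith
    nlinarith
  have en := hf.energy hp hpb hΨ (by linarith) (ht0.trans ht1.1) (ht1.2.trans ht2.1) ht2.2
  have s1 := sub t1 t2 ht1.1 (ht1.2.trans ht2.1) ht2.2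
  have s2 : (∫ t in (tau θ')..t2, ∫ x in closedBall (0 : E N) θ, f x t ^ (p - 2) * ‖fx f x t‖ ^ 2 * Ψ x ^ 2) ≤
     ∫ t in t1..t2, ∫ x in closedBall (0 : E N) θ, f x t ^ (p - 2) * ‖fx f x t‖ ^ 2 * Ψ x ^ 2 :=
    intervalIntegral.integral_mono_interval ht1.2 ht2.1 le_rfl (.of_forall he0) (ce.intervalIntegrable _ _)
  have s3 : (∫ x in closedBall (0 : E N) θ, f x t1 ^ p * Ψ x ^ 2) ≤ 1 / (θ - θ') * Icyl N f S θ p := by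
    have : 0 < θ - θ' := by linarith
    rw [div_mul_eq_mul_div, le_div_iff₀ this]; linarith
  have s4 := mul_le_mul_of_nonneg_left s1 (show 0 ≤ p * (C * L ^ 2) by positivity)
  have s5 := mul_le_mul_of_nonneg_left s2 (show 0 ≤ p * c by positivity)
  rw [add_mul]
  linarith

lemma GoodF.pre_step (hf : GoodF N c C pb S f) (hC : 0 < C) (hc : 0 < c) (hS : 3 / 4 < S) (hN : 2 ≤ N)
    {Cs : ℝ} (hCs : 0 < Cs)
    (hsob : ∀ w : E N → ℝ, ContDiff ℝ 1 w → HasCompactSupport w →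
      ∫ x, |w x| ^ (2 * (1 + 2 / (N : ℝ))) ≤
      Cs * ((∫ x, w x ^ 2) ^ (2 / (N : ℝ)) * ∫ x, ‖fderiv ℝ w x‖ ^ 2))
    {p : ℝ} (hp : 0 < p) (hpb : p ≤ pb)
    {Ψ : E N → ℝ} {θ' θ L : ℝ} (h0 : 1 / 2 ≤ θ') (h1 : θ' < θ) (h2 : θ ≤ 1) (hΨ : Cut N Ψ θ L)
    (hΨ1 : ∀ x ∈ closedBall (0 : E N) θ', Ψ x = 1) {A : ℝ}
    (hA : A = (1 / (θ - θ') + p * (C * L ^ 2)) * Icyl N f S θ p) :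
    Icyl N f S θ' ((1 + 2 / (N : ℝ)) * p) ≤
      Cs * (A ^ (2 / (N : ℝ)) * (p / (2 * c) * A + 2 * L ^ 2 * Icyl N f S θ p)) := by
  have hN0 : (0:ℝ) < N := by exact_mod_cast (by omega : 0 < N)
  have sb := hf.sup_bound hC hc hS hp hpb h0 h1 h2 hΨ
  rw [← hA] at sb
  have hcΨ : Continuous (fun p : E N × ℝ => Ψ p.1) := hΨ.smooth.continuous.comp continuous_fst
  have hcp := cont_pow hf.smooth hf.pos
  have hcx := cont_fx hf.smooth
  have ce := cont_int (F := fun x t => f x t ^ (p - 2) * ‖fx f x t‖ ^ 2 * Ψ x ^ 2)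
    (((hcp _).mul (hcx.norm.pow 2)).mul (hcΨ.pow 2)) θ
  have cj := cont_int (F := fun x t => f x t ^ p) (hcp p) θ
  have ck := cont_int (F := fun x t => f x t ^ ((1 + 2 / (N : ℝ)) * p)) (hcp _) θ'
  have ht'S : tau θ' ≤ S := tau_le h0 hS
  have htt : tau θ ≤ tau θ' := by unfold tau; linarith
  have hj0 : ∀ t, 0 ≤ ∫ x in closedBall (0 : E N) θ, f x t ^ p := fun t =>
    integral_nonneg fun x => Real.rpow_nonneg (hf.pos x t).le _
  have he0 : ∀ t, 0 ≤ ∫ x in closedBall (0 : E N) θ, f x t ^ (p - 2) * ‖fx f x t‖ ^ 2 * Ψ x ^ 2 := fun t =>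
    integral_nonneg fun x => by have := (hf.pos x t).le; positivity
  have hg0 : ∀ t, 0 ≤ ∫ x in closedBall (0 : E N) θ, f x t ^ p * Ψ x ^ 2 := fun t =>
    integral_nonneg fun x => by have := (hf.pos x t).le; positivity
  have hA0 : 0 ≤ A := by
    rw [hA]
    have : 0 < θ - θ' := by linarith
    have := Icyl_nonneg (S := S) hf.pos (htt.trans ht'S) p
    positivity
  have hgA : ∀ t ∈ Icc (tau θ') S, (∫ x in closedBall (0 : E N) θ, f x t ^ p * Ψ x ^ 2) ≤ A := by
    intro t ht
    have i0 := intervalIntegral.integral_nonneg (μ := volume) ht.1 (fun u _ => he0 u)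
    have := sb t ht
    have : 0 ≤ p * c * (∫ t in (tau θ')..t, ∫ x in closedBall (0 : E N) θ, f x t ^ (p - 2) * ‖fx f x t‖ ^ 2 * Ψ x ^ 2) := by
      positivity
    linarith
  have heA : p * c * (∫ t in (tau θ')..S, ∫ x in closedBall (0 : E N) θ, f x t ^ (p - 2) * ‖fx f x t‖ ^ 2 * Ψ x ^ 2) ≤ A := by
    have := sb S ⟨ht'S, le_rfl⟩
    have := hg0 S
    linarith
  have cB : Continuous (fun t => p ^ 2 / 2 * ∫ x in closedBall (0 : E N) θ, f x t ^ (p - 2) * ‖fx f x t‖ ^ 2 * Ψ x ^ 2) :=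
    continuous_const.mul ce
  have cD : Continuous (fun t => 2 * L ^ 2 * ∫ x in closedBall (0 : E N) θ, f x t ^ p) :=
    continuous_const.mul cj
  have cF : Continuous (fun t => Cs * A ^ (2 / (N : ℝ)) * (p ^ 2 / 2 * (∫ x in closedBall (0 : E N) θ, f x t ^ (p - 2) * ‖fx f x t‖ ^ 2 * Ψ x ^ 2) +
      2 * L ^ 2 * ∫ x in closedBall (0 : E N) θ, f x t ^ p)) := continuous_const.mul (cB.add cD)
  have mono := intervalIntegral.integral_mono_on (μ := volume) ht'S (ck.intervalIntegrable _ _)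
    (cF.intervalIntegrable _ _) (fun t ht => by
      refine (slice_sob hf.smooth hf.pos hN hCs hsob h1.le hΨ hΨ1 t).trans ?_
      rw [mul_assoc Cs]
      have := hgA t ht
      have := hg0 t
      have := hj0 t
      have := he0 t
      gcongr)
  rw [intervalIntegral.integral_const_mul, intervalIntegral.integral_add (cB.intervalIntegrable _ _)
    (cD.intervalIntegrable _ _), intervalIntegral.integral_const_mul, intervalIntegral.integral_const_mul] at mono
  refine mono.trans ?_
  rw [mul_assoc Cs]
  have j1 : (∫ t in (tau θ')..S, ∫ x in closedBall (0 : E N) θ, f x t ^ p) ≤ Icyl N f S θ p :=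
    intervalIntegral.integral_mono_interval htt ht'S le_rfl (.of_forall hj0) (cj.intervalIntegrable _ _)
  have e1 : p ^ 2 / 2 * (∫ t in (tau θ')..S, ∫ x in closedBall (0 : E N) θ, f x t ^ (p - 2) * ‖fx f x t‖ ^ 2 * Ψ x ^ 2) ≤
      p / (2 * c) * A := by
    have := mul_le_mul_of_nonneg_left heA (show 0 ≤ p / (2 * c) by positivity)
    refine le_trans (le_of_eq ?_) this
    field_simp
  gcongr

lemma GoodF.step (N : ℕ) (hN : 2 ≤ N) {c C : ℝ} (hC : 0 < C) (hc : 0 < c) : ∃ K : ℝ, 1 ≤ K ∧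
    ∀ (pb S : ℝ) (f : E N → ℝ → ℝ), GoodF N c C pb S f → 3 / 4 < S → ∀ p, 0 < p → p ≤ pb →
    ∀ θ' θ, 1 / 2 ≤ θ' → θ' < θ → θ ≤ 1 →
    Icyl N f S θ' ((1 + 2 / (N : ℝ)) * p) ≤
      (K * (1 + p) ^ 2 / (θ - θ') ^ 2 * Icyl N f S θ p) ^ (1 + 2 / (N : ℝ)) := by
  have hN0 : (0:ℝ) < N := by exact_mod_cast (by omega : 0 < N)
  obtain ⟨D, hD1, hD⟩ := exists_cut N
  obtain ⟨Cs, hCs, hsob⟩ := sob N hN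
  set B := 1 + C * D ^ 2 with hB
  have hB0 : 1 ≤ B := by have : 0 ≤ C * D ^ 2 := by positivity
                         linarith
  set K := 1 + B + Cs * (B / (2 * c) + 2 * D ^ 2) with hK
  have hK2 : 0 ≤ Cs * (B / (2 * c) + 2 * D ^ 2) := by positivity
  refine ⟨K, by linarith, ?_⟩
  intro pb S f hf hS p hp hpb θ' θ h0 h1 h2
  obtain ⟨Ψ, hΨ, hΨ1, -⟩ := hD θ' θ (by linarith) h1 (by linarith)
  have pre := hf.pre_step hC hc hS hN hCs hsob hp hpb h0 h1 h2 hΨ hΨ1 rfl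
  refine pre.trans ?_
  have hI0 := Icyl_nonneg (S := S) hf.pos (tau_le (θ := θ) (by linarith) hS) p
  set I := Icyl N f S θ p
  set δ := θ - θ' with hδ
  have hδ0 : 0 < δ := by simp only [hδ]; linarith
  have hδ1 : δ ≤ 1 := by simp only [hδ]; linarith
  set X := (1 + p) ^ 2 / δ ^ 2 * I with hX
  have hX0 : 0 ≤ X := by positivity
  have hA : (1 / δ + p * (C * (D / δ) ^ 2)) ≤ B * (1 + p) / δ ^ 2 := by
    rw [le_div_iff₀ (by positivity)]
    have : (1 / δ + p * (C * (D / δ) ^ 2)) * δ ^ 2 = δ + p * (C * D ^ 2) := by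
      field_simp
    rw [this, hB]
    nlinarith [show 0 ≤ C * D ^ 2 by positivity]
  have hA1 : (1 / δ + p * (C * (D / δ) ^ 2)) * I ≤ B * X := by
    have : B * (1 + p) / δ ^ 2 ≤ B * (1 + p) ^ 2 / δ ^ 2 := by
      gcongr; nlinarith
    calc _ ≤ B * (1 + p) ^ 2 / δ ^ 2 * I := by gcongr; exact hA.trans this
      _ = B * X := by rw [hX]; ring
  have hA2 : p / (2 * c) * ((1 / δ + p * (C * (D / δ) ^ 2)) * I) ≤ B / (2 * c) * X := by
    calc p / (2 * c) * ((1 / δ + p * (C * (D / δ) ^ 2)) * I)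
        ≤ (1 + p) / (2 * c) * ((B * (1 + p) / δ ^ 2) * I) := by gcongr; linarith
      _ = B / (2 * c) * X := by rw [hX]; field_simp
  have hA3 : 2 * (D / δ) ^ 2 * I ≤ 2 * D ^ 2 * X := by
    calc 2 * (D / δ) ^ 2 * I = 2 * D ^ 2 * (1 / δ ^ 2 * I) := by field_simp
      _ ≤ 2 * D ^ 2 * X := by
        rw [hX]; gcongr; nlinarith
  have hA0 : 0 ≤ (1 / δ + p * (C * (D / δ) ^ 2)) * I := by positivity
  calc Cs * (((1 / δ + p * (C * (D / δ) ^ 2)) * I) ^ (2 / (N : ℝ)) *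
        (p / (2 * c) * ((1 / δ + p * (C * (D / δ) ^ 2)) * I) + 2 * (D / δ) ^ 2 * I))
      ≤ Cs * ((K * X) ^ (2 / (N : ℝ)) * (B / (2 * c) * X + 2 * D ^ 2 * X)) := by
        have hKX : (1 / δ + p * (C * (D / δ) ^ 2)) * I ≤ K * X := hA1.trans (by gcongr; linarith)
        exact mul_le_mul_of_nonneg_left (mul_le_mul (Real.rpow_le_rpow hA0 hKX (by positivity)) (add_le_add hA2 hA3)
          (by positivity) (by positivity)) hCs.le
    _ = (K * X) ^ (2 / (N : ℝ)) * (Cs * (B / (2 * c) + 2 * D ^ 2) * X) := by ring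
    _ ≤ (K * X) ^ (2 / (N : ℝ)) * (K * X) := by gcongr; linarith
    _ = (K * X) ^ (1 + 2 / (N : ℝ)) := by
        rw [add_comm, Real.rpow_add_of_nonneg (by positivity) (by positivity) (by norm_num), Real.rpow_one]
    _ = _ := by rw [hX]; congr 1; ring

end step3

section moser

lemma moser_abs {σ K : ℝ} (hσ : 1 < σ) (hK : 1 ≤ K) : ∃ A γ : ℝ, 1 ≤ A ∧ 0 < γ ∧
    ∀ (I : ℝ → ℝ → ℝ) (pb : ℝ), (∀ θ p, 1 / 2 ≤ θ → 0 ≤ I θ p) →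
      (∀ θ' θ p, 1 / 2 ≤ θ' → θ' ≤ θ → θ ≤ 1 → I θ' p ≤ I θ p) →
      (∀ p, 0 < p → p ≤ pb → ∀ θ' θ, 1 / 2 ≤ θ' → θ' < θ → θ ≤ 1 →
        I θ' (σ * p) ≤ (K * (1 + p) ^ 2 / (θ - θ') ^ 2 * I θ p) ^ σ) →
      ∀ (n : ℕ) p, 0 < p → σ ^ n * p ≤ σ * pb → ∀ θ' θ, 1 / 2 ≤ θ' → θ' < θ → θ ≤ 1 →
        I θ' (σ ^ n * p) ≤ (A * ((1 + p) / (θ - θ')) ^ γ * I θ p) ^ (σ ^ n) := by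
  set γ := 2 * σ / (σ - 1) with hγ
  have hσ1 : 0 < σ - 1 := by linarith
  have hγ0 : 0 < γ := by positivity
  have hγ1 : γ * σ = γ + 2 * σ := by rw [hγ]; field_simp; ring
  set X := (2 * σ) ^ γ * (4 * K) ^ σ with hX
  have hX1 : 1 ≤ X := by
    have h1 : 1 ≤ (2 * σ) ^ γ := Real.one_le_rpow (by linarith) hγ0.le
    have h2 : 1 ≤ (4 * K) ^ σ := Real.one_le_rpow (by linarith) (by linarith)
    nlinarith
  set A := X ^ (1 / (σ - 1)) with hA
  have hA1 : 1 ≤ A := Real.one_le_rpow hX1 (by positivity)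
  have hAX : A ^ σ = A * X := by
    rw [hA]
    nth_rewrite 3 [← Real.rpow_one X]
    rw [← Real.rpow_mul (by positivity), ← Real.rpow_add (by positivity)]
    congr 1; field_simp; ring
  refine ⟨A, γ, hA1, hγ0, ?_⟩
  intro I pb I0 Im Is n
  induction n with
  | zero =>
    intro p hp _ θ' θ h1 h2 h3
    simp only [pow_zero, one_mul, Real.rpow_one]
    have : 1 ≤ (1 + p) / (θ - θ') := by
      rw [le_div_iff₀ (by linarith)]; linarith
    have h5 : 1 ≤ A * ((1 + p) / (θ - θ')) ^ γ :=
      one_le_mul_of_one_le_of_one_le hA1 (Real.one_le_rpow this hγ0.le)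
    have := Im θ' θ p h1 h2.le h3
    have := I0 θ p (by linarith)
    nlinarith
  | succ n ih =>
    intro p hp hpb θ' θ h1 h2 h3
    have hσn : 1 ≤ σ ^ n := one_le_pow₀ hσ.le
    have hppb : p ≤ pb := by
      have : σ * p ≤ σ * pb := by
        refine le_trans ?_ hpb
        rw [pow_succ, mul_assoc]
        exact le_mul_of_one_le_left (by positivity) hσn
      exact le_of_mul_le_mul_left this (by linarith)
    set m := (θ' + θ) / 2 with hm
    have e : σ ^ (n + 1) * p = σ ^ n * (σ * p) := by ring
    rw [e] at hpb ⊢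
    have i1 := ih (σ * p) (by positivity) hpb θ' m h1 (by linarith) (by linarith)
    have i2 := Is p hp hppb m θ (by linarith) (by linarith) h3
    have hI0 := I0 θ p (by linarith)
    have hI1 := I0 m (σ * p) (by linarith)
    set δ := θ - θ' with hδ
    have hδ0 : 0 < δ := by linarith
    have em : m - θ' = δ / 2 := by rw [hm, hδ]; ring
    have em2 : θ - m = δ / 2 := by rw [hm, hδ]; ring
    rw [em] at i1
    rw [em2] at i2
    set W := (1 + p) / δ with hW
    have hW0 : 0 < W := by positivity
    have j1 : (1 + σ * p) / (δ / 2) ≤ 2 * σ * W := by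
      rw [hW, div_le_iff₀ (by positivity)]; field_simp; nlinarith
    have j2 : K * (1 + p) ^ 2 / (δ / 2) ^ 2 = 4 * K * W ^ 2 := by
      rw [hW]; field_simp; ring
    rw [j2] at i2
    refine i1.trans ?_
    rw [show σ ^ (n + 1) = σ * σ ^ n by ring, Real.rpow_mul (by positivity)]
    refine Real.rpow_le_rpow (by positivity) ?_ (by positivity)
    calc A * ((1 + σ * p) / (δ / 2)) ^ γ * I m (σ * p)
        ≤ A * (2 * σ * W) ^ γ * (4 * K * W ^ 2 * I θ p) ^ σ := by gcongr
      _ = (A * X) * (W ^ γ * (W ^ 2) ^ σ) * I θ p ^ σ := by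
          rw [Real.mul_rpow (by positivity) (by positivity), Real.mul_rpow (by positivity) hI0,
            Real.mul_rpow (x := 4 * K) (by positivity) (by positivity), hX]
          ring
      _ = (A * W ^ γ * I θ p) ^ σ := by
          rw [Real.mul_rpow (by positivity) hI0, Real.mul_rpow (by positivity) (by positivity), hAX]
          congr 2
          rw [← Real.rpow_natCast W 2, ← Real.rpow_mul hW0.le, ← Real.rpow_add hW0, ← Real.rpow_mul hW0.le, hγ1]
          norm_num

lemma bg_iter {Γ B : ℝ} (hΓ : 0 < Γ) (hB : 0 ≤ B) : ∃ C : ℝ, 0 ≤ C ∧ ∀ φ : ℝ → ℝ,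
    (∀ θ, 1 / 2 ≤ θ → θ ≤ 1 → 0 ≤ φ θ ∧ φ θ ≤ φ 1) →
    (∀ θ' θ, 1 / 2 ≤ θ' → θ' < θ → θ ≤ 1 → φ θ' ≤ 3 / 4 * φ θ + B * (1 / (θ - θ')) ^ Γ) →
    φ (1 / 2) ≤ C := by
  set lam := (6 / 7 : ℝ) ^ (1 / Γ) with hlam
  have hl0 : 0 < lam := by positivity
  have hl1 : lam < 1 := Real.rpow_lt_one (by norm_num) (by norm_num) (by positivity)
  have hlΓ : lam ^ Γ = 6 / 7 := by
    rw [hlam, ← Real.rpow_mul (by norm_num)]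
    rw [one_div_mul_cancel hΓ.ne', Real.rpow_one]
  set B' := B * (1 / (1 - lam)) ^ Γ with hB'
  have hl2 : 0 < 1 - lam := by linarith
  have hB'0 : 0 ≤ B' := by positivity
  refine ⟨2 ^ Γ * (8 * B'), by positivity, ?_⟩
  intro φ hφ hi
  set s := (fun θ => (1 - θ) ^ Γ * φ θ) '' Ico (1 / 2) 1 with hs
  have hbdd : BddAbove s := by
    refine ⟨φ 1, ?_⟩
    rintro _ ⟨θ, hθ, rfl⟩
    have h1 : (1 - θ) ^ Γ ≤ 1 := Real.rpow_le_one (by linarith [hθ.2]) (by linarith [hθ.1]) hΓ.le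
    have h2 : 0 ≤ (1 - θ) ^ Γ := Real.rpow_nonneg (by linarith [hθ.2]) _
    have := hφ θ hθ.1 hθ.2.le
    simp only
    nlinarith
  have hne : s.Nonempty := ⟨_, 1 / 2, ⟨le_rfl, by norm_num⟩, rfl⟩
  have hM : sSup s ≤ 7 / 8 * sSup s + B' := by
    refine csSup_le hne ?_
    rintro _ ⟨θ, hθ, rfl⟩
    have h1 : 0 < 1 - θ := by linarith [hθ.2]
    set θ1 := 1 - lam * (1 - θ) with hθ1
    have e1 : 1 - θ1 = lam * (1 - θ) := by rw [hθ1]; ring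
    have e2 : θ1 - θ = (1 - lam) * (1 - θ) := by rw [hθ1]; ring
    have h2 : θ < θ1 := by nlinarith [mul_pos hl2 h1]
    have h3 : θ1 < 1 := by nlinarith [mul_pos hl0 h1]
    have := hi θ θ1 hθ.1 h2 h3.le
    have hle : (1 - θ1) ^ Γ * φ θ1 ≤ sSup s := le_csSup hbdd ⟨θ1, ⟨hθ.1.trans h2.le, h3⟩, rfl⟩
    rw [e1, Real.mul_rpow hl0.le h1.le, hlΓ] at hle
    rw [e2, show 1 / ((1 - lam) * (1 - θ)) = (1 / (1 - lam)) * (1 / (1 - θ)) by field_simp,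
      Real.mul_rpow (by positivity) (by positivity), ← mul_assoc, ← hB'] at this
    have hp : 0 < (1 - θ) ^ Γ := by positivity
    have e3 : (1 - θ) ^ Γ * (1 / (1 - θ)) ^ Γ = 1 := by
      rw [← Real.mul_rpow h1.le (by positivity), mul_one_div_cancel h1.ne', Real.one_rpow]
    have := mul_le_mul_of_nonneg_left this hp.le
    simp only
    calc _ ≤ _ := this
      _ = 3 / 4 * ((1 - θ) ^ Γ * φ θ1) + B' * ((1 - θ) ^ Γ * (1 / (1 - θ)) ^ Γ) := by ring
      _ ≤ _ := by rw [e3]; linarith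
  have h1 : (1 - 1 / 2 : ℝ) ^ Γ * φ (1 / 2) ≤ sSup s := le_csSup hbdd ⟨1 / 2, ⟨le_rfl, by norm_num⟩, rfl⟩
  have h2 : (2 : ℝ) ^ Γ * (1 - 1 / 2) ^ Γ = 1 := by
    rw [← Real.mul_rpow (by norm_num) (by norm_num)]; norm_num
  calc φ (1 / 2) = 2 ^ Γ * ((1 - 1 / 2) ^ Γ * φ (1 / 2)) := by rw [← mul_assoc, h2, one_mul]
    _ ≤ 2 ^ Γ * (8 * B') := mul_le_mul_of_nonneg_left (by linarith) (by positivity)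

end moser

section cyl
variable {N : ℕ} {S : ℝ} {f : E N → ℝ → ℝ}

lemma Icyl_mono (hf : ContDiff ℝ (⊤ : ℕ∞) (fun p : E N × ℝ => f p.1 p.2)) (hpos : ∀ x t, 0 < f x t)
    (hS : 3 / 4 < S) {θ' θ p : ℝ} (h1 : 1 / 2 ≤ θ') (h2 : θ' ≤ θ) :
    Icyl N f S θ' p ≤ Icyl N f S θ p := by
  have hcp := cont_pow hf hpos p
  have c1 := cont_int (F := fun x t => f x t ^ p) hcp θ'
  have c2 := cont_int (F := fun x t => f x t ^ p) hcp θ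
  refine (intervalIntegral.integral_mono_on (tau_le h1 hS) (c1.intervalIntegrable _ _) (c2.intervalIntegrable _ _)
    (fun t _ => ?_)).trans (intervalIntegral.integral_mono_interval (by unfold tau; linarith) (tau_le h1 hS) le_rfl
      (.of_forall fun t => integral_nonneg fun x => Real.rpow_nonneg (hpos x t).le _) (c2.intervalIntegrable _ _))
  exact setIntegral_mono_set (int_ball (slice_x (F := fun x t => f x t ^ p) hcp t) θ)
    (.of_forall fun x => Real.rpow_nonneg (hpos x t).le _) (closedBall_subset_closedBall h2).eventuallyLE

lemma Icyl_prod (hf : ContDiff ℝ (⊤ : ℕ∞) (fun p : E N × ℝ => f p.1 p.2)) (hpos : ∀ x t, 0 < f x t)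
    (hS : 3 / 4 < S) {θ : ℝ} (p : ℝ) (h1 : 1 / 2 ≤ θ) :
    IntegrableOn (fun z : ℝ × E N => f z.2 z.1 ^ p) (Ioc (tau θ) S ×ˢ closedBall (0 : E N) θ) ∧
    Icyl N f S θ p = ∫ z in Ioc (tau θ) S ×ˢ closedBall (0 : E N) θ, f z.2 z.1 ^ p := by
  have hcp : Continuous (fun z : ℝ × E N => f z.2 z.1 ^ p) := (cont_pow hf hpos p).comp continuous_swap
  have hi : IntegrableOn (fun z : ℝ × E N => f z.2 z.1 ^ p) (Ioc (tau θ) S ×ˢ closedBall (0 : E N) θ) :=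
    (hcp.continuousOn.integrableOn_compact (isCompact_Icc.prod (isCompact_closedBall (0 : E N) θ))).mono_set
      (prod_mono Ioc_subset_Icc_self subset_rfl)
  refine ⟨hi, ?_⟩
  rw [Measure.volume_eq_prod] at hi ⊢
  rw [setIntegral_prod _ hi, Icyl, intervalIntegral.integral_of_le (tau_le h1 hS)]

/-- the superlevel set of `log f` in the big cylinder -/
def badSet (N : ℕ) (f : E N → ℝ → ℝ) (S l : ℝ) : Set (ℝ × E N) :=
  {z | z ∈ Ioc 0 S ×ˢ closedBall (0 : E N) 1 ∧ l < Real.log (f z.2 z.1)}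

lemma interp (hf : ContDiff ℝ (⊤ : ℕ∞) (fun p : E N × ℝ => f p.1 p.2)) (hpos : ∀ x t, 0 < f x t)
    (hS : 3 / 4 < S) {θ p Q l lam : ℝ} (h1 : 1 / 2 ≤ θ) (h2 : θ ≤ 1) (hp : 0 < p) (hpQ : p ≤ Q)
    (hlam : 0 < lam) :
    Icyl N f S θ p ≤ Real.exp (p * l) * volume.real (Ioc 0 S ×ˢ closedBall (0 : E N) 1) +
      lam ^ p * volume.real (badSet N f S l) + lam ^ (p - Q) * Icyl N f S θ Q := by
  obtain ⟨i1, e1⟩ := Icyl_prod hf hpos hS p h1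
  obtain ⟨i2, e2⟩ := Icyl_prod hf hpos hS Q h1
  set U := Ioc (tau θ) S ×ˢ closedBall (0 : E N) θ with hU
  set U1 := Ioc 0 S ×ˢ closedBall (0 : E N) 1 with hU1
  have hUU : U ⊆ U1 := prod_mono (Ioc_subset_Ioc_left (by unfold tau; linarith)) (closedBall_subset_closedBall h2)
  have hcf : Continuous (fun z : ℝ × E N => f z.2 z.1) := hf.continuous.comp continuous_swap
  have hmU1 : MeasurableSet U1 := measurableSet_Ioc.prod measurableSet_closedBall
  have hmB : MeasurableSet (badSet N f S l) := by
    have : MeasurableSet {z : ℝ × E N | l < Real.log (f z.2 z.1)} :=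
      measurableSet_lt measurable_const (Real.measurable_log.comp hcf.measurable)
    exact hmU1.inter this
  have hfinU1 : volume U1 ≠ ⊤ := ne_top_of_le_ne_top
    (isCompact_Icc.prod (isCompact_closedBall (0 : E N) 1)).measure_lt_top.ne
    (measure_mono (prod_mono Ioc_subset_Icc_self subset_rfl) : _ ≤ volume (Icc 0 S ×ˢ closedBall (0 : E N) 1))
  have hfinB : volume (badSet N f S l) ≠ ⊤ := ne_top_of_le_ne_top hfinU1 (measure_mono fun z hz => hz.1)
  have hfinU : volume U ≠ ⊤ := ne_top_of_le_ne_top hfinU1 (measure_mono hUU)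
  have ic : IntegrableOn (fun _ : ℝ × E N => Real.exp (p * l)) U := integrableOn_const hfinU
  have ib : IntegrableOn (fun z : ℝ × E N => (badSet N f S l).indicator (fun _ => lam ^ p) z) U :=
    ((integrable_indicator_iff hmB).2 (integrableOn_const hfinB)).integrableOn
  have icb : IntegrableOn (fun z : ℝ × E N => Real.exp (p * l) + (badSet N f S l).indicator (fun _ => lam ^ p) z) U := ic.add ib
  have hmU : MeasurableSet U := measurableSet_Ioc.prod measurableSet_closedBall
  have mono := setIntegral_mono_on i1 (icb.add (i2.const_mul (lam ^ (p - Q)))) hmU (fun z hz => by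
    have hz1 := hUU hz
    have hfp := hpos z.2 z.1
    have q1 : 0 ≤ lam ^ (p - Q) * f z.2 z.1 ^ Q := by positivity
    have q2 : 0 < lam ^ p := by positivity
    simp only [Pi.add_apply]
    by_cases hb : l < Real.log (f z.2 z.1)
    · rw [indicator_of_mem (show z ∈ badSet N f S l from ⟨hz1, hb⟩)]
      have := Real.exp_pos (p * l)
      by_cases hl : f z.2 z.1 ≤ lam
      · have := Real.rpow_le_rpow hfp.le hl hp.le
        linarith
      · have : f z.2 z.1 ^ p ≤ lam ^ (p - Q) * f z.2 z.1 ^ Q := by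
          calc f z.2 z.1 ^ p = f z.2 z.1 ^ (p - Q) * f z.2 z.1 ^ Q := by
                rw [← Real.rpow_add hfp]; congr 1; ring
            _ ≤ _ := by
                gcongr ?_ * _
                exact Real.rpow_le_rpow_of_nonpos hlam (not_le.1 hl).le (by linarith)
        linarith
    · rw [indicator_of_notMem (show z ∉ badSet N f S l from fun h => hb h.2)]
      have : f z.2 z.1 ^ p ≤ Real.exp (p * l) := by
        rw [Real.rpow_def_of_pos hfp, Real.exp_le_exp, mul_comm]
        gcongr; exact not_lt.1 hb
      linarith)
  simp only [Pi.add_apply] at mono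
  rw [integral_add icb (i2.const_mul _), integral_add ic ib, setIntegral_const, integral_const_mul, ← e1, ← e2,
    integral_indicator hmB, Measure.restrict_restrict hmB, setIntegral_const, smul_eq_mul, smul_eq_mul] at mono
  refine mono.trans ?_
  have m1 : volume.real U ≤ volume.real U1 := measureReal_mono hUU hfinU1
  have m2 : volume.real (badSet N f S l ∩ U) ≤ volume.real (badSet N f S l) := measureReal_mono inter_subset_left hfinB
  rw [mul_comm (volume.real U), mul_comm (volume.real _) (lam ^ p)]
  gcongr

end cyl

section bg

lemma bg_core {σ A γ Cc M0 q0 Q φ δ : ℝ} (hσ : 1 < σ) (hA : 1 ≤ A) (hγ : 0 < γ) (hCc : 1 ≤ Cc) (hq0 : 1 ≤ Cc * q0)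
    (hq00 : 0 < q0) (hQ : q0 ≤ Q) (hM0 : 0 ≤ M0) (hδ : 0 < δ) (hδ1 : δ ≤ 1) {J : ℝ} {Iθ : ℝ → ℝ}
    (hI0 : ∀ p, 0 ≤ Iθ p) (hJ : J ≤ Real.exp (Q * φ)) (hJ0 : 0 ≤ J) (hIQ : Iθ Q ≤ Real.exp (Q * φ))
    (hint : ∀ p lam, 0 < p → p ≤ Q → 0 < lam → 0 < φ →
      Iθ p ≤ Real.exp (p * (φ / 2)) * M0 + lam ^ p * (2 * Cc / φ) + lam ^ (p - Q) * Iθ Q)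
    (hmos : ∀ (n : ℕ) p, 0 < p → σ ^ n * p = Q → J ≤ (A * ((1 + p) / δ) ^ γ * Iθ p) ^ (σ ^ n)) (hφ : 0 ≤ φ) :
    J ≤ Real.exp (Q * (3 / 4 * φ + 2 * Cc * (Real.exp 1 * (A * 2 ^ γ * (M0 + 2))) ^ (4 * σ) * (1 / δ) ^ (4 * σ * γ))) := by
  have hQ0 : 0 < Q := by linarith
  set Y := A * 2 ^ γ * (M0 + 2) * (1 / δ) ^ γ with hY
  have hY1 : 1 ≤ Y := by
    have h1 : (1:ℝ) ≤ 2 ^ γ := Real.one_le_rpow (by norm_num) hγ.le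
    have h2 : 1 ≤ (1 / δ) ^ γ := Real.one_le_rpow (by rw [le_div_iff₀ hδ]; linarith) hγ.le
    have h3 : 1 ≤ M0 + 2 := by linarith
    exact one_le_mul_of_one_le_of_one_le (one_le_mul_of_one_le_of_one_le (one_le_mul_of_one_le_of_one_le hA h1) h3) h2
  have hYe : (Real.exp 1 * (A * 2 ^ γ * (M0 + 2))) ^ (4 * σ) * (1 / δ) ^ (4 * σ * γ) = (Real.exp 1 * Y) ^ (4 * σ) := by
    rw [mul_comm (4 * σ) γ, Real.rpow_mul (by positivity) γ, ← Real.mul_rpow (by positivity) (by positivity), hY]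
    congr 1; ring
  rw [mul_assoc (2 * Cc), hYe]
  by_cases hc : φ ≤ 2 * Cc * (Real.exp 1 * Y) ^ (4 * σ)
  · refine hJ.trans ?_
    gcongr; linarith
  push Not at hc
  have hP1 : 1 ≤ (Real.exp 1 * Y) ^ (4 * σ) := Real.one_le_rpow
    (one_le_mul_of_one_le_of_one_le (Real.one_le_exp (by norm_num)) hY1) (by linarith)
  have hφ0 : 0 < φ := by nlinarith
  set r := Real.log (φ / (2 * Cc)) with hr
  have hlY : 0 ≤ Real.log Y := Real.log_nonneg hY1
  have hr1 : 4 * σ * (1 + Real.log Y) < r := by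
    have : (Real.exp 1 * Y) ^ (4 * σ) < φ / (2 * Cc) := by
      rw [lt_div_iff₀ (by linarith)]; linarith
    have h2 := Real.log_lt_log (by positivity) this
    rw [Real.log_rpow (by positivity), Real.log_mul (by positivity) (by positivity), Real.log_exp] at h2
    exact h2
  have hr0 : 0 < r := by nlinarith
  have her : Real.exp (-r) = 2 * Cc / φ := by
    rw [Real.exp_neg, hr, Real.exp_log (by positivity), inv_div]
  set p0 := r / φ with hp0
  have hp00 : 0 < p0 := by positivity
  have hp0a : p0 * (2 * Cc) ≤ 1 := by
    have h1 : r ≤ φ / (2 * Cc) := by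
      have := Real.log_le_sub_one_of_pos (show 0 < φ / (2 * Cc) by positivity)
      linarith
    rw [hp0, div_mul_eq_mul_div, div_le_one hφ0]
    rwa [le_div_iff₀ (by positivity)] at h1
  have hp1 : p0 ≤ 1 := by nlinarith
  have hpq : 2 * p0 ≤ Q := by
    have : 2 * p0 * Cc ≤ q0 * Cc := by nlinarith
    have := le_of_mul_le_mul_right this (by linarith)
    linarith
  obtain ⟨n, hn1, hn2⟩ := exists_nat_pow_near (x := Q / p0) (by rw [le_div_iff₀ hp00]; linarith) hσ
  have hsn : 0 < σ ^ (n + 1) := by positivity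
  set p := Q / σ ^ (n + 1) with hp
  have hpp : 0 < p := by positivity
  have hpe : σ ^ (n + 1) * p = Q := by rw [hp]; field_simp
  have hple : p ≤ p0 := by
    rw [hp, div_le_iff₀ hsn]
    rw [div_lt_iff₀ hp00] at hn2; linarith
  have hpge : p0 ≤ σ * p := by
    have : σ * p = Q / σ ^ n := by rw [hp, pow_succ]; field_simp
    rw [this, le_div_iff₀ (by positivity)]
    rw [le_div_iff₀ hp00] at hn1; linarith
  have hpφ : p * φ ≤ r := by
    calc p * φ ≤ p0 * φ := by gcongr
      _ = r := by rw [hp0]; field_simp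
  have hkey : p * φ + p * r / Q - r ≤ p * (φ / 2) := by
    have h1 : p / Q ≤ 1 / 2 := by rw [div_le_iff₀ hQ0]; linarith
    have h2 : p * r / Q = p / Q * r := by ring
    rw [h2]
    have : p / Q * r ≤ 1 / 2 * r := by gcongr
    linarith
  have hi := hint p (Real.exp (φ + r / Q)) hpp (by linarith) (Real.exp_pos _) hφ0
  rw [← Real.exp_mul, ← Real.exp_mul, ← her, ← Real.exp_add] at hi
  have hi2 : Iθ p ≤ (M0 + 2) * Real.exp (p * (φ / 2)) := by
    have a1 : Real.exp ((φ + r / Q) * p + -r) ≤ Real.exp (p * (φ / 2)) := by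
      rw [Real.exp_le_exp]
      have : (φ + r / Q) * p + -r = p * φ + p * r / Q - r := by ring
      rwa [this]
    have a2 : Real.exp ((φ + r / Q) * (p - Q)) * Iθ Q ≤ Real.exp (p * (φ / 2)) := by
      calc _ ≤ Real.exp ((φ + r / Q) * (p - Q)) * Real.exp (Q * φ) := by gcongr
        _ = Real.exp (p * φ + p * r / Q - r) := by
          rw [← Real.exp_add]; congr 1; field_simp; ring
        _ ≤ _ := by rwa [Real.exp_le_exp]
    linarith
  have hm := hmos (n + 1) p hpp hpe
  have hbase : A * ((1 + p) / δ) ^ γ * Iθ p ≤ Real.exp (Real.log Y + p * (φ / 2)) := by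
    rw [Real.exp_add, Real.exp_log (by linarith)]
    have : ((1 + p) / δ) ^ γ ≤ 2 ^ γ * (1 / δ) ^ γ := by
      rw [← Real.mul_rpow (by norm_num) (by positivity)]
      refine Real.rpow_le_rpow (by positivity) ?_ hγ.le
      rw [mul_one_div]; gcongr; linarith
    have h0 := hI0 p
    calc _ ≤ A * (2 ^ γ * (1 / δ) ^ γ) * ((M0 + 2) * Real.exp (p * (φ / 2))) := by gcongr
      _ = _ := by rw [hY]; ring
  refine hm.trans ((Real.rpow_le_rpow (by have := hI0 p; positivity) hbase (by positivity)).trans ?_)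
  rw [← Real.exp_mul, Real.exp_le_exp]
  have hly : Real.log Y ≤ p * (φ / 4) := by
    have : r ≤ σ * (p * φ) := by
      calc r = p0 * φ := by rw [hp0]; field_simp
        _ ≤ σ * p * φ := by gcongr
        _ = _ := by ring
    have h3 : σ * (4 * (1 + Real.log Y)) ≤ σ * (p * φ) := by linarith
    have := le_of_mul_le_mul_left h3 (by linarith)
    linarith
  have hB0 : 0 ≤ 2 * Cc * (Real.exp 1 * Y) ^ (4 * σ) := by positivity
  calc (Real.log Y + p * (φ / 2)) * σ ^ (n + 1) ≤ (p * (3 / 4 * φ)) * σ ^ (n + 1) := by gcongr; linarith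
    _ = Q * (3 / 4 * φ) := by rw [← hpe]; ring
    _ ≤ _ := by gcongr; linarith

lemma le_exp_phi {I Q : ℝ} (hI : 0 ≤ I) (hQ : 0 < Q) : I ≤ Real.exp (Q * max (Real.log I / Q) 0) := by
  rcases hI.eq_or_lt with h | h
  · rw [← h]; positivity
  · calc I = Real.exp (Real.log I) := (Real.exp_log h).symm
      _ ≤ _ := by
        rw [Real.exp_le_exp]
        calc Real.log I = Q * (Real.log I / Q) := by field_simp
          _ ≤ _ := by gcongr; exact le_max_left _ _

lemma phi_le {I Q B : ℝ} (hI : 0 ≤ I) (hQ : 0 < Q) (hB : 0 ≤ B) (h : I ≤ Real.exp (Q * B)) :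
    max (Real.log I / Q) 0 ≤ B := by
  refine max_le ?_ hB
  rw [div_le_iff₀ hQ]
  rcases hI.eq_or_lt with h0 | h0
  · rw [← h0, Real.log_zero]; positivity
  · have := Real.log_le_log h0 h
    rw [Real.log_exp] at this; linarith

lemma bg (N : ℕ) (hN : 2 ≤ N) {c C c0 q0 : ℝ} (hC : 0 < C) (hc : 0 < c) (hq0 : 0 < q0) :
    ∃ B : ℝ, 0 ≤ B ∧ ∀ (pb S : ℝ) (f : E N → ℝ → ℝ) (Q : ℝ), GoodF N c C pb S f → 3 / 4 < S → S ≤ 1 → q0 ≤ Q →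
      Q ≤ (1 + 2 / (N : ℝ)) * pb → (∀ l, 0 < l → volume.real (badSet N f S l) ≤ c0 / l) →
      Icyl N f S (1 / 2) Q ≤ Real.exp (Q * B) := by
  have hN0 : (0:ℝ) < N := by exact_mod_cast (by omega : 0 < N)
  obtain ⟨K, hK1, hK⟩ := GoodF.step N hN hC hc
  set σ := 1 + 2 / (N : ℝ) with hσd
  have hσ : 1 < σ := by have : 0 < 2 / (N : ℝ) := by positivity
                        linarith
  obtain ⟨A, γ, hA, hγ, hmos⟩ := moser_abs hσ hK1
  set M0 := volume.real (Ioc (0:ℝ) 1 ×ˢ closedBall (0 : E N) 1) with hM0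
  set Cc := max (max 1 c0) (1 / q0) with hCc
  have hCc1 : 1 ≤ Cc := (le_max_left _ _).trans (le_max_left _ _)
  have hCc2 : c0 ≤ Cc := (le_max_right _ _).trans (le_max_left _ _)
  have hCc3 : 1 ≤ Cc * q0 := by
    have : 1 / q0 ≤ Cc := le_max_right _ _
    rwa [div_le_iff₀ hq0] at this
  have hM00 : 0 ≤ M0 := measureReal_nonneg
  obtain ⟨B, hB0, hB⟩ := bg_iter (Γ := 4 * σ * γ) (B := 2 * Cc * (Real.exp 1 * (A * 2 ^ γ * (M0 + 2))) ^ (4 * σ))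
    (by positivity) (by positivity)
  refine ⟨B, hB0, ?_⟩
  intro pb S f Q hf hS hS1 hQ hQpb hbad
  have hQ0 : 0 < Q := by linarith
  have I0 : ∀ θ p, 1 / 2 ≤ θ → 0 ≤ Icyl N f S θ p := fun θ p h => Icyl_nonneg hf.pos (tau_le h hS) p
  have Im : ∀ θ' θ p, 1 / 2 ≤ θ' → θ' ≤ θ → θ ≤ 1 → Icyl N f S θ' p ≤ Icyl N f S θ p :=
    fun θ' θ p h1 h2 h3 => Icyl_mono hf.smooth hf.pos hS h1 h2
  have hm := hmos (Icyl N f S) pb I0 Im (fun p hp hpb θ' θ h1 h2 h3 => hK pb S f hf hS p hp hpb θ' θ h1 h2 h3)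
  set φ : ℝ → ℝ := fun θ => max (Real.log (Icyl N f S θ Q) / Q) 0 with hφ
  have hφI : ∀ θ, 1 / 2 ≤ θ → Icyl N f S θ Q ≤ Real.exp (Q * φ θ) := fun θ h => le_exp_phi (I0 θ Q h) hQ0
  have hφ0 : ∀ θ, 0 ≤ φ θ := fun θ => le_max_right _ _
  have hvol : volume.real (Ioc 0 S ×ˢ closedBall (0 : E N) 1) ≤ M0 := by
    refine measureReal_mono (prod_mono (Ioc_subset_Ioc_right hS1) subset_rfl) (ne_top_of_le_ne_top
    (isCompact_Icc.prod (isCompact_closedBall (0 : E N) 1)).measure_lt_top.ne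
    (measure_mono (prod_mono Ioc_subset_Icc_self subset_rfl) : _ ≤ volume (Icc (0:ℝ) 1 ×ˢ closedBall (0 : E N) 1)))
  have fin := hB φ (fun θ h1 h2 => ⟨hφ0 θ, phi_le (I0 θ Q h1) hQ0 (hφ0 1)
      ((Im θ 1 Q h1 h2 le_rfl).trans (hφI 1 (by norm_num)))⟩) (by
    intro θ' θ h1 h2 h3
    have hθ : 1 / 2 ≤ θ := by linarith
    have hd0 : 0 < θ - θ' := by linarith
    refine phi_le (I0 θ' Q h1) hQ0 (add_nonneg (mul_nonneg (by norm_num) (hφ0 θ)) (by positivity)) ?_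
    refine bg_core (q0 := q0) (Iθ := Icyl N f S θ) hσ hA hγ hCc1 hCc3 hq0 hQ hM00 hd0 (by linarith) (fun p => I0 θ p hθ)
      ((Im θ' θ Q h1 h2.le h3).trans (hφI θ hθ)) (I0 θ' Q h1) (hφI θ hθ) ?_ ?_ (hφ0 θ)
    · intro p lam hp hpQ hlam hph
      refine (interp hf.smooth hf.pos hS (l := φ θ / 2) hθ h3 hp hpQ hlam).trans ?_
      have hb : volume.real (badSet N f S (φ θ / 2)) ≤ 2 * Cc / φ θ := by
        refine (hbad _ (by linarith)).trans ?_
        rw [div_div_eq_mul_div, mul_comm c0]; gcongr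
      have := I0 θ Q hθ
      gcongr
    · intro n p hp hn
      rw [← hn]
      exact hm n p hp (by rw [hn]; exact hQpb) θ' θ h1 h2 h3)
  exact (hφI _ le_rfl).trans (by gcongr)

end bg

section poincare
variable {N : ℕ}

lemma cswap {X Y : Type*} [TopologicalSpace X] [TopologicalSpace Y] [MeasurableSpace X] [MeasurableSpace Y]
    [OpensMeasurableSpace X] [OpensMeasurableSpace Y] [SecondCountableTopology X] [SecondCountableTopology Y]
    {μ : Measure X} {ν : Measure Y} [IsLocallyFiniteMeasure μ] [IsLocallyFiniteMeasure ν] [SFinite μ] [SFinite ν]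
    [T2Space X] [T2Space Y]
    {s : Set X} {t : Set Y} (hs : IsCompact s) (ht : IsCompact t) {F : X → Y → ℝ}
    (hF : Continuous (fun p : X × Y => F p.1 p.2)) :
    ∫ x in s, ∫ y in t, F x y ∂ν ∂μ = ∫ y in t, ∫ x in s, F x y ∂μ ∂ν := by
  refine integral_integral_swap ?_
  rw [Measure.prod_restrict]
  exact hF.continuousOn.integrableOn_compact (hs.prod ht)

lemma aff_int {g : E N → ℝ} (hg : Continuous g) (hgs : HasCompactSupport g) (hg0 : ∀ x, 0 ≤ g x) {τ : ℝ}
    (h1 : 1 / 2 ≤ τ) (b : E N) (s : Set (E N)) :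
    ∫ x in s, g (τ • x + b) ≤ 2 ^ N * ∫ x, g x := by
  have hi : Integrable g := hg.integrable_of_hasCompactSupport hgs
  have hi2 : Integrable (fun x => g (τ • x + b)) := (hi.comp_add_right b).comp_smul (by linarith : τ ≠ 0)
  refine (setIntegral_le_integral hi2 (.of_forall fun x => hg0 _)).trans ?_
  rw [Measure.integral_comp_smul volume (fun x => g (x + b)) τ, integral_add_right_eq_self, finrank_euclideanSpace,
    Fintype.card_fin, smul_eq_mul]
  have h0 : 0 ≤ ∫ x, g x := integral_nonneg hg0
  gcongr
  rw [abs_of_nonneg (by positivity), ← inv_pow]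
  gcongr
  rw [inv_le_comm₀ (by linarith) (by norm_num)]; linarith

lemma dbl_int {g : E N → ℝ} (hg : Continuous g) (hgs : HasCompactSupport g) (hg0 : ∀ x, 0 ≤ g x) {τ : ℝ} (ρ : ℝ) :
    ∫ x in closedBall (0 : E N) ρ, ∫ y in closedBall (0 : E N) ρ, g (τ • x + (1 - τ) • y) ≤
      volume.real (closedBall (0 : E N) ρ) * (2 ^ N * ∫ x, g x) := by
  have hc : Continuous (fun p : E N × E N => g (τ • p.1 + (1 - τ) • p.2)) := by fun_prop
  have hB := isCompact_closedBall (0 : E N) ρ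
  have key : ∀ G : E N → E N → ℝ, Continuous (fun p : E N × E N => G p.1 p.2) →
      (∀ y, ∫ x in closedBall (0 : E N) ρ, G y x ≤ 2 ^ N * ∫ x, g x) →
      ∫ y in closedBall (0 : E N) ρ, ∫ x in closedBall (0 : E N) ρ, G y x ≤
      volume.real (closedBall (0 : E N) ρ) * (2 ^ N * ∫ x, g x) := by
    intro G hG h
    have hcc : Continuous (fun y => ∫ x in closedBall (0 : E N) ρ, G y x) :=
      continuous_parametric_integral_of_continuous (f := G) hG hB
    have := setIntegral_mono (int_ball hcc ρ) (integrableOn_const (C := 2 ^ N * ∫ x, g x) measure_closedBall_lt_top.ne) h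
    rwa [setIntegral_const, smul_eq_mul] at this
  by_cases h : 1 / 2 ≤ τ
  · rw [cswap hB hB hc]
    refine key (fun y x => g (τ • x + (1 - τ) • y)) (hc.comp continuous_swap) fun y => ?_
    exact aff_int hg hgs hg0 h _ _
  · refine key (fun x y => g (τ • x + (1 - τ) • y)) hc fun y => ?_
    simp_rw [add_comm (τ • y)]
    exact aff_int hg hgs hg0 (by linarith) _ _

lemma trip_int {g : E N → ℝ} (hg : Continuous g) (hgs : HasCompactSupport g) (hg0 : ∀ x, 0 ≤ g x) (ρ : ℝ) :
    ∫ x in closedBall (0 : E N) ρ, ∫ y in closedBall (0 : E N) ρ, ∫ τ in Icc (0:ℝ) 1, g (τ • x + (1 - τ) • y) ≤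
      volume.real (closedBall (0 : E N) ρ) * (2 ^ N * ∫ x, g x) := by
  have hB := isCompact_closedBall (0 : E N) ρ
  have hI : IsCompact (Icc (0:ℝ) 1) := isCompact_Icc
  have e1 : ∀ x, ∫ y in closedBall (0 : E N) ρ, ∫ τ in Icc (0:ℝ) 1, g (τ • x + (1 - τ) • y) =
      ∫ τ in Icc (0:ℝ) 1, ∫ y in closedBall (0 : E N) ρ, g (τ • x + (1 - τ) • y) := fun x =>
    cswap hB hI (F := fun y τ => g (τ • x + (1 - τ) • y)) (by fun_prop)
  simp_rw [e1]
  have hc2 : Continuous (fun p : E N × ℝ => ∫ y in closedBall (0 : E N) ρ, g (p.2 • p.1 + (1 - p.2) • y)) :=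
    continuous_parametric_integral_of_continuous (f := fun (p : E N × ℝ) y => g (p.2 • p.1 + (1 - p.2) • y))
      (by simp only [Function.uncurry_def]; fun_prop) hB
  rw [cswap hB hI (F := fun x τ => ∫ y in closedBall (0 : E N) ρ, g (τ • x + (1 - τ) • y)) hc2]
  have hc3 : Continuous (fun τ : ℝ => ∫ x in closedBall (0 : E N) ρ, ∫ y in closedBall (0 : E N) ρ, g (τ • x + (1 - τ) • y)) :=
    cont_int (F := fun x τ => ∫ y in closedBall (0 : E N) ρ, g (τ • x + (1 - τ) • y)) hc2 ρ
  have := setIntegral_mono (μ := volume) (hc3.continuousOn.integrableOn_compact hI)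
    (integrableOn_const (C := volume.real (closedBall (0 : E N) ρ) * (2 ^ N * ∫ x, g x)) hI.measure_lt_top.ne)
    (fun τ => dbl_int hg hgs hg0 ρ)
  simpa using this

lemma cs_unit {k : ℝ → ℝ} (hk : Continuous k) : (∫ τ in (0:ℝ)..1, k τ) ^ 2 ≤ ∫ τ in (0:ℝ)..1, k τ ^ 2 := by
  set m := ∫ τ in (0:ℝ)..1, k τ with hm
  have c1 : Continuous (fun τ => k τ ^ 2) := hk.pow 2
  have c2 : Continuous (fun τ => 2 * m * k τ) := continuous_const.mul hk
  have c3 : Continuous (fun τ => k τ ^ 2 - 2 * m * k τ) := c1.sub c2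
  have h : 0 ≤ ∫ τ in (0:ℝ)..1, (k τ ^ 2 - 2 * m * k τ + m ^ 2) :=
    intervalIntegral.integral_nonneg (by norm_num) fun τ _ => by nlinarith [sq_nonneg (k τ - m)]
  rw [intervalIntegral.integral_add (c3.intervalIntegrable _ _) intervalIntegrable_const,
    intervalIntegral.integral_sub (c1.intervalIntegrable _ _) (c2.intervalIntegrable _ _),
    intervalIntegral.integral_const_mul, ← hm, intervalIntegral.integral_const] at h
  simp at h
  nlinarith

lemma seg_bound {h : E N → ℝ} (hh : ContDiff ℝ 1 h) {Ψ : E N → ℝ} {L : ℝ} (hΨ : Cut N Ψ (3 / 2) L)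
    (hrad : ∀ x y : E N, ‖x‖ ≤ ‖y‖ → Ψ y ≤ Ψ x) {x y : E N} (hx : x ∈ closedBall (0 : E N) (3 / 2))
    (hy : y ∈ closedBall (0 : E N) (3 / 2)) :
    (h x - h y) ^ 2 * (Ψ x ^ 2 * Ψ y ^ 2) ≤
      ∫ τ in Icc (0:ℝ) 1, 9 * (‖fderiv ℝ h (τ • x + (1 - τ) • y)‖ ^ 2 * Ψ (τ • x + (1 - τ) • y) ^ 2) := by
  rw [mem_closedBall_zero_iff] at hx hy
  have hcd : Continuous (fderiv ℝ h) := hh.continuous_fderiv (by norm_num)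
  have hcΨ := hΨ.smooth.continuous
  set k : ℝ → ℝ := fun τ => fderiv ℝ h (τ • x + (1 - τ) • y) (x - y) with hk
  have ck : Continuous k := by
    simp only [hk]
    have : Continuous (fun τ : ℝ => fderiv ℝ h (τ • x + (1 - τ) • y)) := hcd.comp (by fun_prop)
    exact this.clm_apply continuous_const
  have hd : ∀ τ : ℝ, HasDerivAt (fun τ : ℝ => h (τ • x + (1 - τ) • y)) (k τ) τ := by
    intro τ
    have h1 : HasDerivAt (fun τ : ℝ => τ • x + (1 - τ) • y) (x - y) τ := by
      have a := (hasDerivAt_id τ).smul_const x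
      have b := ((hasDerivAt_id τ).const_sub 1).smul_const y
      exact (a.add b).congr_deriv (by simp [sub_eq_add_neg])
    exact ((hh.differentiable (by norm_num)) _).hasFDerivAt.comp_hasDerivAt τ h1
  have ftc := intervalIntegral.integral_eq_sub_of_hasDerivAt (a := 0) (b := 1) (fun τ _ => hd τ) (ck.intervalIntegrable _ _)
  simp only [one_smul, sub_self, zero_smul, add_zero, sub_zero, zero_add] at ftc
  have cs := cs_unit ck
  rw [ftc] at cs
  have hw0 : 0 ≤ Ψ x ^ 2 * Ψ y ^ 2 := by positivity
  refine (mul_le_mul_of_nonneg_right cs hw0).trans ?_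
  rw [intervalIntegral.integral_of_le (by norm_num), ← integral_Icc_eq_integral_Ioc, ← integral_mul_const]
  refine setIntegral_mono_on ?_ ?_ measurableSet_Icc fun τ hτ => ?_
  · exact ((ck.pow 2).mul continuous_const).continuousOn.integrableOn_compact isCompact_Icc
  · refine Continuous.integrableOn_Icc ?_
    have c1 : Continuous (fun τ : ℝ => fderiv ℝ h (τ • x + (1 - τ) • y)) := hcd.comp (by fun_prop)
    have c2 : Continuous (fun τ : ℝ => Ψ (τ • x + (1 - τ) • y)) := hcΨ.comp (by fun_prop)
    fun_prop
  · have hxy : ‖x - y‖ ≤ 3 := (norm_sub_le _ _).trans (by linarith)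
    have k1 : k τ ^ 2 ≤ ‖fderiv ℝ h (τ • x + (1 - τ) • y)‖ ^ 2 * 9 := by
      have : |k τ| ≤ ‖fderiv ℝ h (τ • x + (1 - τ) • y)‖ * 3 :=
        ((fderiv ℝ h (τ • x + (1 - τ) • y)).le_opNorm (x - y)).trans (by gcongr)
      rw [← sq_abs]
      calc |k τ| ^ 2 ≤ (‖fderiv ℝ h (τ • x + (1 - τ) • y)‖ * 3) ^ 2 := by gcongr
        _ = _ := by ring
    have hz : Ψ x * Ψ y ≤ Ψ (τ • x + (1 - τ) • y) := by
      have hn : ‖τ • x + (1 - τ) • y‖ ≤ max ‖x‖ ‖y‖ := by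
        refine (norm_add_le _ _).trans ?_
        rw [norm_smul, norm_smul, Real.norm_of_nonneg hτ.1, Real.norm_of_nonneg (by linarith [hτ.2])]
        have a1 := le_max_left ‖x‖ ‖y‖
        have a2 := le_max_right ‖x‖ ‖y‖
        have b1 := mul_le_mul_of_nonneg_left a1 hτ.1
        have b2 := mul_le_mul_of_nonneg_left a2 (show 0 ≤ 1 - τ by linarith [hτ.2])
        linarith
      have p1 := hΨ.nonneg x
      have p2 := hΨ.nonneg y
      have p3 := hΨ.le_one x
      have p4 := hΨ.le_one y
      rcases le_total ‖x‖ ‖y‖ with h | h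
      · rw [max_eq_right h] at hn
        have := hrad _ _ hn
        nlinarith
      · rw [max_eq_left h] at hn
        have := hrad _ _ hn
        nlinarith
    have hz2 : Ψ x ^ 2 * Ψ y ^ 2 ≤ Ψ (τ • x + (1 - τ) • y) ^ 2 := by
      rw [← mul_pow]
      have p1 := hΨ.nonneg x
      have p2 := hΨ.nonneg y
      gcongr
    calc _ ≤ (‖fderiv ℝ h (τ • x + (1 - τ) • y)‖ ^ 2 * 9) * Ψ (τ • x + (1 - τ) • y) ^ 2 := by gcongr
      _ = _ := by ring

lemma poincare {h : E N → ℝ} (hh : ContDiff ℝ 1 h) {Ψ : E N → ℝ} {L : ℝ} (hΨ : Cut N Ψ (3 / 2) L)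
    (hrad : ∀ x y : E N, ‖x‖ ≤ ‖y‖ → Ψ y ≤ Ψ x) {W0 H : ℝ}
    (hW : W0 = ∫ x in closedBall (0 : E N) (3 / 2), Ψ x ^ 2)
    (hH : H * W0 = ∫ x in closedBall (0 : E N) (3 / 2), h x * Ψ x ^ 2) :
    2 * W0 * ∫ x in closedBall (0 : E N) (3 / 2), (h x - H) ^ 2 * Ψ x ^ 2 ≤
      volume.real (closedBall (0 : E N) (3 / 2)) * (2 ^ N * 9) *
        ∫ x in closedBall (0 : E N) (3 / 2), ‖fderiv ℝ h x‖ ^ 2 * Ψ x ^ 2 := by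
  have hB := isCompact_closedBall (0 : E N) (3 / 2)
  have hch := hh.continuous
  have hcd : Continuous (fderiv ℝ h) := hh.continuous_fderiv (by norm_num)
  have hcΨ := hΨ.smooth.continuous
  set g : E N → ℝ := fun z => 9 * (‖fderiv ℝ h z‖ ^ 2 * Ψ z ^ 2) with hg
  have cg : Continuous g := by fun_prop
  have g0 : ∀ x, 0 ≤ g x := fun x => by positivity
  have gsupp : ∀ x, x ∉ closedBall (0 : E N) (3 / 2) → g x = 0 := fun x hx => by simp [hg, hΨ.supp x hx]
  have gcs : HasCompactSupport g := HasCompactSupport.intro hB gsupp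
  have T := trip_int cg gcs g0 (3 / 2)
  have eg : ∫ x, g x = 9 * ∫ x in closedBall (0 : E N) (3 / 2), ‖fderiv ℝ h x‖ ^ 2 * Ψ x ^ 2 := by
    rw [← setIntegral_eq_integral_of_forall_compl_eq_zero gsupp, hg, integral_const_mul]
  rw [eg] at T
  have ci : Continuous (fun p : E N × E N => (h p.1 - h p.2) ^ 2 * (Ψ p.1 ^ 2 * Ψ p.2 ^ 2)) := by fun_prop
  have ct : Continuous (fun p : E N × E N => ∫ τ in Icc (0:ℝ) 1, g (τ • p.1 + (1 - τ) • p.2)) :=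
    continuous_parametric_integral_of_continuous (f := fun (p : E N × E N) (τ : ℝ) => g (τ • p.1 + (1 - τ) • p.2))
      (by simp only [Function.uncurry_def]; fun_prop) isCompact_Icc
  have low : ∫ x in closedBall (0 : E N) (3 / 2), ∫ y in closedBall (0 : E N) (3 / 2),
      (h x - h y) ^ 2 * (Ψ x ^ 2 * Ψ y ^ 2) ≤
      ∫ x in closedBall (0 : E N) (3 / 2), ∫ y in closedBall (0 : E N) (3 / 2), ∫ τ in Icc (0:ℝ) 1, g (τ • x + (1 - τ) • y) := by
    have c1 : Continuous (fun x => ∫ y in closedBall (0 : E N) (3 / 2), (h x - h y) ^ 2 * (Ψ x ^ 2 * Ψ y ^ 2)) :=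
      continuous_parametric_integral_of_continuous (f := fun x y => (h x - h y) ^ 2 * (Ψ x ^ 2 * Ψ y ^ 2)) ci hB
    have c2 : Continuous (fun x => ∫ y in closedBall (0 : E N) (3 / 2), ∫ τ in Icc (0:ℝ) 1, g (τ • x + (1 - τ) • y)) :=
      continuous_parametric_integral_of_continuous (f := fun (x y : E N) => ∫ τ in Icc (0:ℝ) 1, g (τ • x + (1 - τ) • y)) ct hB
    refine setIntegral_mono_on (int_ball c1 _) (int_ball c2 _) measurableSet_closedBall fun x hx => ?_
    refine setIntegral_mono_on (int_ball (ci.comp (Continuous.prodMk_right x)) _)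
      (int_ball (ct.comp (Continuous.prodMk_right x)) _) measurableSet_closedBall fun y hy => ?_
    exact seg_bound hh hΨ hrad hx hy
  set M2 := ∫ x in closedBall (0 : E N) (3 / 2), h x ^ 2 * Ψ x ^ 2 with hM2
  have i0 : IntegrableOn (fun x => Ψ x ^ 2) (closedBall (0 : E N) (3 / 2)) := int_ball (by fun_prop) _
  have i1 : IntegrableOn (fun x => h x * Ψ x ^ 2) (closedBall (0 : E N) (3 / 2)) := int_ball (by fun_prop) _
  have i2 : IntegrableOn (fun x => h x ^ 2 * Ψ x ^ 2) (closedBall (0 : E N) (3 / 2)) := int_ball (by fun_prop) _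
  have lin : ∀ a b c : ℝ, ∫ x in closedBall (0 : E N) (3 / 2), (a * (Ψ x ^ 2) + b * (h x * Ψ x ^ 2) + c * (h x ^ 2 * Ψ x ^ 2)) =
      a * W0 + b * (H * W0) + c * M2 := by
    intro a b c
    have i3 : IntegrableOn (fun x => a * Ψ x ^ 2 + b * (h x * Ψ x ^ 2)) (closedBall (0 : E N) (3 / 2)) :=
      (i0.const_mul a).add (i1.const_mul b)
    rw [integral_add i3 (i2.const_mul c), integral_add (i0.const_mul a) (i1.const_mul b), integral_const_mul,
      integral_const_mul, integral_const_mul, ← hW, ← hH]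
  have e1 : ∫ x in closedBall (0 : E N) (3 / 2), (h x - H) ^ 2 * Ψ x ^ 2 = H ^ 2 * W0 + (-(2 * H)) * (H * W0) + 1 * M2 := by
    rw [← lin]; congr 1; ext x; ring
  have e2 : ∀ x, ∫ y in closedBall (0 : E N) (3 / 2), (h x - h y) ^ 2 * (Ψ x ^ 2 * Ψ y ^ 2) =
      M2 * (Ψ x ^ 2) + (-(2 * (H * W0))) * (h x * Ψ x ^ 2) + W0 * (h x ^ 2 * Ψ x ^ 2) := by
    intro x
    have := lin (h x ^ 2 * Ψ x ^ 2) (-(2 * h x * Ψ x ^ 2)) (Ψ x ^ 2)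
    rw [show M2 * (Ψ x ^ 2) + (-(2 * (H * W0))) * (h x * Ψ x ^ 2) + W0 * (h x ^ 2 * Ψ x ^ 2) =
      (h x ^ 2 * Ψ x ^ 2) * W0 + (-(2 * h x * Ψ x ^ 2)) * (H * W0) + (Ψ x ^ 2) * M2 by ring, ← this]
    congr 1; ext y; ring
  simp_rw [e2] at low
  rw [lin] at low
  rw [e1]
  linarith

end poincare

section loglemma
variable {N : ℕ}

/-- weighted mean of the logarithm at time zero -/
def meanLog (N : ℕ) (Ψ : E N → ℝ) (f : E N → ℝ → ℝ) : ℝ :=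
  (∫ x in closedBall (0 : E N) (3 / 2), Real.log (f x 0) * Ψ x ^ 2) / ∫ x in closedBall (0 : E N) (3 / 2), Ψ x ^ 2

lemma ode_aux {Y Y' : ℝ → ℝ} (hY : ∀ t, HasDerivAt Y (Y' t) t) (hc : Continuous Y') {S l : ℝ} (hS : 0 ≤ S) (hl : 0 < l)
    (hY0 : Y 0 = l) (hpos : ∀ t ∈ Icc 0 S, 0 ≤ Y' t) :
    (∀ t ∈ Icc 0 S, l ≤ Y t) ∧ IntegrableOn (fun t => Y' t / Y t ^ 2) (Ioc 0 S) ∧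
      ∫ t in Ioc 0 S, Y' t / Y t ^ 2 ≤ 1 / l := by
  have hcY : Continuous Y := continuous_iff_continuousAt.2 fun t => (hY t).continuousAt
  have mono : MonotoneOn Y (Icc 0 S) := by
    refine monotoneOn_of_deriv_nonneg (convex_Icc 0 S) hcY.continuousOn
      (fun t _ => (hY t).differentiableAt.differentiableWithinAt) fun t ht => ?_
    rw [interior_Icc] at ht
    rw [(hY t).deriv]
    exact hpos t ⟨ht.1.le, ht.2.le⟩
  have h1 : ∀ t ∈ Icc 0 S, l ≤ Y t := fun t ht => by
    rw [← hY0]; exact mono ⟨le_rfl, hS⟩ ht ht.1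
  have hco : ContinuousOn (fun t => Y' t / Y t ^ 2) (Icc 0 S) :=
    hc.continuousOn.div (hcY.pow 2).continuousOn fun t ht => by
      have := h1 t ht
      have : 0 < Y t := by linarith
      positivity
  have hint : IntegrableOn (fun t => Y' t / Y t ^ 2) (Icc 0 S) := hco.integrableOn_compact isCompact_Icc
  refine ⟨h1, hint.mono_set Ioc_subset_Icc_self, ?_⟩
  rw [← intervalIntegral.integral_of_le hS]
  have ftc := intervalIntegral.integral_eq_sub_of_hasDerivAt (f := fun t => -(Y t)⁻¹) (f' := fun t => Y' t / Y t ^ 2)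
    (a := 0) (b := S) (fun t ht => by
      rw [uIcc_of_le hS] at ht
      have := h1 t ht
      exact ((hY t).inv (by linarith)).neg.congr_deriv (by ring))
    (by rw [intervalIntegrable_iff_integrableOn_Ioc_of_le hS]; exact hint.mono_set Ioc_subset_Icc_self)
  rw [ftc, hY0, one_div]
  have : 0 ≤ (Y S)⁻¹ := by
    have := h1 S ⟨hS, le_rfl⟩
    exact inv_nonneg.2 (by linarith)
  linarith

lemma slice_var {h : E N → ℝ} (hh : Continuous h) {Ψ : E N → ℝ} (hcΨ : Continuous Ψ)
    (hΨ1 : ∀ x ∈ closedBall (0 : E N) 1, Ψ x = 1) {H y : ℝ} (hy : 0 < y) :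
    y ^ 2 * volume.real {x | x ∈ closedBall (0 : E N) 1 ∧ H + y < h x} ≤
      ∫ x in closedBall (0 : E N) (3 / 2), (h x - H) ^ 2 * Ψ x ^ 2 := by
  have hm : MeasurableSet {x | x ∈ closedBall (0 : E N) 1 ∧ H + y < h x} :=
    measurableSet_closedBall.inter (measurableSet_lt measurable_const hh.measurable)
  have hsub : {x | x ∈ closedBall (0 : E N) 1 ∧ H + y < h x} ⊆ closedBall (0 : E N) (3 / 2) := fun x hx =>
    closedBall_subset_closedBall (by norm_num) hx.1
  have hi : IntegrableOn (fun x => (h x - H) ^ 2 * Ψ x ^ 2) (closedBall (0 : E N) (3 / 2)) := int_ball (by fun_prop) _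
  calc _ = ∫ x in {x | x ∈ closedBall (0 : E N) 1 ∧ H + y < h x}, y ^ 2 := by
        rw [setIntegral_const, smul_eq_mul, mul_comm]
    _ ≤ ∫ x in {x | x ∈ closedBall (0 : E N) 1 ∧ H + y < h x}, (h x - H) ^ 2 * Ψ x ^ 2 := by
        refine setIntegral_mono_on (integrableOn_const (ne_top_of_le_ne_top measure_closedBall_lt_top.ne (measure_mono hsub)))
          (hi.mono_set hsub) hm fun x hx => ?_
        rw [hΨ1 x hx.1]
        have := hx.2
        nlinarith
    _ ≤ _ := setIntegral_mono_set hi (.of_forall fun x => by positivity) hsub.eventuallyLE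

lemma log_deriv {c C pb S : ℝ} {f : E N → ℝ → ℝ} (hf : GoodF N c C pb S f) (hpb : 0 ≤ pb) (hc : 0 < c)
    {Ψ : E N → ℝ} {L : ℝ} (hΨ : Cut N Ψ (3 / 2) L) (hrad : ∀ x y : E N, ‖x‖ ≤ ‖y‖ → Ψ y ≤ Ψ x)
    {W0 : ℝ} (hW : W0 = ∫ x in closedBall (0 : E N) (3 / 2), Ψ x ^ 2) (hW0 : 0 < W0) (hV : 0 < volume.real (closedBall (0 : E N) (3 / 2))) :
    ∃ W' : ℝ → ℝ, Continuous W' ∧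
      (∀ t, HasDerivAt (fun t => (∫ x in closedBall (0 : E N) (3 / 2), Real.log (f x t) * Ψ x ^ 2) / W0) (W' t) t) ∧
      ∀ t ∈ Icc 0 S, W' t + 2 * c / (volume.real (closedBall (0 : E N) (3 / 2)) * (2 ^ N * 9)) *
        (∫ x in closedBall (0 : E N) (3 / 2),
          (Real.log (f x t) - (∫ x in closedBall (0 : E N) (3 / 2), Real.log (f x t) * Ψ x ^ 2) / W0) ^ 2 * Ψ x ^ 2) ≤
        C * L ^ 2 * volume.real (closedBall (0 : E N) (3 / 2)) / W0 := by
  have hcΨ : Continuous (fun p : E N × ℝ => Ψ p.1) := hΨ.smooth.continuous.comp continuous_fst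
  have hcp := cont_pow hf.smooth hf.pos
  have hct := cont_ft hf.smooth
  have cl : Continuous (fun p : E N × ℝ => Real.log (f p.1 p.2)) :=
    hf.smooth.continuous.log fun p => (hf.pos _ _).ne'
  have cg' := cont_int (F := fun x t => f x t ^ ((0:ℝ) - 1) * ft f x t * Ψ x ^ 2) (((hcp _).mul hct).mul (hcΨ.pow 2)) (3 / 2)
  refine ⟨fun t => (∫ x in closedBall (0 : E N) (3 / 2), f x t ^ ((0:ℝ) - 1) * ft f x t * Ψ x ^ 2) / W0,
    cg'.div_const _, fun t => ?_, fun t ht => ?_⟩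
  · have := hasDeriv_int (F := fun x t => Real.log (f x t) * Ψ x ^ 2)
      (F' := fun x t => f x t ^ ((0:ℝ) - 1) * ft f x t * Ψ x ^ 2) (cl.mul (hcΨ.pow 2))
      (((hcp _).mul hct).mul (hcΨ.pow 2)) (fun x t => by
        have := ((has_ft' hf.smooth x t).log (hf.pos x t).ne').mul_const (Ψ x ^ 2)
        refine this.congr_deriv ?_
        rw [zero_sub, Real.rpow_neg_one, div_eq_inv_mul]) (3 / 2) t
    exact this.div_const W0
  · have g := hf.ineq 0 le_rfl hpb Ψ (3 / 2) L hΨ le_rfl t ht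
    have hh : ContDiff ℝ 1 (fun x => Real.log (f x t)) := by
      have : ContDiff ℝ 1 (fun x => f x t) :=
        (hf.smooth.of_le (by norm_cast)).comp (contDiff_id.prodMk contDiff_const)
      exact this.log fun x => (hf.pos x t).ne'
    have hP := poincare hh hΨ hrad (H := (∫ x in closedBall (0 : E N) (3 / 2), Real.log (f x t) * Ψ x ^ 2) / W0) hW
      (by field_simp)
    have e1 : ∀ x, ‖fderiv ℝ (fun x => Real.log (f x t)) x‖ ^ 2 * Ψ x ^ 2 = f x t ^ ((0:ℝ) - 2) * ‖fx f x t‖ ^ 2 * Ψ x ^ 2 := by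
      intro x
      have hd := ((has_fx' hf.smooth x t).log (hf.pos x t).ne').fderiv
      rw [hd, norm_smul, mul_pow]
      congr 2
      have := hf.pos x t
      rw [Real.norm_of_nonneg (by positivity), zero_sub, Real.rpow_neg this.le]
      norm_num
    simp_rw [e1] at hP
    simp only [Real.rpow_zero, setIntegral_const, smul_eq_mul, mul_one] at g
    set P := volume.real (closedBall (0 : E N) (3 / 2)) * (2 ^ N * 9) with hPd
    have hP0 : 0 < P := by positivity
    set V := ∫ x in closedBall (0 : E N) (3 / 2),
          (Real.log (f x t) - (∫ x in closedBall (0 : E N) (3 / 2), Real.log (f x t) * Ψ x ^ 2) / W0) ^ 2 * Ψ x ^ 2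
    set G := ∫ x in closedBall (0 : E N) (3 / 2), f x t ^ ((0:ℝ) - 2) * ‖fx f x t‖ ^ 2 * Ψ x ^ 2
    have : 2 * c / P * V ≤ c * G / W0 := by
      rw [div_mul_eq_mul_div, div_le_div_iff₀ hP0 hW0]
      have := mul_le_mul_of_nonneg_left hP hc.le
      linarith
    calc _ ≤ (∫ x in closedBall (0 : E N) (3 / 2), f x t ^ ((0:ℝ) - 1) * ft f x t * Ψ x ^ 2) / W0 + c * G / W0 := by gcongr
      _ = ((∫ x in closedBall (0 : E N) (3 / 2), f x t ^ ((0:ℝ) - 1) * ft f x t * Ψ x ^ 2) + c * G) / W0 := by ring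
      _ ≤ _ := by gcongr

lemma log_lemma {c C : ℝ} (hC : 0 < C) (hc : 0 < c)
    {Ψ : E N → ℝ} {L : ℝ} (hΨ : Cut N Ψ (3 / 2) L) (hrad : ∀ x y : E N, ‖x‖ ≤ ‖y‖ → Ψ y ≤ Ψ x)
    (hΨ1 : ∀ x ∈ closedBall (0 : E N) 1, Ψ x = 1) :
    ∃ c0 : ℝ, ∀ (pb S : ℝ) (f : E N → ℝ → ℝ), GoodF N c C pb S f → 0 ≤ pb → 3 / 4 < S → S ≤ 1 → ∀ l, 0 < l →
      volume.real (badSet N (fun x t => Real.exp (-meanLog N Ψ f) * f x t) S l) ≤ c0 / l := by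
  set V := volume.real (closedBall (0 : E N) (3 / 2)) with hVd
  have hV : 0 < V := ENNReal.toReal_pos (measure_closedBall_pos volume _ (by norm_num)).ne' measure_closedBall_lt_top.ne
  set W0 := ∫ x in closedBall (0 : E N) (3 / 2), Ψ x ^ 2 with hW
  have hcΨ := hΨ.smooth.continuous
  have hW0 : 0 < W0 := by
    have h1 := slice_var (N := N) (h := fun _ => (1:ℝ)) continuous_const hcΨ hΨ1 (H := 0) (y := 1 / 2) (by norm_num)
    have h2 : {x : E N | x ∈ closedBall (0 : E N) 1 ∧ (0:ℝ) + 1 / 2 < 1} = closedBall (0 : E N) 1 := by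
      ext x; simp only [mem_ofPred_eq, and_iff_left_iff_imp]; intro _; norm_num
    rw [h2] at h1
    have h3 : 0 < volume.real (closedBall (0 : E N) 1) :=
      ENNReal.toReal_pos (measure_closedBall_pos volume _ (by norm_num)).ne' measure_closedBall_lt_top.ne
    have h4 : ∫ x in closedBall (0 : E N) (3 / 2), ((1:ℝ) - 0) ^ 2 * Ψ x ^ 2 = W0 := by simp [hW]
    rw [h4] at h1
    nlinarith
  set C1 := C * L ^ 2 * V / W0 with hC1
  set c2 := 2 * c / (V * (2 ^ N * 9)) with hc2
  have hc20 : 0 < c2 := by positivity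
  have hL := hΨ.one_le
  have hC10 : 0 < C1 := by positivity
  set M0 := volume.real (Ioc (0:ℝ) 1 ×ˢ closedBall (0 : E N) 1) with hM0
  refine ⟨2 / c2 + 2 * C1 * M0, ?_⟩
  intro pb S f hf hpb hS hS1 l hl
  have hM00 : 0 ≤ M0 := measureReal_nonneg
  have hfinU1 : volume (Ioc (0:ℝ) 1 ×ˢ closedBall (0 : E N) 1) ≠ ⊤ := ne_top_of_le_ne_top
    (isCompact_Icc.prod (isCompact_closedBall (0 : E N) 1)).measure_lt_top.ne
    (measure_mono (prod_mono Ioc_subset_Icc_self subset_rfl) : _ ≤ volume (Icc (0:ℝ) 1 ×ˢ closedBall (0 : E N) 1))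
  by_cases hcase : l < 2 * C1
  · have : volume.real (badSet N (fun x t => Real.exp (-meanLog N Ψ f) * f x t) S l) ≤ M0 :=
      measureReal_mono (fun z hz => ⟨⟨hz.1.1.1, hz.1.1.2.trans hS1⟩, hz.1.2⟩) hfinU1
    refine this.trans ?_
    rw [le_div_iff₀ hl]
    have : 0 < 2 / c2 := by positivity
    nlinarith
  push Not at hcase
  have cl : Continuous (fun p : E N × ℝ => Real.log (f p.1 p.2)) :=
    hf.smooth.continuous.log fun p => (hf.pos _ _).ne'
  obtain ⟨W', cW', dW, hWi⟩ := log_deriv hf hpb hc hΨ hrad hW hW0 hV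
  set W : ℝ → ℝ := fun t => (∫ x in closedBall (0 : E N) (3 / 2), Real.log (f x t) * Ψ x ^ 2) / W0 with hWd
  have hml : meanLog N Ψ f = W 0 := rfl
  rw [hml]
  set Y : ℝ → ℝ := fun t => l / 2 + W 0 - W t + C1 * t with hY
  have dY : ∀ t, HasDerivAt Y (-W' t + C1) t := fun t => by
    have := ((dW t).const_sub (l / 2 + W 0)).add ((hasDerivAt_id t).const_mul C1)
    exact this.congr_deriv (by simp)
  have hvn : ∀ t, 0 ≤ ∫ x in closedBall (0 : E N) (3 / 2), (Real.log (f x t) - W t) ^ 2 * Ψ x ^ 2 := fun t =>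
    integral_nonneg fun x => by positivity
  have hYp : ∀ t ∈ Icc 0 S, c2 * (∫ x in closedBall (0 : E N) (3 / 2), (Real.log (f x t) - W t) ^ 2 * Ψ x ^ 2) ≤ -W' t + C1 := by
    intro t ht
    have := hWi t ht
    linarith
  obtain ⟨hYl, hYi, hYint⟩ := ode_aux dY (cW'.neg.add continuous_const) (by linarith : (0:ℝ) ≤ S) (show 0 < l / 2 by linarith)
    (by simp [hY]) (fun t ht => (mul_nonneg hc20.le (hvn t)).trans (hYp t ht))
  set Bd := badSet N (fun x t => Real.exp (-W 0) * f x t) S l with hBd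
  have hsl : ∀ t, volume (Prod.mk t ⁻¹' Bd) ≤ (Ioc 0 S).indicator (fun t => ENNReal.ofReal (1 / c2 * ((-W' t + C1) / Y t ^ 2))) t := by
    intro t
    by_cases ht : t ∈ Ioc 0 S
    · rw [indicator_of_mem ht]
      have ht' : t ∈ Icc 0 S := ⟨ht.1.le, ht.2⟩
      have hYt := hYl t ht'
      have hYt0 : 0 < Y t := by linarith
      have sv := slice_var (slice_x (F := fun x t => Real.log (f x t)) cl t) hcΨ hΨ1 (H := W t) hYt0
      have hsub : Prod.mk t ⁻¹' Bd ⊆ {x | x ∈ closedBall (0 : E N) 1 ∧ W t + Y t < Real.log (f x t)} := by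
        intro x hx
        refine ⟨hx.1.2, ?_⟩
        have h2 : l < Real.log (Real.exp (-W 0) * f x t) := hx.2
        rw [Real.log_mul (Real.exp_pos _).ne' (hf.pos x t).ne', Real.log_exp] at h2
        simp only [hY]
        have : C1 * t ≤ C1 * 1 := by gcongr; exact ht.2.trans hS1
        linarith
      refine (measure_mono hsub).trans ?_
      rw [← ENNReal.ofReal_toReal (ne_top_of_le_ne_top measure_closedBall_lt_top.ne (measure_mono fun x hx => hx.1 :
        volume {x | x ∈ closedBall (0 : E N) 1 ∧ W t + Y t < Real.log (f x t)} ≤ volume (closedBall (0 : E N) 1)))]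
      refine ENNReal.ofReal_le_ofReal ?_
      change volume.real _ ≤ _
      have h3 := hYp t ht'
      have h4 := mul_le_mul_of_nonneg_left sv hc20.le
      rw [one_div_mul_eq_div, div_div, le_div_iff₀ (by positivity)]
      linarith
    · rw [indicator_of_notMem ht]
      have : Prod.mk t ⁻¹' Bd = ∅ := by
        ext x; simp only [mem_preimage, mem_empty_iff_false, iff_false]
        exact fun hx => ht hx.1.1
      rw [this]; simp
  have hmB : MeasurableSet Bd := by
    have hcf : Continuous (fun z : ℝ × E N => Real.exp (-W 0) * f z.2 z.1) :=
      continuous_const.mul (hf.smooth.continuous.comp continuous_swap)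
    have : MeasurableSet {z : ℝ × E N | l < Real.log (Real.exp (-W 0) * f z.2 z.1)} :=
      measurableSet_lt measurable_const (Real.measurable_log.comp hcf.measurable)
    exact (measurableSet_Ioc.prod measurableSet_closedBall).inter this
  have hfin : volume Bd ≤ ENNReal.ofReal (1 / c2 * (1 / (l / 2))) := by
    rw [Measure.volume_eq_prod, Measure.prod_apply hmB]
    refine (lintegral_mono hsl).trans ?_
    rw [lintegral_indicator measurableSet_Ioc, ← ofReal_integral_eq_lintegral_ofReal (hYi.const_mul _)]
    · refine ENNReal.ofReal_le_ofReal ?_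
      rw [integral_const_mul]
      gcongr
    · refine (ae_restrict_iff' measurableSet_Ioc).2 (.of_forall fun t ht => ?_)
      have := (mul_nonneg hc20.le (hvn t)).trans (hYp t ⟨ht.1.le, ht.2⟩)
      simp only [Pi.zero_apply]
      positivity
  have := ENNReal.toReal_le_of_le_ofReal (by positivity) hfin
  refine (show volume.real Bd ≤ _ from this).trans ?_
  rw [le_div_iff₀ hl]
  have e : 1 / c2 * (1 / (l / 2)) * l = 2 / c2 := by field_simp
  rw [e]
  have : 0 ≤ 2 * C1 * M0 := by positivity
  linarith

end loglemma

section harn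
variable {N : ℕ}

lemma GoodF.smul {c C pb S : ℝ} {f : E N → ℝ → ℝ} (hf : GoodF N c C pb S f) {k : ℝ} (hk : 0 < k) :
    GoodF N c C pb S (fun x t => k * f x t) where
  smooth := contDiff_const.mul hf.smooth
  pos := fun x t => mul_pos hk (hf.pos x t)
  ineq := by
    intro p hp hpb Ψ ρ L hΨ hρ t ht
    have g := mul_le_mul_of_nonneg_left (hf.ineq p hp hpb Ψ ρ L hΨ hρ t ht) (Real.rpow_nonneg hk.le p)
    have e1 : ∀ x, (k * f x t) ^ (p - 1) * ft (fun x t => k * f x t) x t * Ψ x ^ 2 =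
        k ^ p * (f x t ^ (p - 1) * ft f x t * Ψ x ^ 2) := by
      intro x
      have h1 : ft (fun x t => k * f x t) x t = k * ft f x t := ((has_ft' hf.smooth x t).const_mul k).deriv
      have h2 : k ^ (p - 1) * k = k ^ p := by rw [← Real.rpow_add_one hk.ne']; congr 1; ring
      rw [h1, Real.mul_rpow hk.le (hf.pos x t).le, ← h2]; ring
    have e2 : ∀ x, (k * f x t) ^ (p - 2) * ‖fx (fun x t => k * f x t) x t‖ ^ 2 * Ψ x ^ 2 =
        k ^ p * (f x t ^ (p - 2) * ‖fx f x t‖ ^ 2 * Ψ x ^ 2) := by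
      intro x
      have h1 : fx (fun x t => k * f x t) x t = k • fx f x t := ((has_fx' hf.smooth x t).const_mul k).fderiv
      have h2 : k ^ (p - 2) * k ^ 2 = k ^ p := by
        rw [← Real.rpow_natCast k 2, ← Real.rpow_add hk]; congr 1; norm_num
      rw [h1, norm_smul, Real.norm_of_nonneg hk.le, Real.mul_rpow hk.le (hf.pos x t).le, ← h2]; ring
    have e3 : ∀ x, (k * f x t) ^ p = k ^ p * f x t ^ p := fun x => Real.mul_rpow hk.le (hf.pos x t).le
    simp_rw [e1, e2, e3, integral_const_mul]
    linarith

lemma harn (hN : 2 ≤ N) {c C q0 : ℝ} (hC : 0 < C) (hc : 0 < c) (hq0 : 0 < q0)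
    {Ψ : E N → ℝ} {L : ℝ} (hΨ : Cut N Ψ (3 / 2) L) (hrad : ∀ x y : E N, ‖x‖ ≤ ‖y‖ → Ψ y ≤ Ψ x)
    (hΨ1 : ∀ x ∈ closedBall (0 : E N) 1, Ψ x = 1) :
    ∃ B : ℝ, 0 ≤ B ∧ ∀ (pb S : ℝ) (f : E N → ℝ → ℝ) (Q : ℝ), GoodF N c C pb S f → 3 / 4 < S → S ≤ 1 → q0 ≤ Q →
      Q ≤ (1 + 2 / (N : ℝ)) * pb → Icyl N f S (1 / 2) Q ≤ Real.exp (Q * (B + meanLog N Ψ f)) := by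
  have hN0 : (0:ℝ) < N := by exact_mod_cast (by omega : 0 < N)
  obtain ⟨c0, hlog⟩ := log_lemma hC hc hΨ hrad hΨ1
  obtain ⟨B, hB0, hB⟩ := bg N hN (c0 := c0) hC hc hq0
  refine ⟨B, hB0, ?_⟩
  intro pb S f Q hf hS hS1 hQ hQpb
  have hpb : 0 ≤ pb := by
    by_contra h
    push Not at h
    have : (1 + 2 / (N : ℝ)) * pb < 0 := mul_neg_of_pos_of_neg (by positivity) h
    linarith
  have h1 := hB pb S _ Q (hf.smul (Real.exp_pos (-meanLog N Ψ f))) hS hS1 hQ hQpb (hlog pb S f hf hpb hS hS1)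
  have e : Icyl N (fun x t => Real.exp (-meanLog N Ψ f) * f x t) S (1 / 2) Q =
      Real.exp (-meanLog N Ψ f * Q) * Icyl N f S (1 / 2) Q := by
    unfold Icyl
    rw [← intervalIntegral.integral_const_mul]
    congr 1; ext t
    rw [← integral_const_mul]
    congr 1; ext x
    rw [Real.mul_rpow (Real.exp_pos _).le (hf.pos x t).le, ← Real.exp_mul]
  rw [e] at h1
  have h2 := mul_le_mul_of_nonneg_left h1 (Real.exp_pos (meanLog N Ψ f * Q)).le
  rw [← mul_assoc, ← Real.exp_add, ← Real.exp_add] at h2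
  simp only [neg_mul, add_neg_cancel, Real.exp_zero, one_mul] at h2
  refine h2.trans (le_of_eq ?_)
  congr 1; ring

end harn

section nonlocal
variable {N : ℕ}

lemma alg_one {X Y p q a : ℝ} (hY : 0 < Y) (hXY : Y ≤ X) (hq : 0 ≤ q) (hqp : q ≤ p) (ha : 0 < a) :
    (X - Y) * (X ^ (-a) * p ^ 2 - Y ^ (-a) * q ^ 2) ≤ (1 + 1 / a) * (X ^ (1 - a) * (p - q) ^ 2) := by
  have hX : 0 < X := by linarith
  set θ := Y / X with hθ
  have hθ0 : 0 < θ := by positivity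
  have hθ1 : θ ≤ 1 := by rw [hθ, div_le_one hX]; exact hXY
  have eY : Y = X * θ := by rw [hθ]; field_simp
  have hb : 1 + a * (1 - θ) ≤ θ ^ (-a) := by
    rw [Real.rpow_def_of_pos hθ0]
    have h1 := Real.add_one_le_exp (Real.log θ * -a)
    have h2 := Real.log_le_sub_one_of_pos hθ0
    nlinarith
  have hX1 : X ^ (1 - a) = X * X ^ (-a) := by
    rw [sub_eq_add_neg, Real.rpow_add hX, Real.rpow_one]
  have e : (X - Y) * (X ^ (-a) * p ^ 2 - Y ^ (-a) * q ^ 2) = X ^ (1 - a) * ((1 - θ) * (p ^ 2 - θ ^ (-a) * q ^ 2)) := by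
    rw [hX1, eY, Real.mul_rpow hX.le hθ0.le]; ring
  rw [e, mul_left_comm (1 + 1 / a)]
  refine mul_le_mul_of_nonneg_left ?_ (by positivity)
  have h1 : (1 - θ) * (p ^ 2 - θ ^ (-a) * q ^ 2) ≤ (1 - θ) * (p ^ 2 - (1 + a * (1 - θ)) * q ^ 2) := by
    refine mul_le_mul_of_nonneg_left ?_ (by linarith)
    nlinarith [sq_nonneg q]
  refine h1.trans ?_
  have h2 : 2 * q * (p - q) * (1 - θ) ≤ a * ((1 - θ) * q) ^ 2 + (p - q) ^ 2 / a := by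
    have : a * ((1 - θ) * q) ^ 2 + (p - q) ^ 2 / a - 2 * q * (p - q) * (1 - θ) = (a * ((1 - θ) * q) - (p - q)) ^ 2 / a := by
      field_simp; ring
    have h3 : 0 ≤ (a * ((1 - θ) * q) - (p - q)) ^ 2 / a := by positivity
    linarith
  have h4 : (1 + 1 / a) * (p - q) ^ 2 = (p - q) ^ 2 + (p - q) ^ 2 / a := by ring
  rw [h4]
  nlinarith [sq_nonneg (p - q)]

lemma alg_two {X Y p q a : ℝ} (hY : 0 < Y) (hXY : Y ≤ X) (hp : 0 ≤ p) (hqp : p ≤ q) (ha : 0 < a) :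
    (X - Y) * (X ^ (-a) * p ^ 2 - Y ^ (-a) * q ^ 2) ≤ 0 := by
  refine mul_nonpos_of_nonneg_of_nonpos (by linarith) ?_
  have h1 : X ^ (-a) ≤ Y ^ (-a) := Real.rpow_le_rpow_of_nonpos hY hXY (by linarith)
  have h2 : p ^ 2 ≤ q ^ 2 := by gcongr
  have : X ^ (-a) * p ^ 2 ≤ Y ^ (-a) * q ^ 2 := mul_le_mul h1 h2 (by positivity) (by positivity)
  linarith

lemma alg_all {V ψ : E N → ℝ} {B : Set (E N)} (hV : ∀ x, 0 < V x) (h0 : ∀ x, 0 ≤ ψ x) (hs : ∀ x, x ∉ B → ψ x = 0)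
    {a : ℝ} (ha : 0 < a) (x y : E N) :
    (V x - V y) * (V x ^ (-a) * ψ x ^ 2 - V y ^ (-a) * ψ y ^ 2) ≤
      (1 + 1 / a) * (B.indicator (fun x => V x ^ (1 - a)) x + B.indicator (fun x => V x ^ (1 - a)) y) * (ψ x - ψ y) ^ 2 := by
  have hi : ∀ x, 0 ≤ B.indicator (fun x => V x ^ (1 - a)) x := fun x =>
    indicator_nonneg (fun x _ => Real.rpow_nonneg (hV x).le _) x
  have key : ∀ x y : E N, V y ≤ V x → (V x - V y) * (V x ^ (-a) * ψ x ^ 2 - V y ^ (-a) * ψ y ^ 2) ≤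
      (1 + 1 / a) * (B.indicator (fun x => V x ^ (1 - a)) x + B.indicator (fun x => V x ^ (1 - a)) y) * (ψ x - ψ y) ^ 2 := by
    intro x y hxy
    have i1 := hi x
    have i2 := hi y
    rcases le_total (ψ x) (ψ y) with h | h
    · exact (alg_two (hV y) hxy (h0 x) h ha).trans (by positivity)
    · by_cases hx : x ∈ B
      · refine (alg_one (hV y) hxy (h0 y) h ha).trans ?_
        rw [indicator_of_mem hx]
        rw [mul_assoc]
        gcongr
        linarith
      · have e1 : ψ x = 0 := hs x hx
        have e2 : ψ y = 0 := le_antisymm (by linarith) (h0 y)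
        simp [e1, e2]
  rcases le_total (V y) (V x) with h | h
  · exact key x y h
  · have := key y x h
    rw [add_comm (B.indicator _ y)] at this
    calc _ = (V y - V x) * (V y ^ (-a) * ψ y ^ 2 - V x ^ (-a) * ψ x ^ 2) := by ring
      _ ≤ _ := this
      _ = _ := by ring

/-- the truncated fractional kernel -/
def mker (N : ℕ) (s : ℝ) (z : E N) : ℝ := min (‖z‖ ^ 2) 1 * ‖z‖ ^ (-((N : ℝ) + 2 * s))

lemma mker_nonneg (s : ℝ) (z : E N) : 0 ≤ mker N s z := by unfold mker; positivity

lemma mker_int (hN : 2 ≤ N) {s : ℝ} (hs : s ∈ Ioo (0:ℝ) 1) : Integrable (mker N s) := by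
  have hN0 : 0 < N := by omega
  haveI : Nonempty (Fin N) := ⟨⟨0, hN0⟩⟩
  haveI : Nontrivial (E N) := inferInstance
  have := integrable_fun_norm_addHaar (E := E N) (volume) (f := fun y : ℝ => min (y ^ 2) 1 * y ^ (-((N : ℝ) + 2 * s)))
  refine this.2 ?_
  rw [finrank_euclideanSpace, Fintype.card_fin]
  have hU : Ioi (0:ℝ) = Ioc 0 1 ∪ Ioi 1 := (Ioc_union_Ioi_eq_Ioi (by norm_num)).symm
  have hpow : ∀ y : ℝ, 0 < y → y ^ (N - 1) = y ^ ((N : ℝ) - 1) := fun y hy => by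
    rw [← Real.rpow_natCast]; congr 1; rw [Nat.cast_sub (by omega)]; simp
  rw [hU]
  refine IntegrableOn.union ?_ ?_
  · have h1 : IntegrableOn (fun y : ℝ => y ^ (1 - 2 * s)) (Ioc 0 1) := by
      rw [← intervalIntegrable_iff_integrableOn_Ioc_of_le (by norm_num)]
      exact intervalIntegral.intervalIntegrable_rpow' (by linarith [hs.2])
    refine h1.congr_fun (fun y hy => ?_) measurableSet_Ioc
    have hy0 := hy.1
    simp only [smul_eq_mul]
    rw [min_eq_left (by nlinarith [hy.2]), hpow y hy0, ← Real.rpow_natCast y 2, ← Real.rpow_add hy0, ← Real.rpow_add hy0]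
    congr 1; push_cast; ring
  · have h1 : IntegrableOn (fun y : ℝ => y ^ (-1 - 2 * s)) (Ioi 1) :=
      integrableOn_Ioi_rpow_of_lt (by linarith [hs.1]) (by norm_num)
    refine h1.congr_fun (fun y hy => ?_) measurableSet_Ioi
    have hy1 : 1 < y := hy
    have hy0 : 0 < y := by linarith
    simp only [smul_eq_mul]
    rw [min_eq_right (by nlinarith), hpow y hy0, one_mul, ← Real.rpow_add hy0]
    congr 1; ring

lemma int_le_of_le {α : Type*} [MeasurableSpace α] {μ : Measure α} {f g : α → ℝ} (h : ∀ x, f x ≤ g x) (hg0 : ∀ x, 0 ≤ g x)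
    (hg : Integrable g μ) : ∫ x, f x ∂μ ≤ ∫ x, g x ∂μ := by
  by_cases hf : Integrable f μ
  · exact integral_mono hf hg h
  · rw [integral_undef hf]; exact integral_nonneg hg0

lemma nonlocal_bound (hN : 2 ≤ N) {s : ℝ} (hs : s ∈ Ioo (0:ℝ) 1) {Λ : ℝ} (hΛ : 1 ≤ Λ) {κ : E N → E N → ℝ}
    (hκ : ∀ x y, x ≠ y → 0 ≤ κ x y ∧ κ x y ≤ Λ * ‖x - y‖ ^ (-((N : ℝ) + 2 * s)))
    {V ψ : E N → ℝ} {B : Set (E N)} (hB : MeasurableSet B) (hV : ∀ x, 0 < V x) (h0 : ∀ x, 0 ≤ ψ x) (h1 : ∀ x, ψ x ≤ 1)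
    (hsup : ∀ x, x ∉ B → ψ x = 0) {ℓ : ℝ} (hℓ : 1 ≤ ℓ) (hlip : ∀ x y, |ψ x - ψ y| ≤ ℓ * ‖x - y‖)
    {a : ℝ} (ha : 0 < a) (hi : IntegrableOn (fun x => V x ^ (1 - a)) B) :
    ∫ x, ∫ y, (V x - V y) * (V x ^ (-a) * ψ x ^ 2 - V y ^ (-a) * ψ y ^ 2) * κ x y ≤
      (2 * Λ * ∫ z, mker N s z) * (1 + 1 / a) * ℓ ^ 2 * ∫ x in B, V x ^ (1 - a) := by
  have hℓ0 : 0 < ℓ := by linarith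
  set A : E N → ℝ := B.indicator (fun x => V x ^ (1 - a)) with hA
  have hA0 : ∀ x, 0 ≤ A x := fun x => indicator_nonneg (fun x _ => Real.rpow_nonneg (hV x).le _) x
  have hAi : Integrable A := (integrable_indicator_iff hB).2 hi
  set d := (N : ℝ) + 2 * s with hd
  set c1 := (1 + 1 / a) * (Λ * ℓ ^ d) with hc1
  have hc10 : 0 ≤ c1 := by positivity
  set m : E N → ℝ := fun z => mker N s (ℓ • z) with hm
  have hm0 : ∀ z, 0 ≤ m z := fun z => mker_nonneg s _
  have hmi : Integrable m := (mker_int hN hs).comp_smul hℓ0.ne'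
  have hmI : ∫ z, m z = (ℓ ^ N)⁻¹ * ∫ z, mker N s z := by
    rw [hm, Measure.integral_comp_smul, finrank_euclideanSpace, Fintype.card_fin, smul_eq_mul, abs_of_nonneg (by positivity)]
  have msymm : ∀ z, m (-z) = m z := fun z => by simp [hm, mker]
  have hpt : ∀ x y, (V x - V y) * (V x ^ (-a) * ψ x ^ 2 - V y ^ (-a) * ψ y ^ 2) * κ x y ≤
      c1 * (A x * m (x - y) + A y * m (x - y)) := by
    intro x y
    have a1 := hA0 x
    have a2 := hA0 y
    have a3 := hm0 (x - y)
    by_cases hxy : x = y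
    · subst hxy; simp only [sub_self, zero_mul]; rw [sub_self] at a3; positivity
    obtain ⟨k0, k1⟩ := hκ x y hxy
    have hn : 0 < ‖x - y‖ := norm_pos_iff.2 (sub_ne_zero.2 hxy)
    have p1 : (ψ x - ψ y) ^ 2 ≤ min (‖ℓ • (x - y)‖ ^ 2) 1 := by
      refine le_min ?_ ?_
      · rw [norm_smul, Real.norm_of_nonneg hℓ0.le, ← sq_abs]
        have := hlip x y
        gcongr
      · have := h0 x; have := h0 y; have := h1 x; have := h1 y
        rw [sq_le_one_iff_abs_le_one, abs_le]; constructor <;> linarith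
    have p2 : ‖x - y‖ ^ (-d) = ℓ ^ d * ‖ℓ • (x - y)‖ ^ (-d) := by
      rw [norm_smul, Real.norm_of_nonneg hℓ0.le, Real.mul_rpow hℓ0.le hn.le, ← mul_assoc, ← Real.rpow_add hℓ0]
      simp
    have p3 : (ψ x - ψ y) ^ 2 * κ x y ≤ Λ * ℓ ^ d * m (x - y) := by
      calc _ ≤ min (‖ℓ • (x - y)‖ ^ 2) 1 * (Λ * ‖x - y‖ ^ (-d)) := by gcongr
        _ = _ := by rw [p2, hm]; simp only [mker]; ring
    calc _ ≤ ((1 + 1 / a) * (A x + A y) * (ψ x - ψ y) ^ 2) * κ x y :=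
          mul_le_mul_of_nonneg_right (alg_all hV h0 hsup ha x y) k0
      _ = ((1 + 1 / a) * (A x + A y)) * ((ψ x - ψ y) ^ 2 * κ x y) := by ring
      _ ≤ ((1 + 1 / a) * (A x + A y)) * (Λ * ℓ ^ d * m (x - y)) := by gcongr
      _ = _ := by rw [hc1]; ring
  -- integrability on the product
  have P2 : Integrable (fun p : E N × E N => A p.2 * m (p.1 - p.2)) (volume.prod volume) :=
    Integrable.convolution_integrand (ContinuousLinearMap.mul ℝ ℝ) hAi hmi
  have P1 : Integrable (fun p : E N × E N => A p.1 * m (p.1 - p.2)) (volume.prod volume) := by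
    have := P2.swap
    refine this.congr (.of_forall fun p => ?_)
    simp only [Function.comp, Prod.fst_swap, Prod.snd_swap]
    rw [← msymm, neg_sub]
  have P3 : Integrable (fun p : E N × E N => c1 * (A p.1 * m (p.1 - p.2) + A p.2 * m (p.1 - p.2))) (volume.prod volume) :=
    (P1.add P2).const_mul c1
  have g0 : ∀ x y, 0 ≤ c1 * (A x * m (x - y) + A y * m (x - y)) := fun x y => by
    have a1 := hA0 x
    have a2 := hA0 y
    have a3 := hm0 (x - y)
    positivity
  have step : ∫ x, ∫ y, (V x - V y) * (V x ^ (-a) * ψ x ^ 2 - V y ^ (-a) * ψ y ^ 2) * κ x y ≤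
      ∫ x, ∫ y, c1 * (A x * m (x - y) + A y * m (x - y)) := by
    have hae := P3.prod_right_ae
    have hint : Integrable (fun x => ∫ y, c1 * (A x * m (x - y) + A y * m (x - y))) := P3.integral_prod_left
    by_cases hf : Integrable (fun x => ∫ y, (V x - V y) * (V x ^ (-a) * ψ x ^ 2 - V y ^ (-a) * ψ y ^ 2) * κ x y)
    · refine integral_mono_ae hf hint ?_
      filter_upwards [hae] with x hx
      exact int_le_of_le (hpt x) (g0 x) hx
    · rw [integral_undef hf]
      exact integral_nonneg fun x => integral_nonneg fun y => g0 x y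
  refine step.trans ?_
  rw [integral_integral (f := fun x y => c1 * (A x * m (x - y) + A y * m (x - y))) P3, integral_const_mul,
    integral_add P1 P2]
  have I1 : ∫ p : E N × E N, A p.1 * m (p.1 - p.2) ∂(volume.prod volume) = (∫ x, A x) * ∫ z, m z := by
    rw [integral_prod _ P1]
    have : ∀ x, ∫ y, A x * m (x - y) = A x * ∫ z, m z := fun x => by
      rw [integral_const_mul, integral_sub_left_eq_self m volume x]
    simp_rw [this]; rw [integral_mul_const]
  have I2 : ∫ p : E N × E N, A p.2 * m (p.1 - p.2) ∂(volume.prod volume) = (∫ x, A x) * ∫ z, m z := by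
    rw [← I1, ← integral_prod_swap]
    refine integral_congr_ae (.of_forall fun p => ?_)
    simp only [Prod.fst_swap, Prod.snd_swap]
    rw [← msymm, neg_sub]
  rw [I1, I2, hmI, hA, integral_indicator hB]
  have hI0 : 0 ≤ ∫ x in B, V x ^ (1 - a) := integral_nonneg fun x => Real.rpow_nonneg (hV x).le _
  have hm00 : 0 ≤ ∫ z, mker N s z := integral_nonneg fun z => mker_nonneg s z
  have hpow : ℓ ^ d * (ℓ ^ N)⁻¹ ≤ ℓ ^ 2 := by
    rw [← Real.rpow_natCast ℓ N, ← Real.rpow_neg hℓ0.le, ← Real.rpow_add hℓ0, ← Real.rpow_natCast ℓ 2]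
    refine Real.rpow_le_rpow_of_exponent_le hℓ ?_
    rw [hd]; push_cast; linarith [hs.2]
  calc _ = (2 * Λ * ∫ z, mker N s z) * (1 + 1 / a) * (ℓ ^ d * (ℓ ^ N)⁻¹) * ∫ x in B, V x ^ (1 - a) := by
        rw [hc1]; ring
    _ ≤ _ := by gcongr

end nonlocal

section testing
variable {N : ℕ}

lemma cont_int_c {F : E N → ℝ → ℝ} (hF : Continuous (fun p : E N × ℝ => F p.1 p.2)) {B : Set (E N)} (hB : IsCompact B) :
    Continuous (fun t => ∫ x in B, F x t) :=
  continuous_parametric_integral_of_continuous (f := fun t x => F x t)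
    (hF.comp (continuous_snd.prodMk continuous_fst)) hB

lemma int_c {F : E N → ℝ} (hF : Continuous F) {B : Set (E N)} (hB : IsCompact B) :
    IntegrableOn F B :=
  hF.continuousOn.integrableOn_compact hB

lemma hasDeriv_int_c {F F' : E N → ℝ → ℝ} (hF : Continuous (fun p : E N × ℝ => F p.1 p.2))
    (hF' : Continuous (fun p : E N × ℝ => F' p.1 p.2))
    (hd : ∀ x t, HasDerivAt (fun τ => F x τ) (F' x t) t) {B : Set (E N)} (hB : IsCompact B) (t : ℝ) :
    HasDerivAt (fun τ => ∫ x in B, F x τ) (∫ x in B, F' x t) t := by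
  obtain ⟨M, hM⟩ := (hB.prod (isCompact_Icc (a := t - 1) (b := t + 1))).exists_bound_of_continuousOn
    hF'.continuousOn
  refine (hasDerivAt_integral_of_dominated_loc_of_deriv_le (F := fun τ x => F x τ) (F' := fun τ x => F' x τ)
    (bound := fun _ => M) (s := Icc (t - 1) (t + 1)) (Icc_mem_nhds (by linarith) (by linarith)) ?_ ?_ ?_ ?_ ?_ ?_).2
  · exact .of_forall fun τ => (slice_x hF τ).aestronglyMeasurable
  · exact int_c (slice_x hF t) hB
  · exact (slice_x hF' t).aestronglyMeasurable
  · exact (ae_restrict_iff' hB.measurableSet).2 (.of_forall fun x hx τ hτ => hM (x, τ) ⟨hx, hτ⟩)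
  · exact integrableOn_const (hB.measure_lt_top.ne)
  · exact .of_forall fun x τ _ => hd x τ

/-- The test function. -/
def phi (w : E N → ℝ → ℝ) (ψ : E N → ℝ) (χ : ℝ → ℝ) (a : ℝ) (x : E N) (t : ℝ) : ℝ :=
  w x t ^ (-a) * ψ x ^ 2 * χ t

variable {w : E N → ℝ → ℝ} {ψ : E N → ℝ} {χ : ℝ → ℝ} {a : ℝ} {B : Set (E N)}

lemma phi_smooth (hw : ContDiff ℝ (⊤ : ℕ∞) (fun p : E N × ℝ => w p.1 p.2)) (hpos : ∀ x t, 0 < w x t)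
    (hψ : ContDiff ℝ (⊤ : ℕ∞) ψ) (hχ : ContDiff ℝ (⊤ : ℕ∞) χ) :
    ContDiff ℝ (⊤ : ℕ∞) (fun p : E N × ℝ => phi w ψ χ a p.1 p.2) := by
  unfold phi
  exact ((hw.rpow_const_of_ne fun p => (hpos _ _).ne').mul ((hψ.comp contDiff_fst).pow 2)).mul (hχ.comp contDiff_snd)

lemma phi_tsupport (hB : IsCompact B) (hψB : ∀ x ∉ B, ψ x = 0) :
    tsupport (fun p : E N × ℝ => phi w ψ χ a p.1 p.2) ⊆ B ×ˢ tsupport χ := by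
  refine closure_minimal ?_ (hB.isClosed.prod (isClosed_tsupport χ))
  intro p hp
  rw [Function.mem_support] at hp
  refine ⟨?_, subset_tsupport _ ?_⟩
  · by_contra h
    exact hp (by simp [phi, hψB _ h])
  · rw [Function.mem_support]
    intro h
    exact hp (by simp [phi, h])

/-- time term -/
lemma test_time (hw : ContDiff ℝ (⊤ : ℕ∞) (fun p : E N × ℝ => w p.1 p.2)) (hpos : ∀ x t, 0 < w x t)
    (hψ : ContDiff ℝ (⊤ : ℕ∞) ψ) (hχ : ContDiff ℝ (⊤ : ℕ∞) χ) (hB : IsCompact B)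
    (hψB : ∀ x ∉ B, ψ x = 0) {Ω : Set (E N)} (hΩ : IsOpen Ω) (hBΩ : B ⊆ Ω) {T α β ε : ℝ} (hT : 0 < T)
    {u : E N → ℝ → ℝ} (hsub : Ioo α β ⊆ Ioo 0 T) (hχs : tsupport χ ⊆ Ioo α β)
    (huw : ∀ x ∈ B, ∀ t ∈ Ioo α β, w x t = u x t + ε) :
    -(∫ t in Ioo 0 T, ∫ x in Ω, u x t * deriv (fun τ => phi w ψ χ a x τ) t) =
      ∫ t in Ioo 0 T, χ t * ∫ x in B, w x t ^ (-a) * ft w x t * ψ x ^ 2 := by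
  have hs := phi_smooth (a := a) hw hpos hψ hχ
  have e1 : ∀ t, ∫ x in Ω, u x t * deriv (fun τ => phi w ψ χ a x τ) t =
      ∫ x in B, (w x t - ε) * ft (phi w ψ χ a) x t := by
    intro t
    rw [setIntegral_eq_of_subset_of_forall_sdiff_eq_zero hΩ.measurableSet hBΩ]
    · refine setIntegral_congr_fun hB.measurableSet fun x hx => ?_
      by_cases ht : t ∈ Ioo α β
      · rw [huw x hx t ht]; ring
      · have hz : ft (phi w ψ χ a) x t = 0 := by
          have : (fun τ => phi w ψ χ a x τ) =ᶠ[nhds t] fun _ => 0 := by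
            have h : t ∉ tsupport χ := fun h => ht (hχs h)
            filter_upwards [notMem_tsupport_iff_eventuallyEq.1 h] with τ hτ
            simp [phi, hτ]
          rw [ft, this.deriv_eq]; simp
        change u x t * ft (phi w ψ χ a) x t = (w x t - ε) * ft (phi w ψ χ a) x t
        rw [hz]; simp
    · intro x hx
      have : (fun τ => phi w ψ χ a x τ) = fun _ => 0 := by
        ext τ; simp [phi, hψB x hx.2]
      rw [this]; simp
  simp only [e1]
  have cφ := hs.continuous
  have cw : Continuous (fun p : E N × ℝ => w p.1 p.2 - ε) := hw.continuous.sub continuous_const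
  have ctφ := cont_ft hs
  have ctw := cont_ft hw
  have c1 : Continuous (fun p : E N × ℝ => (w p.1 p.2 - ε) * ft (phi w ψ χ a) p.1 p.2) := cw.mul ctφ
  have c2 : Continuous (fun p : E N × ℝ => ft w p.1 p.2 * phi w ψ χ a p.1 p.2) := ctw.mul cφ
  have hd := hasDeriv_int_c (F := fun x t => (w x t - ε) * phi w ψ χ a x t)
    (F' := fun x t => ft w x t * phi w ψ χ a x t + (w x t - ε) * ft (phi w ψ χ a) x t) (cw.mul cφ) (c2.add c1)
    (fun x t => ((has_ft' hw x t).sub_const ε).mul (has_ft' hs x t)) hB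
  have ci1 := cont_int_c (F := fun x t => (w x t - ε) * ft (phi w ψ χ a) x t) c1 hB
  have ci2 := cont_int_c (F := fun x t => ft w x t * phi w ψ χ a x t) c2 hB
  have esplit : ∀ t, ∫ x in B, (ft w x t * phi w ψ χ a x t + (w x t - ε) * ft (phi w ψ χ a) x t) =
      (∫ x in B, ft w x t * phi w ψ χ a x t) + ∫ x in B, (w x t - ε) * ft (phi w ψ χ a) x t := fun t =>
    integral_add (f := fun x => ft w x t * phi w ψ χ a x t) (g := fun x => (w x t - ε) * ft (phi w ψ χ a) x t)
      (int_c (slice_x (F := fun x t => ft w x t * phi w ψ χ a x t) c2 t) hB)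
      (int_c (slice_x (F := fun x t => (w x t - ε) * ft (phi w ψ χ a) x t) c1 t) hB)
  simp only [esplit] at hd
  have ftc := intervalIntegral.integral_eq_sub_of_hasDerivAt (a := 0) (b := T) (fun t _ => hd t)
    ((ci2.add ci1).intervalIntegrable _ _)
  have z : ∀ t, t ∉ Ioo 0 T → ∫ x in B, (w x t - ε) * phi w ψ χ a x t = 0 := by
    intro t ht
    have : χ t = 0 := by
      by_contra h
      exact ht (hsub (hχs (subset_tsupport _ h)))
    simp [phi, this]
  rw [z T (by simp), z 0 (by simp), intervalIntegral.integral_add (ci2.intervalIntegrable _ _) (ci1.intervalIntegrable _ _),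
    intervalIntegral.integral_of_le hT.le, intervalIntegral.integral_of_le hT.le, integral_Ioc_eq_integral_Ioo,
    integral_Ioc_eq_integral_Ioo] at ftc
  have e2 : ∀ t, ∫ x in B, ft w x t * phi w ψ χ a x t = χ t * ∫ x in B, w x t ^ (-a) * ft w x t * ψ x ^ 2 := by
    intro t
    rw [← integral_const_mul]
    congr 1; ext x; simp only [phi]; ring
  simp only [e2] at ftc
  linarith

lemma grad_phi (hw : ContDiff ℝ (⊤ : ℕ∞) (fun p : E N × ℝ => w p.1 p.2)) (hpos : ∀ x t, 0 < w x t)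
    (hψ : ContDiff ℝ (⊤ : ℕ∞) ψ) (x : E N) (t : ℝ) :
    HasFDerivAt (fun y => phi w ψ χ a y t)
      (((-a * w x t ^ (-a - 1) * ψ x ^ 2 * χ t) • fx w x t + (2 * w x t ^ (-a) * ψ x * χ t) • fderiv ℝ ψ x)) x := by
  have h1 := (has_fx' hw x t).rpow_const (p := -a) (Or.inl (hpos x t).ne')
  have h2 := ((hψ.differentiable (by simp) x).hasFDerivAt).pow 2
  have h3 := (h1.mul h2).mul_const (χ t)
  refine h3.congr_fderiv ?_
  ext v
  simp
  ring

lemma grad_alg {W G P l X a : ℝ} (hW : 0 < W) (hP : 0 ≤ P) (hX : 0 ≤ X) (ha : 0 < a) {i : ℝ}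
    (hi : |i| ≤ G * l) :
    (-a * W ^ (-a - 1) * P ^ 2 * X) * G ^ 2 + (2 * W ^ (-a) * P * X) * i ≤
      X * (-(a / 2) * (W ^ (-a - 1) * G ^ 2 * P ^ 2) + 2 / a * l ^ 2 * W ^ (1 - a)) := by
  have e1 : W ^ (-a) = W ^ (-a - 1) * W := by
    rw [← Real.rpow_add_one hW.ne']; congr 1; ring
  have e2 : W ^ (1 - a) = W ^ (-a - 1) * W ^ 2 := by
    rw [← Real.rpow_natCast W 2, ← Real.rpow_add hW]; congr 1; push_cast; ring
  rw [e1, e2]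
  set Z := W ^ (-a - 1) with hZ
  have hZ0 : 0 ≤ Z := Real.rpow_nonneg hW.le _
  have k : (2 * (Z * W) * P * X) * i ≤ (2 * (Z * W) * P * X) * (G * l) :=
    mul_le_mul_of_nonneg_left ((le_abs_self i).trans hi) (by positivity)
  have sq : 0 ≤ X * Z * (1 / (2 * a)) * (a * (G * P) - 2 * (l * W)) ^ 2 := by positivity
  have : X * Z * (1 / (2 * a)) * (a * (G * P) - 2 * (l * W)) ^ 2 =
     X * (-(a / 2) * (Z * G ^ 2 * P ^ 2) + 2 / a * l ^ 2 * (Z * W ^ 2)) - ((-a * Z * P ^ 2 * X) * G ^ 2 + (2 * (Z * W) * P * X) * (G * l)) := by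
    field_simp; ring
  linarith

/-- gradient term -/
lemma test_grad (hw : ContDiff ℝ (⊤ : ℕ∞) (fun p : E N × ℝ => w p.1 p.2)) (hpos : ∀ x t, 0 < w x t)
    (hψ : ContDiff ℝ (⊤ : ℕ∞) ψ) (hχ : ContDiff ℝ (⊤ : ℕ∞) χ) (hχ0 : ∀ t, 0 ≤ χ t) (hB : IsCompact B)
    (hψB : ∀ x ∉ B, ψ x = 0) (hψ0 : ∀ x, 0 ≤ ψ x) {ℓ : ℝ} (hgr : ∀ x, ‖fderiv ℝ ψ x‖ ≤ ℓ) (ha : 0 < a)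
    {Ω U : Set (E N)} (hΩ : IsOpen Ω) (hU : IsOpen U) (hBU : B ⊆ U)
    (hUΩ : U ⊆ Ω) {T α β ε : ℝ}
    {u : E N → ℝ → ℝ} (hχs : tsupport χ ⊆ Ioo α β)
    (huw : ∀ x ∈ U, ∀ t ∈ Ioo α β, w x t = u x t + ε) :
    (∫ t in Ioo 0 T, ∫ x in Ω, ⟪gradient (fun y => u y t) x, gradient (fun y => phi w ψ χ a y t) x⟫) ≤
      ∫ t in Ioo 0 T, χ t * (-(a / 2) * (∫ x in B, w x t ^ (-a - 1) * ‖fx w x t‖ ^ 2 * ψ x ^ 2) +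
        2 / a * ℓ ^ 2 * ∫ x in B, w x t ^ (1 - a)) := by
  have hs := phi_smooth (a := a) hw hpos hψ hχ
  have cgw : Continuous (fun p : E N × ℝ => gradient (fun y => w y p.2) p.1) :=
    (InnerProductSpace.toDual ℝ (E N)).symm.continuous.comp (cont_fx hw)
  have cgp : Continuous (fun p : E N × ℝ => gradient (fun y => phi w ψ χ a y p.2) p.1) :=
    (InnerProductSpace.toDual ℝ (E N)).symm.continuous.comp (cont_fx hs)
  have ci : Continuous (fun p : E N × ℝ => ⟪gradient (fun y => w y p.2) p.1, gradient (fun y => phi w ψ χ a y p.2) p.1⟫) :=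
    cgw.inner cgp
  have cp := cont_pow hw hpos
  have cψ : Continuous (fun p : E N × ℝ => ψ p.1) := hψ.continuous.comp continuous_fst
  have c1 : Continuous (fun p : E N × ℝ => w p.1 p.2 ^ (-a - 1) * ‖fx w p.1 p.2‖ ^ 2 * ψ p.1 ^ 2) :=
    ((cp _).mul ((cont_fx hw).norm.pow 2)).mul (cψ.pow 2)
  have e1 : ∀ t, ∫ x in Ω, ⟪gradient (fun y => u y t) x, gradient (fun y => phi w ψ χ a y t) x⟫ =
      ∫ x in B, ⟪gradient (fun y => w y t) x, gradient (fun y => phi w ψ χ a y t) x⟫ := by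
    intro t
    rw [setIntegral_eq_of_subset_of_forall_sdiff_eq_zero hΩ.measurableSet (hBU.trans hUΩ)]
    · refine setIntegral_congr_fun hB.measurableSet fun x hx => ?_
      by_cases ht : t ∈ Ioo α β
      · have : (fun y => w y t) =ᶠ[nhds x] fun y => u y t + ε := by
          filter_upwards [hU.mem_nhds (hBU hx)] with y hy
          exact huw y hy t ht
        have : gradient (fun y => w y t) x = gradient (fun y => u y t) x := by
          simp only [gradient]
          rw [this.fderiv_eq, fderiv_add_const]
        simp only [this]
      · have hz : gradient (fun y => phi w ψ χ a y t) x = 0 := by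
          have h : χ t = 0 := by
            by_contra h
            exact ht (hχs (subset_tsupport _ h))
          have : (fun y => phi w ψ χ a y t) = fun _ => 0 := by ext y; simp [phi, h]
          rw [this]; simp [gradient]
        simp only [hz, inner_zero_right]
    · intro x hx
      have : (fun y => phi w ψ χ a y t) =ᶠ[nhds x] fun _ => 0 := by
        filter_upwards [hB.isClosed.isOpen_compl.mem_nhds hx.2] with y hy
        simp [phi, hψB y hy]
      have hz : gradient (fun y => phi w ψ χ a y t) x = 0 := by
        simp only [gradient]
        rw [this.fderiv_eq]; simp
      rw [hz, inner_zero_right]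
  simp only [e1]
  have cI1 := cont_int_c (F := fun x t => ⟪gradient (fun y => w y t) x, gradient (fun y => phi w ψ χ a y t) x⟫) ci hB
  have cI2 := cont_int_c (F := fun x t => w x t ^ (-a - 1) * ‖fx w x t‖ ^ 2 * ψ x ^ 2) c1 hB
  have cI3 := cont_int_c (F := fun x t => w x t ^ (1 - a)) (cp _) hB
  have cR : Continuous (fun t => χ t * (-(a / 2) * (∫ x in B, w x t ^ (-a - 1) * ‖fx w x t‖ ^ 2 * ψ x ^ 2) +
        2 / a * ℓ ^ 2 * ∫ x in B, w x t ^ (1 - a))) :=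
    hχ.continuous.mul ((continuous_const.mul cI2).add (continuous_const.mul cI3))
  have key : ∀ t, (∫ x in B, ⟪gradient (fun y => w y t) x, gradient (fun y => phi w ψ χ a y t) x⟫) ≤
      χ t * (-(a / 2) * (∫ x in B, w x t ^ (-a - 1) * ‖fx w x t‖ ^ 2 * ψ x ^ 2) +
        2 / a * ℓ ^ 2 * ∫ x in B, w x t ^ (1 - a)) := by
    intro t
    have i1 := int_c (slice_x (F := fun x t => w x t ^ (-a - 1) * ‖fx w x t‖ ^ 2 * ψ x ^ 2) c1 t) hB
    have i2 := int_c (slice_x (F := fun x t => w x t ^ (1 - a)) (cp _) t) hB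
    rw [← integral_const_mul, ← integral_const_mul, ← integral_add (i1.const_mul _) (i2.const_mul _), ← integral_const_mul]
    refine setIntegral_mono (μ := volume) (int_c (slice_x (F := fun x t => ⟪gradient (fun y => w y t) x, gradient (fun y => phi w ψ χ a y t) x⟫) ci t) hB)
      (((i1.const_mul _).add (i2.const_mul _)).const_mul _) fun x => ?_
    have g1 : gradient (fun y => phi w ψ χ a y t) x = (-a * w x t ^ (-a - 1) * ψ x ^ 2 * χ t) • gradient (fun y => w y t) x
        + (2 * w x t ^ (-a) * ψ x * χ t) • gradient ψ x := by
      simp only [gradient]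
      rw [(grad_phi hw hpos hψ x t).fderiv, map_add, map_smul, map_smul]
    have n1 : ‖gradient (fun y => w y t) x‖ = ‖fx w x t‖ := by simp [gradient, fx]
    have n2 : ‖gradient ψ x‖ ≤ ℓ := by simpa [gradient] using hgr x
    have := grad_alg (W := w x t) (G := ‖fx w x t‖) (P := ψ x) (l := ℓ) (X := χ t) (hpos x t) (hψ0 x) (hχ0 t) ha
      (i := ⟪gradient (fun y => w y t) x, gradient ψ x⟫) (by
        refine (abs_real_inner_le_norm _ _).trans ?_
        rw [n1]
        exact mul_le_mul_of_nonneg_left n2 (norm_nonneg _))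
    simp only
    rw [g1, inner_add_right, inner_smul_right, inner_smul_right, real_inner_self_eq_norm_sq, n1]
    exact this
  refine setIntegral_mono (μ := volume) ?_ ?_ key
  · exact (cI1.continuousOn.integrableOn_compact isCompact_Icc).mono_set Ioo_subset_Icc_self
  · exact (cR.continuousOn.integrableOn_compact isCompact_Icc).mono_set Ioo_subset_Icc_self

/-- nonlocal term -/
lemma test_nonlocal (hN : 2 ≤ N) {s Λ : ℝ} (hs : s ∈ Ioo (0 : ℝ) 1) (hΛ : 1 ≤ Λ)
    (hw : ContDiff ℝ (⊤ : ℕ∞) (fun p : E N × ℝ => w p.1 p.2)) (hpos : ∀ x t, 0 < w x t)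
    (hχ : ContDiff ℝ (⊤ : ℕ∞) χ) (hχ0 : ∀ t, 0 ≤ χ t) (hB : IsCompact B)
    (hψB : ∀ x ∉ B, ψ x = 0) (hψ0 : ∀ x, 0 ≤ ψ x) (hψ1 : ∀ x, ψ x ≤ 1) {ℓ : ℝ} (hℓ : 1 ≤ ℓ)
    (hlip : ∀ x y, |ψ x - ψ y| ≤ ℓ * ‖x - y‖) (ha : 0 < a)
    {T α β ε : ℝ} (hε : 0 < ε) {K : E N → E N → ℝ → ℝ} (hK : KernelOK N s Λ T K)
    {u : E N → ℝ → ℝ} (hsub : Ioo α β ⊆ Ioo 0 T) (hu : ∀ x, ∀ t ∈ Ioo α β, 0 ≤ u x t) (hχs : tsupport χ ⊆ Ioo α β)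
    (huw : ∀ x ∈ B, ∀ t ∈ Ioo α β, w x t = u x t + ε) :
    (∫ t in Ioo 0 T, ∫ x : E N, ∫ y : E N,
          (u x t - u y t) * (phi w ψ χ a x t - phi w ψ χ a y t) * K x y t) ≤
      ∫ t in Ioo 0 T, χ t * ((2 * Λ * ∫ z, mker N s z) * (1 + 1 / a) * ℓ ^ 2 * ∫ x in B, w x t ^ (1 - a)) := by
  have cp := cont_pow hw hpos
  have cI3 := cont_int_c (F := fun x t => w x t ^ (1 - a)) (cp _) hB
  have hM : 0 ≤ 2 * Λ * ∫ z, mker N s z :=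
    mul_nonneg (by linarith) (integral_nonneg fun z => mker_nonneg s z)
  have hb0 : ∀ t, 0 ≤ (2 * Λ * ∫ z, mker N s z) * (1 + 1 / a) * ℓ ^ 2 * ∫ x in B, w x t ^ (1 - a) := fun t =>
    mul_nonneg (mul_nonneg (mul_nonneg hM (by positivity)) (sq_nonneg _))
      (integral_nonneg fun x => Real.rpow_nonneg (hpos x t).le _)
  refine int_le_of_le ?_ (fun t => mul_nonneg (hχ0 t) (hb0 t)) ?_
  · intro t
    by_cases ht : t ∈ Ioo α β
    · have nb := nonlocal_bound hN hs hΛ (κ := fun x y => K x y t) (V := fun x => u x t + ε) (ψ := ψ) (B := B) (ℓ := ℓ) (a := a)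
        (fun x y hxy => ?_) hB.measurableSet (fun x => by linarith [hu x t ht]) hψ0 hψ1 hψB hℓ hlip ha ?_
      · have e1 : ∫ x in B, (u x t + ε) ^ (1 - a) = ∫ x in B, w x t ^ (1 - a) :=
          setIntegral_congr_fun hB.measurableSet fun x hx => by simp only [huw x hx t ht]
        have e2 : ∀ x, phi w ψ χ a x t = χ t * ((u x t + ε) ^ (-a) * ψ x ^ 2) := by
          intro x
          by_cases hx : x ∈ B
          · rw [phi, huw x hx t ht]; ring
          · simp [phi, hψB x hx]
        rw [e1] at nb
        refine le_trans (le_of_eq ?_) (mul_le_mul_of_nonneg_left nb (hχ0 t))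
        rw [← integral_const_mul]
        congr 1; ext x
        rw [← integral_const_mul]
        congr 1; ext y
        rw [e2, e2]; ring
      · have := hK.2.2 x y hxy t (hsub ht)
        exact ⟨le_trans (mul_nonneg (inv_nonneg.2 (by linarith)) (Real.rpow_nonneg (norm_nonneg _) _)) this.1, this.2⟩
      · refine (int_c (slice_x (F := fun x t => w x t ^ (1 - a)) (cp _) t) hB).congr_fun (fun x hx => ?_) hB.measurableSet
        simp only [huw x hx t ht]
    · have h : χ t = 0 := by
        by_contra h
        exact ht (hχs (subset_tsupport _ h))
      simp [phi, h]
  · have c : Continuous (fun t => χ t * ((2 * Λ * ∫ z, mker N s z) * (1 + 1 / a) * ℓ ^ 2 * ∫ x in B, w x t ^ (1 - a))) :=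
      hχ.continuous.mul (continuous_const.mul cI3)
    exact (c.continuousOn.integrableOn_compact isCompact_Icc).mono_set Ioo_subset_Icc_self

lemma bump_nonneg {H : ℝ → ℝ} (hH : Continuous H) {T α β : ℝ} (hsub : Ioo α β ⊆ Ioo 0 T)
    (h : ∀ χ : ℝ → ℝ, ContDiff ℝ (⊤ : ℕ∞) χ → (∀ t, 0 ≤ χ t) → tsupport χ ⊆ Ioo α β → HasCompactSupport χ →
      0 ≤ ∫ t in Ioo 0 T, χ t * H t) {t : ℝ} (ht : t ∈ Ioo α β) : 0 ≤ H t := by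
  by_contra hneg
  push Not at hneg
  have hn : {τ | H τ < 0} ∩ Ioo α β ∈ nhds t :=
    Filter.inter_mem ((isOpen_lt hH continuous_const).mem_nhds hneg) (Ioo_mem_nhds ht.1 ht.2)
  obtain ⟨δ, hδ, hsd⟩ := Metric.nhds_basis_closedBall.mem_iff.1 hn
  let b : ContDiffBump t := ⟨δ / 2, δ, by linarith, by linarith⟩
  have hts : tsupport b = closedBall t δ := b.tsupport_eq
  have h1 := h b b.contDiff (fun τ => b.nonneg) (by rw [hts]; exact fun τ hτ => (hsd hτ).2) b.hasCompactSupport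
  have hle : ∀ τ, b τ * H τ ≤ 0 := by
    intro τ
    by_cases hτ : τ ∈ closedBall t δ
    · exact mul_nonpos_of_nonneg_of_nonpos b.nonneg (le_of_lt (hsd hτ).1)
    · rw [image_eq_zero_of_notMem_tsupport (f := b) (by rw [hts]; exact hτ)]; simp
  have hc : Continuous (fun τ => -(b τ * H τ)) := (b.continuous.mul hH).neg
  have hz : ∀ τ, τ ∉ Ioo 0 T → b τ * H τ = 0 := by
    intro τ hτ
    rw [image_eq_zero_of_notMem_tsupport (f := b) (by rw [hts]; exact fun h => hτ (hsub (hsd h).2))]; simp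
  have hcs : HasCompactSupport (fun τ => -(b τ * H τ)) := by
    refine HasCompactSupport.intro (K := closedBall t δ) (isCompact_closedBall t δ) fun τ hτ => ?_
    rw [image_eq_zero_of_notMem_tsupport (f := b) (by rw [hts]; exact hτ)]; simp
  have pos := Continuous.integral_pos_of_hasCompactSupport_nonneg_nonzero (μ := (volume : Measure ℝ)) (x := t) hc hcs
    (fun τ => by have := hle τ; simp only [Pi.zero_apply]; linarith) (by
      have : b t = 1 := b.one_of_mem_closedBall (mem_closedBall_self (by positivity))
      rw [this]; simp; exact hneg.ne)
  rw [integral_neg, ← setIntegral_eq_integral_of_forall_compl_eq_zero hz] at pos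
  linarith

/-- The slice-wise inequality obtained by testing. -/
lemma test_all (hN : 2 ≤ N) {s Λ : ℝ} (hs : s ∈ Ioo (0 : ℝ) 1) (hΛ : 1 ≤ Λ)
    (hw : ContDiff ℝ (⊤ : ℕ∞) (fun p : E N × ℝ => w p.1 p.2)) (hpos : ∀ x t, 0 < w x t)
    (hψ : ContDiff ℝ (⊤ : ℕ∞) ψ) (hB : IsCompact B)
    (hψB : ∀ x ∉ B, ψ x = 0) (hψ0 : ∀ x, 0 ≤ ψ x) (hψ1 : ∀ x, ψ x ≤ 1) {ℓ : ℝ} (hℓ : 1 ≤ ℓ)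
    (hgr : ∀ x, ‖fderiv ℝ ψ x‖ ≤ ℓ) (ha : 0 < a) {Ω U : Set (E N)} (hΩ : IsOpen Ω) (hU : IsOpen U) (hBU : B ⊆ U)
    (hUΩ : U ⊆ Ω) {T α β ε : ℝ} (hT : 0 < T) (hε : 0 < ε) {K : E N → E N → ℝ → ℝ} (hK : KernelOK N s Λ T K)
    {u : E N → ℝ → ℝ} (hsol : IsWeakSupersolution N T K Ω u)
    (hsub : Ioo α β ⊆ Ioo 0 T) (hu : ∀ x, ∀ t ∈ Ioo α β, 0 ≤ u x t)
    (huw : ∀ x ∈ U, ∀ t ∈ Ioo α β, w x t = u x t + ε) {t : ℝ} (ht : t ∈ Ioo α β) :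
    (a / 2) * (∫ x in B, w x t ^ (-a - 1) * ‖fx w x t‖ ^ 2 * ψ x ^ 2) ≤
      (∫ x in B, w x t ^ (-a) * ft w x t * ψ x ^ 2) +
      (2 + 2 * Λ * ∫ z, mker N s z) * (1 + 1 / a) * ℓ ^ 2 * ∫ x in B, w x t ^ (1 - a) := by
  have hlip : ∀ x y, |ψ x - ψ y| ≤ ℓ * ‖x - y‖ := fun x y =>
    Convex.norm_image_sub_le_of_norm_fderiv_le (𝕜 := ℝ) (s := univ)
      (fun z _ => hψ.differentiable (by simp) z) (fun z _ => hgr z) convex_univ (mem_univ y) (mem_univ x)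
  have cp := cont_pow hw hpos
  have cψ : Continuous (fun p : E N × ℝ => ψ p.1) := hψ.continuous.comp continuous_fst
  have c1 : Continuous (fun p : E N × ℝ => w p.1 p.2 ^ (-a - 1) * ‖fx w p.1 p.2‖ ^ 2 * ψ p.1 ^ 2) :=
    ((cp _).mul ((cont_fx hw).norm.pow 2)).mul (cψ.pow 2)
  have c2 : Continuous (fun p : E N × ℝ => w p.1 p.2 ^ (-a) * ft w p.1 p.2 * ψ p.1 ^ 2) :=
    ((cp _).mul (cont_ft hw)).mul (cψ.pow 2)
  have cI1 := cont_int_c (F := fun x t => w x t ^ (-a) * ft w x t * ψ x ^ 2) c2 hB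
  have cI2 := cont_int_c (F := fun x t => w x t ^ (-a - 1) * ‖fx w x t‖ ^ 2 * ψ x ^ 2) c1 hB
  have cI3 := cont_int_c (F := fun x t => w x t ^ (1 - a)) (cp _) hB
  have cA2 : Continuous (fun t => -(a / 2) * (∫ x in B, w x t ^ (-a - 1) * ‖fx w x t‖ ^ 2 * ψ x ^ 2) +
        2 / a * ℓ ^ 2 * ∫ x in B, w x t ^ (1 - a)) := (continuous_const.mul cI2).add (continuous_const.mul cI3)
  have cA3 : Continuous (fun t => (2 * Λ * ∫ z, mker N s z) * (1 + 1 / a) * ℓ ^ 2 * ∫ x in B, w x t ^ (1 - a)) :=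
    continuous_const.mul cI3
  have cH : Continuous (fun t => (∫ x in B, w x t ^ (-a) * ft w x t * ψ x ^ 2) +
      (-(a / 2) * (∫ x in B, w x t ^ (-a - 1) * ‖fx w x t‖ ^ 2 * ψ x ^ 2) +
        2 / a * ℓ ^ 2 * ∫ x in B, w x t ^ (1 - a)) +
      (2 * Λ * ∫ z, mker N s z) * (1 + 1 / a) * ℓ ^ 2 * ∫ x in B, w x t ^ (1 - a)) := (cI1.add cA2).add cA3
  have := bump_nonneg cH hsub (fun χ hχ hχ0 hχs hχc => ?_) ht
  · have h0 : 0 ≤ ∫ x in B, w x t ^ (1 - a) := integral_nonneg fun x => Real.rpow_nonneg (hpos x t).le _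
    have h00 : 0 ≤ ℓ ^ 2 * ∫ x in B, w x t ^ (1 - a) := mul_nonneg (sq_nonneg _) h0
    revert this h00
    generalize (∫ x in B, w x t ^ (1 - a)) = I3
    generalize (∫ x in B, w x t ^ (-a - 1) * ‖fx w x t‖ ^ 2 * ψ x ^ 2) = I2
    generalize (∫ x in B, w x t ^ (-a) * ft w x t * ψ x ^ 2) = I1
    generalize (∫ z, mker N s z) = M
    intro h1 h2
    have e : (2 + 2 * Λ * M) * (1 + 1 / a) * ℓ ^ 2 * I3 = 2 * (ℓ ^ 2 * I3) + 2 / a * ℓ ^ 2 * I3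
      + (2 * Λ * M) * (1 + 1 / a) * ℓ ^ 2 * I3 := by ring
    rw [e]
    linarith
  · have hts := phi_tsupport (w := w) (χ := χ) (a := a) hB hψB
    have hcs : HasCompactSupport (fun p : E N × ℝ => phi w ψ χ a p.1 p.2) :=
      (hB.prod hχc).of_isClosed_subset (isClosed_tsupport _) hts
    have main := hsol.2.2.2 (phi w ψ χ a) (phi_smooth hw hpos hψ hχ) hcs
      (hts.trans (prod_mono (hBU.trans hUΩ) (hχs.trans hsub))) (fun x t =>
        mul_nonneg (mul_nonneg (Real.rpow_nonneg (hpos x t).le _) (sq_nonneg _)) (hχ0 t))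
    have t1 := test_time (a := a) hw hpos hψ hχ hB hψB hΩ (hBU.trans hUΩ) hT hsub hχs (fun x hx => huw x (hBU hx))
    have t2 := test_grad (a := a) (T := T) hw hpos hψ hχ hχ0 hB hψB hψ0 hgr ha hΩ hU hBU hUΩ hχs huw
    have t3 := test_nonlocal (a := a) hN hs hΛ hw hpos hχ hχ0 hB hψB hψ0 hψ1 hℓ hlip ha hε hK hsub hu hχs
      (fun x hx => huw x (hBU hx))
    rw [t1] at main
    have ii : ∀ {f : ℝ → ℝ}, Continuous f → IntegrableOn (fun t => χ t * f t) (Ioo 0 T) := fun hf =>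
      ((hχ.continuous.mul hf).continuousOn.integrableOn_compact isCompact_Icc).mono_set Ioo_subset_Icc_self
    have e : (∫ t in Ioo 0 T, χ t * ((∫ x in B, w x t ^ (-a) * ft w x t * ψ x ^ 2) +
      (-(a / 2) * (∫ x in B, w x t ^ (-a - 1) * ‖fx w x t‖ ^ 2 * ψ x ^ 2) +
        2 / a * ℓ ^ 2 * ∫ x in B, w x t ^ (1 - a)) +
      (2 * Λ * ∫ z, mker N s z) * (1 + 1 / a) * ℓ ^ 2 * ∫ x in B, w x t ^ (1 - a))) =
      (∫ t in Ioo 0 T, χ t * ∫ x in B, w x t ^ (-a) * ft w x t * ψ x ^ 2) +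
      (∫ t in Ioo 0 T, χ t * (-(a / 2) * (∫ x in B, w x t ^ (-a - 1) * ‖fx w x t‖ ^ 2 * ψ x ^ 2) +
        2 / a * ℓ ^ 2 * ∫ x in B, w x t ^ (1 - a))) +
      ∫ t in Ioo 0 T, χ t * ((2 * Λ * ∫ z, mker N s z) * (1 + 1 / a) * ℓ ^ 2 * ∫ x in B, w x t ^ (1 - a)) := by
      have a1 := integral_add (ii cI1) (ii cA2)
      have a2 := integral_add ((ii cI1).add (ii cA2)) (ii cA3)
      simp only [Pi.add_apply] at a2
      rw [← a1, ← a2]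
      congr 1; ext t; ring
    rw [e]
    linarith

end testing

section scaling
variable {N : ℕ}

lemma change_var (x₀ : E N) {r : ℝ} (hr : 0 < r) (ρ : ℝ) (F : E N → ℝ) :
    ∫ x in closedBall x₀ (r * ρ), F x = r ^ N * ∫ x in closedBall (0 : E N) ρ, F (x₀ + r • x) := by
  rw [← integral_indicator measurableSet_closedBall, ← integral_indicator measurableSet_closedBall]
  have h1 := Measure.integral_comp_smul (volume : Measure (E N))
    (fun y => (closedBall x₀ (r * ρ)).indicator F (x₀ + y)) r
  rw [integral_add_left_eq_self (μ := (volume : Measure (E N))) (fun y => (closedBall x₀ (r * ρ)).indicator F y) x₀] at h1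
  have h2 : (fun x => (closedBall x₀ (r * ρ)).indicator F (x₀ + r • x)) =
      (closedBall (0 : E N) ρ).indicator (fun x => F (x₀ + r • x)) := by
    ext x
    have : (x₀ + r • x ∈ closedBall x₀ (r * ρ)) ↔ x ∈ closedBall (0 : E N) ρ := by
      rw [mem_closedBall, mem_closedBall, dist_eq_norm, dist_eq_norm, add_sub_cancel_left, sub_zero, norm_smul,
        Real.norm_of_nonneg hr.le, mul_le_mul_iff_right₀ hr]
    by_cases h : x ∈ closedBall (0 : E N) ρ
    · rw [indicator_of_mem h, indicator_of_mem (this.2 h)]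
    · rw [indicator_of_notMem h, indicator_of_notMem (fun h' => h (this.1 h'))]
  rw [h2] at h1
  rw [h1]
  simp only [finrank_euclideanSpace, Fintype.card_fin, smul_eq_mul]
  rw [abs_of_pos (by positivity)]
  field_simp

lemma exists_w {T : ℝ} {K : E N → E N → ℝ → ℝ} {Ω : Set (E N)} (hΩ : IsOpen Ω) {u : E N → ℝ → ℝ}
    (hsol : IsWeakSupersolution N T K Ω u) {x₀ : E N} {R r t₀ : ℝ} (hR : ball x₀ R ⊆ Ω)
    (hsub : Ioo (t₀ - r ^ 2) (t₀ + r ^ 2) ⊆ Ioo 0 T)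
    (hu : ∀ x, ∀ t ∈ Ioo (t₀ - r ^ 2) (t₀ + r ^ 2), 0 ≤ u x t) (hr : 0 < r) (hrR : r < R / 2)
    {S ε : ℝ} (hS0 : 0 < S) (hS : S < 1) (hε : 0 < ε) :
    ∃ w : E N → ℝ → ℝ, ContDiff ℝ (⊤ : ℕ∞) (fun p : E N × ℝ => w p.1 p.2) ∧ (∀ x t, 0 < w x t) ∧
      ∀ x ∈ ball x₀ (7 / 4 * r), ∀ t ∈ Ioo (t₀ - r ^ 2 * ((1 + S) / 2)) (t₀ + r ^ 2 * ((1 + S) / 2)), w x t = u x t + ε := by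
  have hr2 : 0 < r ^ 2 := by positivity
  let b1 : ContDiffBump x₀ := ⟨7 / 4 * r, 15 / 8 * r, by linarith, by linarith⟩
  let b2 : ContDiffBump t₀ := ⟨r ^ 2 * ((1 + S) / 2), r ^ 2 * ((3 + S) / 4), by nlinarith, by nlinarith⟩
  have hb1 : tsupport b1 = closedBall x₀ (15 / 8 * r) := b1.tsupport_eq
  have hb2 : tsupport b2 = closedBall t₀ (r ^ 2 * ((3 + S) / 4)) := b2.tsupport_eq
  have hV1 : closedBall x₀ (15 / 8 * r) ⊆ Ω := (closedBall_subset_ball (by linarith)).trans hR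
  have hV2 : closedBall t₀ (r ^ 2 * ((3 + S) / 4)) ⊆ Ioo (t₀ - r ^ 2) (t₀ + r ^ 2) := by
    intro t ht
    rw [Real.closedBall_eq_Icc] at ht
    constructor <;> nlinarith [ht.1, ht.2]
  let b : E N × ℝ → ℝ := fun p => b1 p.1 * b2 p.2
  have hbs : ContDiff ℝ (⊤ : ℕ∞) b := (b1.contDiff.comp contDiff_fst).mul (b2.contDiff.comp contDiff_snd)
  have hbt : ∀ p : E N × ℝ, ¬ (p.1 ∈ closedBall x₀ (15 / 8 * r) ∧ p.2 ∈ closedBall t₀ (r ^ 2 * ((3 + S) / 4))) → b p = 0 := by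
    intro p hp
    by_cases h1 : p.1 ∈ closedBall x₀ (15 / 8 * r)
    · have h2 : p.2 ∉ closedBall t₀ (r ^ 2 * ((3 + S) / 4)) := fun h => hp ⟨h1, h⟩
      simp only [b]
      rw [image_eq_zero_of_notMem_tsupport (f := b2) (by rw [hb2]; exact h2), mul_zero]
    · simp only [b]
      rw [image_eq_zero_of_notMem_tsupport (f := b1) (by rw [hb1]; exact h1), zero_mul]
  have hb0 : ∀ p, 0 ≤ b p := fun p => mul_nonneg b1.nonneg b2.nonneg
  have hb1' : ∀ p, b p ≤ 1 := fun p => mul_le_one₀ b1.le_one b2.nonneg b2.le_one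
  refine ⟨fun x t => b (x, t) * (u x t + ε) + (1 - b (x, t)), ?_, ?_, ?_⟩
  · rw [contDiff_iff_contDiffAt]
    intro p
    by_cases hp : p.1 ∈ closedBall x₀ (15 / 8 * r) ∧ p.2 ∈ closedBall t₀ (r ^ 2 * ((3 + S) / 4))
    · have hm : Ω ×ˢ Ioo 0 T ∈ nhds p := (hΩ.prod isOpen_Ioo).mem_nhds ⟨hV1 hp.1, hsub (hV2 hp.2)⟩
      have hus : ContDiffAt ℝ (⊤ : ℕ∞) (fun p : E N × ℝ => u p.1 p.2) p := hsol.2.2.1.contDiffAt hm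
      exact (hbs.contDiffAt.mul (hus.add contDiffAt_const)).add (contDiffAt_const.sub hbs.contDiffAt)
    · have hop : IsOpen {p : E N × ℝ | ¬ (p.1 ∈ closedBall x₀ (15 / 8 * r) ∧ p.2 ∈ closedBall t₀ (r ^ 2 * ((3 + S) / 4)))} :=
        (isClosed_closedBall.prod isClosed_closedBall).isOpen_compl
      have : (fun p : E N × ℝ => b (p.1, p.2) * (u p.1 p.2 + ε) + (1 - b (p.1, p.2))) =ᶠ[nhds p] fun _ => 1 := by
        filter_upwards [hop.mem_nhds hp] with y hy
        rw [show b (y.1, y.2) = 0 from hbt y hy]; ring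
      exact contDiffAt_const.congr_of_eventuallyEq this
  · intro x t
    change 0 < b (x, t) * (u x t + ε) + (1 - b (x, t))
    by_cases hp : x ∈ closedBall x₀ (15 / 8 * r) ∧ t ∈ closedBall t₀ (r ^ 2 * ((3 + S) / 4))
    · have h1 := hu x t (hV2 hp.2)
      have h2 := hb0 (x, t)
      have h3 := hb1' (x, t)
      rcases h2.eq_or_lt with h | h
      · rw [← h]; norm_num
      · have := mul_pos h (by linarith : 0 < u x t + ε)
        linarith
    · rw [show b (x, t) = 0 from hbt (x, t) hp]; norm_num
  · intro x hx t ht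
    have h1 : b1 x = 1 := b1.one_of_mem_closedBall (ball_subset_closedBall hx)
    have h2 : b2 t = 1 := b2.one_of_mem_closedBall (by
      rw [Real.closedBall_eq_Icc]
      exact Ioo_subset_Icc_self ht)
    simp [b, h1, h2]

/-- energy inequality for all exponents in unit scale -/
def EnIneq (N : ℕ) (C S : ℝ) (g : E N → ℝ → ℝ) : Prop :=
  ∀ a, 0 < a → ∀ (Ψ : E N → ℝ) (ρ L : ℝ), Cut N Ψ ρ L → ρ ≤ 3 / 2 → ∀ t, |t| ≤ S →
    (a / 2) * (∫ x in closedBall (0 : E N) ρ, g x t ^ (-a - 1) * ‖fx g x t‖ ^ 2 * Ψ x ^ 2) ≤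
      (∫ x in closedBall (0 : E N) ρ, g x t ^ (-a) * ft g x t * Ψ x ^ 2) +
      C * (1 + 1 / a) * L ^ 2 * ∫ x in closedBall (0 : E N) ρ, g x t ^ (1 - a)

lemma scaled (hN : 2 ≤ N) {s Λ : ℝ} (hs : s ∈ Ioo (0 : ℝ) 1) (hΛ : 1 ≤ Λ)
    {T : ℝ} {K : E N → E N → ℝ → ℝ} {Ω : Set (E N)} {u : E N → ℝ → ℝ} {x₀ : E N} {R r t₀ : ℝ}
    (hT : 0 < T) (hΩ : IsOpen Ω) (hK : KernelOK N s Λ T K)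
    (hsol : IsWeakSupersolution N T K Ω u) (hR : ball x₀ R ⊆ Ω)
    (hsub : Ioo (t₀ - r ^ 2) (t₀ + r ^ 2) ⊆ Ioo 0 T)
    (hu : ∀ x, ∀ t ∈ Ioo (t₀ - r ^ 2) (t₀ + r ^ 2), 0 ≤ u x t) (hr : 0 < r) (hr1 : r ≤ 1) (hrR : r < R / 2)
    {S ε : ℝ} (hS0 : 0 < S) (hS : S < 1) (hε : 0 < ε) :
    ∃ g : E N → ℝ → ℝ, ContDiff ℝ (⊤ : ℕ∞) (fun p : E N × ℝ => g p.1 p.2) ∧ (∀ x t, 0 < g x t) ∧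
      (∀ x ∈ closedBall (0 : E N) 1, ∀ t, |t| ≤ S → g x t = u (x₀ + r • x) (t₀ + r ^ 2 * t) + ε) ∧
      EnIneq N (2 + 2 * Λ * ∫ z, mker N s z) S g := by
  obtain ⟨w, hw, hpos, hwu⟩ := exists_w hΩ hsol hR hsub hu hr hrR hS0 hS hε
  have hr2 : 0 < r ^ 2 := by positivity
  have htm : ∀ t, |t| ≤ S → t₀ + r ^ 2 * t ∈ Ioo (t₀ - r ^ 2 * ((1 + S) / 2)) (t₀ + r ^ 2 * ((1 + S) / 2)) := by
    intro t ht
    rw [abs_le] at ht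
    constructor <;> nlinarith [ht.1, ht.2]
  have hsub' : Ioo (t₀ - r ^ 2 * ((1 + S) / 2)) (t₀ + r ^ 2 * ((1 + S) / 2)) ⊆ Ioo (t₀ - r ^ 2) (t₀ + r ^ 2) :=
    Ioo_subset_Ioo (by nlinarith) (by nlinarith)
  have hgs : ContDiff ℝ (⊤ : ℕ∞) (fun p : E N × ℝ => w (x₀ + r • p.1) (t₀ + r ^ 2 * p.2)) := by
    have : ContDiff ℝ (⊤ : ℕ∞) (fun p : E N × ℝ => (x₀ + r • p.1, t₀ + r ^ 2 * p.2)) := by fun_prop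
    exact hw.comp this
  refine ⟨fun x t => w (x₀ + r • x) (t₀ + r ^ 2 * t), hgs, fun x t => hpos _ _, ?_, ?_⟩
  · intro x hx t ht
    refine hwu _ ?_ _ (htm t ht)
    rw [mem_closedBall, dist_zero_right] at hx
    rw [mem_ball, dist_eq_norm, add_sub_cancel_left, norm_smul, Real.norm_of_nonneg hr.le]
    nlinarith
  · intro a ha Ψ ρ L hΨ hρ t ht
    have hψs : ContDiff ℝ (⊤ : ℕ∞) (fun x : E N => Ψ (r⁻¹ • (x - x₀))) := by
      have : ContDiff ℝ (⊤ : ℕ∞) (fun x : E N => r⁻¹ • (x - x₀)) := by fun_prop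
      exact hΨ.smooth.comp this
    have main := test_all (w := w) (ψ := fun x => Ψ (r⁻¹ • (x - x₀))) (a := a) (B := closedBall x₀ (r * ρ)) hN hs hΛ hw hpos hψs
      (isCompact_closedBall _ _) (fun x hx => hΨ.supp _ (by
        intro h
        apply hx
        rw [mem_closedBall, dist_zero_right, norm_smul, norm_inv, Real.norm_of_nonneg hr.le, inv_mul_le_iff₀ hr] at h
        rwa [mem_closedBall, dist_eq_norm])) (fun x => hΨ.nonneg _) (fun x => hΨ.le_one _) (ℓ := L / r)
      (by rw [le_div_iff₀ hr]; linarith [hΨ.one_le]) (fun x => by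
        have h1 : HasFDerivAt (fun x : E N => r⁻¹ • (x - x₀)) (r⁻¹ • ContinuousLinearMap.id ℝ (E N)) x :=
          ((hasFDerivAt_id x).sub_const x₀).const_smul r⁻¹
        have h2 := (hΨ.smooth.differentiable (by simp) (r⁻¹ • (x - x₀))).hasFDerivAt.comp x h1
        have h3 : fderiv ℝ (fun x => Ψ (r⁻¹ • (x - x₀))) x = r⁻¹ • fderiv ℝ Ψ (r⁻¹ • (x - x₀)) := by
          rw [show (fun x => Ψ (r⁻¹ • (x - x₀))) = Ψ ∘ fun x => r⁻¹ • (x - x₀) from rfl, h2.fderiv]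
          ext v; simp
        rw [h3, norm_smul, norm_inv, Real.norm_of_nonneg hr.le, div_eq_inv_mul]
        exact mul_le_mul_of_nonneg_left (hΨ.grad _) (by positivity))
      ha hΩ (isOpen_ball (x := x₀) (ε := 7 / 4 * r)) (closedBall_subset_ball (by nlinarith))
      ((ball_subset_ball (by linarith)).trans hR) hT hε hK hsol (hsub'.trans hsub)
      (fun x t ht => hu x t (hsub' ht)) hwu (htm t ht)
    rw [change_var x₀ hr, change_var x₀ hr, change_var x₀ hr] at main
    have ex : ∀ x : E N, r⁻¹ • (x₀ + r • x - x₀) = x := by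
      intro x; rw [add_sub_cancel_left, smul_smul, inv_mul_cancel₀ hr.ne', one_smul]
    simp only [ex] at main
    have efx : ∀ x, fx (fun x t => w (x₀ + r • x) (t₀ + r ^ 2 * t)) x t = r • fx w (x₀ + r • x) (t₀ + r ^ 2 * t) := by
      intro x
      have h1 : HasFDerivAt (fun x : E N => x₀ + r • x) (r • ContinuousLinearMap.id ℝ (E N)) x :=
        ((hasFDerivAt_id x).const_smul r).const_add x₀
      have h2 := (has_fx' hw (x₀ + r • x) (t₀ + r ^ 2 * t)).comp x h1
      rw [fx]
      rw [show (fun y => (fun x t => w (x₀ + r • x) (t₀ + r ^ 2 * t)) y t) = (fun y => w y (t₀ + r ^ 2 * t)) ∘ fun x => x₀ + r • x from rfl, h2.fderiv]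
      ext v; simp
    have eft : ∀ x, ft (fun x t => w (x₀ + r • x) (t₀ + r ^ 2 * t)) x t = r ^ 2 * ft w (x₀ + r • x) (t₀ + r ^ 2 * t) := by
      intro x
      have h1 : HasDerivAt (fun t : ℝ => t₀ + r ^ 2 * t) (r ^ 2 * 1) t :=
        ((hasDerivAt_id t).const_mul (r ^ 2)).const_add t₀
      have h2 := (has_ft' hw (x₀ + r • x) (t₀ + r ^ 2 * t)).comp t h1
      rw [ft]
      rw [show (fun τ => (fun x t => w (x₀ + r • x) (t₀ + r ^ 2 * t)) x τ) = (fun τ => w (x₀ + r • x) τ) ∘ fun t => t₀ + r ^ 2 * t from rfl, h2.deriv]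
      ring
    simp only [efx, eft, norm_smul, Real.norm_of_nonneg hr.le]
    have e1 : (∫ x in closedBall (0 : E N) ρ, w (x₀ + r • x) (t₀ + r ^ 2 * t) ^ (-a - 1) * (r * ‖fx w (x₀ + r • x) (t₀ + r ^ 2 * t)‖) ^ 2 * Ψ x ^ 2)
      = r ^ 2 * ∫ x in closedBall (0 : E N) ρ, w (x₀ + r • x) (t₀ + r ^ 2 * t) ^ (-a - 1) * ‖fx w (x₀ + r • x) (t₀ + r ^ 2 * t)‖ ^ 2 * Ψ x ^ 2 := by
      rw [← integral_const_mul]; congr 1; ext x; ring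
    have e2 : (∫ x in closedBall (0 : E N) ρ, w (x₀ + r • x) (t₀ + r ^ 2 * t) ^ (-a) * (r ^ 2 * ft w (x₀ + r • x) (t₀ + r ^ 2 * t)) * Ψ x ^ 2)
      = r ^ 2 * ∫ x in closedBall (0 : E N) ρ, w (x₀ + r • x) (t₀ + r ^ 2 * t) ^ (-a) * ft w (x₀ + r • x) (t₀ + r ^ 2 * t) * Ψ x ^ 2 := by
      rw [← integral_const_mul]; congr 1; ext x; ring
    rw [e1, e2]
    revert main
    generalize (∫ x in closedBall (0 : E N) ρ, w (x₀ + r • x) (t₀ + r ^ 2 * t) ^ (-a - 1) * ‖fx w (x₀ + r • x) (t₀ + r ^ 2 * t)‖ ^ 2 * Ψ x ^ 2) = I1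
    generalize (∫ x in closedBall (0 : E N) ρ, w (x₀ + r • x) (t₀ + r ^ 2 * t) ^ (-a) * ft w (x₀ + r • x) (t₀ + r ^ 2 * t) * Ψ x ^ 2) = I2
    generalize (∫ x in closedBall (0 : E N) ρ, w (x₀ + r • x) (t₀ + r ^ 2 * t) ^ (1 - a)) = I3
    generalize (2 + 2 * Λ * ∫ z, mker N s z) = M
    intro main
    have hrN : 0 < r ^ N := by positivity
    have hq : r ^ N * (a / 2 * I1) ≤ r ^ N * (I2 + M * (1 + 1 / a) * (L / r) ^ 2 * I3) := by
      refine le_trans (le_of_eq ?_) (main.trans (le_of_eq ?_)) <;> ring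
    have hq2 := mul_le_mul_of_nonneg_left (le_of_mul_le_mul_left hq hrN) hr2.le
    refine le_trans (le_of_eq ?_) (hq2.trans (le_of_eq ?_))
    · ring
    · field_simp

end scaling

section good
variable {N : ℕ} {C S : ℝ} {g : E N → ℝ → ℝ}

lemma good_inv (hg : ContDiff ℝ (⊤ : ℕ∞) (fun p : E N × ℝ => g p.1 p.2)) (hpos : ∀ x t, 0 < g x t)
    (hC : 0 ≤ C) (hE : EnIneq N C S g) (pb : ℝ) : GoodF N (1 / 2) (2 * C) pb S (fun x t => (g x t)⁻¹) where
  smooth := hg.inv fun p => (hpos _ _).ne'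
  pos := fun x t => inv_pos.2 (hpos x t)
  ineq := by
    intro p hp _ Ψ ρ L hΨ hρ t ht
    have main := hE (1 + p) (by linarith) Ψ ρ L hΨ hρ t (by rw [abs_of_nonneg ht.1]; exact ht.2)
    have eft : ∀ x, ft (fun x t => (g x t)⁻¹) x t = -(g x t) ^ (-2 : ℝ) * ft g x t := by
      intro x
      have h := (has_ft' hg x t).inv (hpos x t).ne'
      have h2 : ft (fun x t => (g x t)⁻¹) x t = -ft g x t / g x t ^ 2 := h.deriv
      rw [h2, Real.rpow_neg (hpos x t).le, Real.rpow_two]; field_simp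
    have efx : ∀ x, ‖fx (fun x t => (g x t)⁻¹) x t‖ = g x t ^ (-2 : ℝ) * ‖fx g x t‖ := by
      intro x
      have h := (hasDerivAt_inv (hpos x t).ne').comp_hasFDerivAt x (has_fx' hg x t)
      have h2 : fx (fun x t => (g x t)⁻¹) x t = (-(g x t ^ 2)⁻¹) • fx g x t := h.fderiv
      rw [h2, norm_smul, norm_neg, norm_inv, norm_pow, Real.norm_of_nonneg (hpos x t).le, Real.rpow_neg (hpos x t).le, Real.rpow_two]
    have epow : ∀ x (e : ℝ), (g x t)⁻¹ ^ e = g x t ^ (-e) := by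
      intro x e; rw [Real.inv_rpow (hpos x t).le, Real.rpow_neg (hpos x t).le]
    have e1 : (∫ x in closedBall (0 : E N) ρ, (g x t)⁻¹ ^ (p - 1) * ft (fun x t => (g x t)⁻¹) x t * Ψ x ^ 2) =
        -∫ x in closedBall (0 : E N) ρ, g x t ^ (-(1 + p)) * ft g x t * Ψ x ^ 2 := by
      rw [← integral_neg]
      congr 1; ext x
      rw [eft, epow, show -(1 + p) = -(p - 1) + (-2) by ring, Real.rpow_add (hpos x t)]; ring
    have e2 : (∫ x in closedBall (0 : E N) ρ, (g x t)⁻¹ ^ (p - 2) * ‖fx (fun x t => (g x t)⁻¹) x t‖ ^ 2 * Ψ x ^ 2) =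
        ∫ x in closedBall (0 : E N) ρ, g x t ^ (-(1 + p) - 1) * ‖fx g x t‖ ^ 2 * Ψ x ^ 2 := by
      congr 1; ext x
      rw [efx, epow, show -(1 + p) - 1 = -(p - 2) + (-2) + (-2) by ring, Real.rpow_add (hpos x t), Real.rpow_add (hpos x t)]; ring
    have e3 : (∫ x in closedBall (0 : E N) ρ, (g x t)⁻¹ ^ p) = ∫ x in closedBall (0 : E N) ρ, g x t ^ (1 - (1 + p)) := by
      congr 1; ext x
      rw [epow]; congr 1; ring
    rw [e1, e2, e3]
    have n1 : 0 ≤ ∫ x in closedBall (0 : E N) ρ, g x t ^ (-(1 + p) - 1) * ‖fx g x t‖ ^ 2 * Ψ x ^ 2 :=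
      integral_nonneg fun x => mul_nonneg (mul_nonneg (Real.rpow_nonneg (hpos x t).le _) (sq_nonneg _)) (sq_nonneg _)
    have n2 : 0 ≤ ∫ x in closedBall (0 : E N) ρ, g x t ^ (1 - (1 + p)) :=
      integral_nonneg fun x => Real.rpow_nonneg (hpos x t).le _
    revert main n1 n2
    generalize (∫ x in closedBall (0 : E N) ρ, g x t ^ (-(1 + p) - 1) * ‖fx g x t‖ ^ 2 * Ψ x ^ 2) = I1
    generalize (∫ x in closedBall (0 : E N) ρ, g x t ^ (-(1 + p)) * ft g x t * Ψ x ^ 2) = I2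
    generalize (∫ x in closedBall (0 : E N) ρ, g x t ^ (1 - (1 + p))) = I3
    intro main n1 n2
    have k1 : 1 / 2 * I1 ≤ (1 + p) / 2 * I1 := mul_le_mul_of_nonneg_right (by linarith) n1
    have k2 : 1 / (1 + p) ≤ 1 := by rw [div_le_one (by linarith)]; linarith
    have k3 : 0 ≤ C * L ^ 2 * I3 := mul_nonneg (mul_nonneg hC (sq_nonneg _)) n2
    have k4 : C * (1 + 1 / (1 + p)) * L ^ 2 * I3 ≤ 2 * C * L ^ 2 * I3 := by nlinarith
    linarith

lemma good_refl (hg : ContDiff ℝ (⊤ : ℕ∞) (fun p : E N × ℝ => g p.1 p.2)) (hpos : ∀ x t, 0 < g x t)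
    (hC : 0 ≤ C) (hE : EnIneq N C S g) {pb : ℝ} (hpb : pb < 1) :
    GoodF N ((1 - pb) / 2) (C * (1 + 1 / (1 - pb))) pb S (fun x t => g x (-t)) where
  smooth := by
    have : ContDiff ℝ (⊤ : ℕ∞) (fun p : E N × ℝ => (p.1, -p.2)) := by fun_prop
    exact hg.comp this
  pos := fun x t => hpos x _
  ineq := by
    intro p hp hpp Ψ ρ L hΨ hρ t ht
    have main := hE (1 - p) (by linarith) Ψ ρ L hΨ hρ (-t) (by rw [abs_neg, abs_of_nonneg ht.1]; exact ht.2)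
    have eft : ∀ x, ft (fun x t => g x (-t)) x t = -ft g x (-t) := by
      intro x
      have h := (has_ft' hg x (-t)).comp t (hasDerivAt_neg t)
      have h2 : ft (fun x t => g x (-t)) x t = ft g x (-t) * -1 := h.deriv
      rw [h2]; ring
    have efx : ∀ x, fx (fun x t => g x (-t)) x t = fx g x (-t) := fun x => rfl
    have e1 : (∫ x in closedBall (0 : E N) ρ, g x (-t) ^ (p - 1) * ft (fun x t => g x (-t)) x t * Ψ x ^ 2) =
        -∫ x in closedBall (0 : E N) ρ, g x (-t) ^ (-(1 - p)) * ft g x (-t) * Ψ x ^ 2 := by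
      rw [← integral_neg]
      congr 1; ext x
      rw [eft, show -(1 - p) = p - 1 by ring]; ring
    simp only [efx]
    rw [e1, show -(1 - p) - 1 = p - 2 by ring, show 1 - (1 - p) = p by ring] at *
    have n1 : 0 ≤ ∫ x in closedBall (0 : E N) ρ, g x (-t) ^ (p - 2) * ‖fx g x (-t)‖ ^ 2 * Ψ x ^ 2 :=
      integral_nonneg fun x => mul_nonneg (mul_nonneg (Real.rpow_nonneg (hpos x _).le _) (sq_nonneg _)) (sq_nonneg _)
    have n2 : 0 ≤ ∫ x in closedBall (0 : E N) ρ, g x (-t) ^ p :=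
      integral_nonneg fun x => Real.rpow_nonneg (hpos x _).le _
    revert main n1 n2
    generalize (∫ x in closedBall (0 : E N) ρ, g x (-t) ^ (p - 2) * ‖fx g x (-t)‖ ^ 2 * Ψ x ^ 2) = I1
    generalize (∫ x in closedBall (0 : E N) ρ, g x (-t) ^ (-(1 - p)) * ft g x (-t) * Ψ x ^ 2) = I2
    generalize (∫ x in closedBall (0 : E N) ρ, g x (-t) ^ p) = I3
    intro main n1 n2
    have k1 : (1 - pb) / 2 * I1 ≤ (1 - p) / 2 * I1 := mul_le_mul_of_nonneg_right (by linarith) n1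
    have k2 : 1 / (1 - p) ≤ 1 / (1 - pb) := one_div_le_one_div_of_le (by linarith) (by linarith)
    have k3 : 0 ≤ C * L ^ 2 * I3 := mul_nonneg (mul_nonneg hC (sq_nonneg _)) n2
    have k4 : C * (1 + 1 / (1 - p)) * L ^ 2 * I3 ≤ C * (1 + 1 / (1 - pb)) * L ^ 2 * I3 := by
      nlinarith [mul_le_mul_of_nonneg_left k2 k3]
    linarith

end good

section final
variable {N : ℕ}

lemma lp_sup {F : ℝ × E N → ℝ} (hF : Continuous F) (hpos : ∀ z, 0 < F z) {Z : Set (ℝ × E N)}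
    {A : ℝ} (hA : 0 < A) (h : ∀ n : ℕ, 1 ≤ n → IntegrableOn (fun z => F z ^ (n : ℝ)) Z ∧ ∫ z in Z, F z ^ (n : ℝ) ≤ A ^ n)
    {z₁ : ℝ × E N} (hz : Z ∈ nhds z₁) : F z₁ ≤ A := by
  by_contra hlt
  push Not at hlt
  obtain ⟨A', hA1, hA2⟩ := exists_between hlt
  have hn : {z | A' < F z} ∩ Z ∈ nhds z₁ :=
    Filter.inter_mem ((isOpen_lt continuous_const hF).mem_nhds hA2) hz
  obtain ⟨δ, hδ, hsd⟩ := Metric.nhds_basis_ball.mem_iff.1 hn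
  set O := ball z₁ δ with hO
  have hOm : 0 < (volume O).toReal := ENNReal.toReal_pos (measure_ball_pos _ _ hδ).ne' measure_ball_lt_top.ne
  have key : ∀ n : ℕ, 1 ≤ n → (volume O).toReal * A' ^ n ≤ A ^ n := by
    intro n hn
    obtain ⟨hi, hle⟩ := h n hn
    have hOZ : O ⊆ Z := fun z hz => (hsd hz).2
    refine le_trans ?_ ((setIntegral_mono_set hi (.of_forall fun z => Real.rpow_nonneg (hpos z).le _)
      (LE.le.eventuallyLE hOZ)).trans hle)
    have h1 : ∫ z in O, A' ^ n = (volume O).toReal * A' ^ n := by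
      rw [setIntegral_const, smul_eq_mul]; rfl
    rw [← h1]
    refine setIntegral_mono_on (integrableOn_const measure_ball_lt_top.ne) (hi.mono_set hOZ) measurableSet_ball fun z hz => ?_
    rw [Real.rpow_natCast]
    exact pow_le_pow_left₀ (hA.trans hA1).le (le_of_lt (hsd hz).1) n
  have hA' : 0 < A' := hA.trans hA1
  have hlim := tendsto_pow_atTop_nhds_zero_of_lt_one (r := A / A') (by positivity) ((div_lt_one hA').2 hA1)
  have : (volume O).toReal ≤ 0 := by
    refine ge_of_tendsto hlim ?_
    filter_upwards [Filter.eventually_ge_atTop 1] with n hn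
    rw [div_pow, le_div_iff₀ (by positivity)]
    exact key n hn
  linarith

lemma q_lt (hN : 2 ≤ N) {q : ℝ} (hq1 : q < 2 - 2 / kappa N) : q < 1 + 2 / (N : ℝ) := by
  unfold kappa at hq1
  split_ifs at hq1 with h
  · have h3 : (2 : ℝ) < N := by exact_mod_cast h
    have : 2 / (2 * (N : ℝ) / (N - 2)) = 1 - 2 / N := by
      have : (N : ℝ) - 2 ≠ 0 := by linarith
      field_simp
    linarith
  · have h2 : N = 2 := by omega
    subst h2
    norm_num at *
    linarith

lemma core (hN : 2 ≤ N) {s Λ : ℝ} (hs : s ∈ Ioo (0 : ℝ) 1) (hΛ : 1 ≤ Λ) {q : ℝ} (hq0 : 0 < q) (hq1 : q < 1 + 2 / (N : ℝ)) :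
    ∃ B : ℝ, ∀ S, 3 / 4 < S → S < 1 → ∀ g : E N → ℝ → ℝ, ContDiff ℝ (⊤ : ℕ∞) (fun p : E N × ℝ => g p.1 p.2) →
      (∀ x t, 0 < g x t) → EnIneq N (2 + 2 * Λ * ∫ z, mker N s z) S g →
      ∀ x₁ ∈ ball (0 : E N) (1 / 2), ∀ t₁ ∈ Ioo (3 / 4) S,
        Icyl N (fun x t => g x (-t)) S (1 / 2) q ≤ (Real.exp B * g x₁ t₁) ^ q := by
  obtain ⟨D, hD, hcut⟩ := exists_cut N
  obtain ⟨Ψ, hΨ, hΨ1, hrad⟩ := hcut 1 (3 / 2) (by norm_num) (by norm_num) le_rfl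
  have hC : 0 < 2 + 2 * Λ * ∫ z, mker N s z := by
    have : 0 ≤ ∫ z, mker N s z := integral_nonneg fun z => mker_nonneg s z
    have : 0 ≤ 2 * Λ * ∫ z, mker N s z := mul_nonneg (by linarith) this
    linarith
  set C := 2 + 2 * Λ * ∫ z, mker N s z
  have hσ : 0 < 1 + 2 / (N : ℝ) := by positivity
  set pb := q / (1 + 2 / (N : ℝ)) with hpbd
  have hpb : pb < 1 := by rw [hpbd, div_lt_one hσ]; exact hq1
  have hpb' : 0 < 1 - pb := by linarith
  obtain ⟨B1, -, h1⟩ := harn hN (c := 1 / 2) (C := 2 * C) (q0 := 1) (by positivity) (by norm_num) one_pos hΨ hrad hΨ1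
  obtain ⟨B2, -, h2⟩ := harn hN (c := (1 - pb) / 2) (C := C * (1 + 1 / (1 - pb))) (q0 := q) (by positivity) (by linarith) hq0 hΨ hrad hΨ1
  refine ⟨B1 + B2, fun S hS0 hS1 g hg hpos hE x₁ hx₁ t₁ ht₁ => ?_⟩
  have k2 := h2 pb S _ q (good_refl hg hpos hC.le hE hpb) hS0 hS1.le le_rfl (by rw [hpbd]; field_simp; exact le_rfl)
  have em : meanLog N Ψ (fun x t => (g x t)⁻¹) = -meanLog N Ψ (fun x t => g x (-t)) := by
    simp only [meanLog, Real.log_inv, neg_zero, neg_mul, integral_neg, neg_div]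
  set m := meanLog N Ψ (fun x t => g x (-t)) with hm
  have gi := fun pb => good_inv hg hpos hC.le hE pb
  have hlow : (g x₁ t₁)⁻¹ ≤ Real.exp (B1 - m) := by
    have hfc : Continuous (fun z : ℝ × E N => (g z.2 z.1)⁻¹) :=
      (gi 0).smooth.continuous.comp (continuous_snd.prodMk continuous_fst)
    refine lp_sup (F := fun z : ℝ × E N => (g z.2 z.1)⁻¹) hfc (fun z => inv_pos.2 (hpos _ _))
      (Z := Ioc (tau (1 / 2)) S ×ˢ closedBall (0 : E N) (1 / 2)) (Real.exp_pos _) (fun n hn => ?_) (z₁ := (t₁, x₁)) ?_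
    · have hn' : (1 : ℝ) ≤ n := by exact_mod_cast hn
      have a1 := h1 (n / (1 + 2 / (N : ℝ))) S _ n (gi _) hS0 hS1.le hn' (by field_simp; exact le_rfl)
      obtain ⟨a2, a3⟩ := Icyl_prod (gi 0).smooth (gi 0).pos hS0 (θ := 1 / 2) (n : ℝ) le_rfl
      refine ⟨a2, ?_⟩
      rw [a3, em, mul_comm, Real.exp_mul, Real.rpow_natCast] at a1
      exact a1
    · refine prod_mem_nhds (Ioc_mem_nhds ?_ ht₁.2) (Filter.mem_of_superset (isOpen_ball.mem_nhds hx₁) ball_subset_closedBall)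
      have := ht₁.1
      unfold tau; linarith
  have hg1 := hpos x₁ t₁
  have hm1 : Real.exp m ≤ Real.exp B1 * g x₁ t₁ := by
    rw [inv_le_iff_one_le_mul₀ hg1, Real.exp_sub] at hlow
    have := Real.exp_pos m
    rw [div_mul_eq_mul_div, le_div_iff₀ this] at hlow
    linarith
  refine k2.trans ?_
  rw [mul_comm q, Real.exp_mul]
  refine Real.rpow_le_rpow (Real.exp_pos _).le ?_ hq0.le
  rw [Real.exp_add, Real.exp_add]
  nlinarith [Real.exp_pos B2]

end final

section final2
variable {N : ℕ}

/-- for fixed S and ε -/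
lemma bound_S {u g : E N → ℝ → ℝ} (hg : ContDiff ℝ (⊤ : ℕ∞) (fun p : E N × ℝ => g p.1 p.2)) (hpos : ∀ x t, 0 < g x t)
    {x₀ : E N} {r t₀ S ε q : ℝ} (hr : 0 < r) (hq : 0 < q) (hS : 3 / 4 < S) (hε : 0 < ε)
    (hu : ∀ x, ∀ t ∈ Ioo (t₀ - r ^ 2) (t₀ + r ^ 2), 0 ≤ u x t) (hS1 : S < 1)
    (hgu : ∀ x ∈ closedBall (0 : E N) 1, ∀ t, |t| ≤ S → g x t = u (x₀ + r • x) (t₀ + r ^ 2 * t) + ε) :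
    (∫ t in (t₀ - r ^ 2 * S)..(t₀ - r ^ 2 * (3 / 4)), ∫ x in ball x₀ (r / 2), u x t ^ q) ≤
      r ^ (N + 2) * Icyl N (fun x t => g x (-t)) S (1 / 2) q := by
  have hr2 : 0 < r ^ 2 := by positivity
  have e0 : ∀ t, ∫ x in ball x₀ (r / 2), u x t ^ q = r ^ N * ∫ x in closedBall (0 : E N) (1 / 2), u (x₀ + r • x) t ^ q := by
    intro t
    have hae : (ball x₀ (r / 2) : Set (E N)) =ᵐ[volume] closedBall x₀ (r / 2) :=
      ae_eq_of_subset_of_measure_ge ball_subset_closedBall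
        ((Measure.addHaar_closedBall volume x₀ (by positivity)).trans (Measure.addHaar_ball_of_pos volume x₀ (by positivity)).symm).le measurableSet_ball.nullMeasurableSet measure_closedBall_lt_top.ne
    rw [← change_var x₀ hr (1 / 2) (fun x => u x t ^ q), setIntegral_congr_set hae, mul_one_div]
  have e1 := intervalIntegral.integral_comp_sub_mul (a := 3 / 4) (b := S) (c := r ^ 2)
    (fun t => ∫ x in ball x₀ (r / 2), u x t ^ q) hr2.ne' t₀
  rw [smul_eq_mul, eq_inv_mul_iff_mul_eq₀ hr2.ne'] at e1
  rw [← e1, pow_add, mul_assoc, mul_comm (r ^ N), mul_assoc]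
  refine mul_le_mul_of_nonneg_left ?_ hr2.le
  simp only [e0]
  rw [intervalIntegral.integral_const_mul, mul_comm (Icyl _ _ _ _ _)]
  refine mul_le_mul_of_nonneg_left ?_ (by positivity)
  have et : tau (1 / 2) = 3 / 4 := by unfold tau; norm_num
  unfold Icyl
  rw [et]
  have cg : Continuous (fun p : E N × ℝ => g p.1 (-p.2)) := hg.continuous.comp (continuous_fst.prodMk continuous_snd.neg)
  have c1 : Continuous (fun p : E N × ℝ => |g p.1 (-p.2) - ε| ^ q) :=
    ((cg.sub continuous_const).abs).rpow_const fun _ => Or.inr hq.le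
  have c2 : Continuous (fun p : E N × ℝ => g p.1 (-p.2) ^ q) := cg.rpow_const fun _ => Or.inr hq.le
  have hin : ∀ t ∈ Icc (3 / 4) S, ∀ x ∈ closedBall (0 : E N) (1 / 2),
      0 ≤ u (x₀ + r • x) (t₀ - r ^ 2 * t) ∧ g x (-t) = u (x₀ + r • x) (t₀ - r ^ 2 * t) + ε := by
    intro t ht x hx
    refine ⟨hu _ _ ⟨by nlinarith [ht.1, ht.2], by nlinarith [ht.1, ht.2]⟩, ?_⟩
    rw [hgu x (closedBall_subset_closedBall (by norm_num) hx) (-t) (by rw [abs_neg, abs_of_pos (by linarith [ht.1])]; exact ht.2)]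
    rw [mul_neg, ← sub_eq_add_neg]
  have e2 : (∫ t in (3 / 4)..S, ∫ x in closedBall (0 : E N) (1 / 2), u (x₀ + r • x) (t₀ - r ^ 2 * t) ^ q) =
      ∫ t in (3 / 4)..S, ∫ x in closedBall (0 : E N) (1 / 2), |g x (-t) - ε| ^ q := by
    refine intervalIntegral.integral_congr fun t ht => ?_
    rw [uIcc_of_le hS.le] at ht
    refine setIntegral_congr_fun measurableSet_closedBall fun x hx => ?_
    obtain ⟨h0, h1⟩ := hin t ht x hx
    simp only [h1, add_sub_cancel_right, abs_of_nonneg h0]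
  rw [e2]
  refine intervalIntegral.integral_mono_on hS.le
    ((cont_int (F := fun x t => |g x (-t) - ε| ^ q) c1 _).intervalIntegrable _ _)
    ((cont_int (F := fun x t => g x (-t) ^ q) c2 _).intervalIntegrable _ _) fun t ht => ?_
  refine setIntegral_mono_on (int_ball (slice_x (F := fun x t => |g x (-t) - ε| ^ q) c1 t) _)
    (int_ball (slice_x (F := fun x t => g x (-t) ^ q) c2 t) _) measurableSet_closedBall fun x hx => ?_
  obtain ⟨h0, h1⟩ := hin t ht x hx
  refine Real.rpow_le_rpow (abs_nonneg _) ?_ hq.le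
  rw [h1, add_sub_cancel_right, abs_of_nonneg h0]; linarith

lemma lim_S {G : ℝ → ℝ} {a b r2 Y : ℝ} (hab : a = b - r2 * (1 / 4)) (hr : 0 < r2) {t1 : ℝ} (ht1 : t1 < 1) (ht0 : 3 / 4 < t1)
    (hG : IntegrableOn G (Ioo a b))
    (h : ∀ S, t1 < S → S < 1 → (∫ t in (b - r2 * (S - 3 / 4))..b, G t) ≤ Y) : ∫ t in Ioo a b, G t ≤ Y := by
  have hGi : Integrable ((Ioo a b).indicator G) := hG.integrable_indicator measurableSet_Ioo
  have hc := intervalIntegral.continuous_primitive (μ := volume) (fun x y => hGi.intervalIntegrable (a := x) (b := y)) b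
  have hc2 : Continuous (fun S => -∫ t in b..(b - r2 * (S - 3 / 4)), (Ioo a b).indicator G t) :=
    (hc.comp (by fun_prop : Continuous fun S : ℝ => b - r2 * (S - 3 / 4))).neg
  have hcl : ∀ S ∈ Ioo t1 1, -∫ t in b..(b - r2 * (S - 3 / 4)), (Ioo a b).indicator G t ≤ Y := by
    intro S hS
    refine le_trans (le_of_eq ?_) (h S hS.1 hS.2)
    rw [← intervalIntegral.integral_symm]
    have hle : b - r2 * (S - 3 / 4) ≤ b := by nlinarith [hS.1]
    rw [intervalIntegral.integral_of_le hle, intervalIntegral.integral_of_le hle, integral_Ioc_eq_integral_Ioo, integral_Ioc_eq_integral_Ioo]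
    refine setIntegral_congr_fun measurableSet_Ioo fun t ht => ?_
    have hm : t ∈ Ioo a b := ⟨by nlinarith [ht.1, hS.2], ht.2⟩
    exact indicator_of_mem hm _
  have h1 : -∫ t in b..(b - r2 * (1 - 3 / 4)), (Ioo a b).indicator G t ≤ Y := by
    refine le_of_tendsto (x := nhdsWithin 1 (Iio 1)) (hc2.continuousWithinAt (s := Iio 1) (x := (1 : ℝ))) ?_
    filter_upwards [Ioo_mem_nhdsLT ht1] with S hS
    exact hcl S hS
  refine le_trans (le_of_eq ?_) h1
  rw [← intervalIntegral.integral_symm, show b - r2 * (1 - 3 / 4) = a by rw [hab]; ring, intervalIntegral.integral_of_le (by rw [hab]; linarith),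
    integral_Ioc_eq_integral_Ioo]
  exact (setIntegral_congr_fun measurableSet_Ioo fun t ht => indicator_of_mem ht _).symm

lemma int_uq {T : ℝ} {K : E N → E N → ℝ → ℝ} {Ω : Set (E N)} {u : E N → ℝ → ℝ}
    (hsol : IsWeakSupersolution N T K Ω u) {q : ℝ} (hq : 0 < q) (x₀ : E N) (ρ : ℝ) {a b : ℝ} (hab : Ioo a b ⊆ Ioo 0 T) :
    IntegrableOn (fun p : E N × ℝ => u p.1 p.2 ^ q) (ball x₀ ρ ×ˢ Ioo a b) := by
  obtain ⟨hm, ⟨M, hM⟩, -⟩ := hsol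
  have hmeas : MeasurableSet (ball x₀ ρ ×ˢ Ioo a b) := measurableSet_ball.prod measurableSet_Ioo
  refine Measure.integrableOn_of_bounded (M := M ^ q) ?_ (hm.pow_const q).aestronglyMeasurable ?_
  · rw [Measure.volume_eq_prod, Measure.prod_prod]
    exact ENNReal.mul_ne_top measure_ball_lt_top.ne measure_Ioo_lt_top.ne
  · refine (ae_restrict_iff' hmeas).2 (.of_forall fun p hp => ?_)
    rw [Real.norm_eq_abs]
    exact (Real.abs_rpow_le_abs_rpow _ _).trans (Real.rpow_le_rpow (abs_nonneg _) (hM _ _ (hab hp.2)) hq.le)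

lemma pointwise (hN : 2 ≤ N) {s Λ : ℝ} (hs : s ∈ Ioo (0 : ℝ) 1) (hΛ : 1 ≤ Λ) {q : ℝ} (hq0 : 0 < q) (hq1 : q < 1 + 2 / (N : ℝ)) :
    ∃ B : ℝ, ∀ (T : ℝ) (Ω : Set (E N)) (K : E N → E N → ℝ → ℝ) (u : E N → ℝ → ℝ)
        (x₀ : E N) (R r t₀ : ℝ), 0 < T → IsOpen Ω →
        KernelOK N s Λ T K → IsWeakSupersolution N T K Ω u →
        Metric.ball x₀ R ⊆ Ω → Set.Ioo (t₀ - r ^ 2) (t₀ + r ^ 2) ⊆ Set.Ioo 0 T →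
        (∀ x : E N, ∀ t ∈ Set.Ioo (t₀ - r ^ 2) (t₀ + r ^ 2), 0 ≤ u x t) →
        0 < r → r ≤ 1 → r < R / 2 → ∀ y ∈ ball x₀ (r / 2), ∀ τ ∈ Ioo (t₀ + 3 * r ^ 2 / 4) (t₀ + r ^ 2),
        ∫ p in (Metric.ball x₀ (r / 2)) ×ˢ Set.Ioo (t₀ - r ^ 2) (t₀ - 3 * r ^ 2 / 4), u p.1 p.2 ^ q
          ≤ r ^ (N + 2) * (Real.exp B * u y τ) ^ q := by
  obtain ⟨B, hB⟩ := core hN hs hΛ hq0 hq1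
  refine ⟨B, fun T Ω K u x₀ R r t₀ hT hΩ hK hsol hR hsub hu hr hr1 hrR y hy τ hτ => ?_⟩
  have hr2 : 0 < r ^ 2 := by positivity
  have hsub1 : Ioo (t₀ - r ^ 2) (t₀ - 3 * r ^ 2 / 4) ⊆ Ioo 0 T := (Ioo_subset_Ioo le_rfl (by linarith)).trans hsub
  have hi := int_uq hsol hq0 x₀ (r / 2) hsub1
  have hi' : Integrable (fun p : E N × ℝ => u p.1 p.2 ^ q)
      ((volume.restrict (ball x₀ (r / 2))).prod (volume.restrict (Ioo (t₀ - r ^ 2) (t₀ - 3 * r ^ 2 / 4)))) := by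
    rw [Measure.prod_restrict, ← Measure.volume_eq_prod]; exact hi
  have hfub : ∫ p in ball x₀ (r / 2) ×ˢ Ioo (t₀ - r ^ 2) (t₀ - 3 * r ^ 2 / 4), u p.1 p.2 ^ q =
      ∫ t in Ioo (t₀ - r ^ 2) (t₀ - 3 * r ^ 2 / 4), ∫ x in ball x₀ (r / 2), u x t ^ q := by
    rw [Measure.volume_eq_prod, ← Measure.prod_restrict, integral_prod_symm _ hi']
  rw [hfub]
  set t1 := (τ - t₀) / r ^ 2 with ht1
  set x1 := r⁻¹ • (y - x₀) with hx1
  have et : t₀ + r ^ 2 * t1 = τ := by rw [ht1]; field_simp; ring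
  have ex : x₀ + r • x1 = y := by rw [hx1, smul_smul, mul_inv_cancel₀ hr.ne', one_smul]; abel
  have ht1a : 3 / 4 < t1 := by rw [ht1, lt_div_iff₀ hr2]; linarith [hτ.1]
  have ht1b : t1 < 1 := by rw [ht1, div_lt_one hr2]; linarith [hτ.2]
  have hx1m : x1 ∈ ball (0 : E N) (1 / 2) := by
    rw [mem_ball, dist_eq_norm] at hy
    rw [mem_ball, dist_zero_right, hx1, norm_smul, norm_inv, Real.norm_of_nonneg hr.le, inv_mul_lt_iff₀ hr]
    linarith
  refine lim_S (r2 := r ^ 2) (by ring) hr2 ht1b ht1a hi'.integral_prod_right fun S hS1 hS2 => ?_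
  have hS0 : 3 / 4 < S := ht1a.trans hS1
  have hε : ∀ ε, 0 < ε → (∫ t in (t₀ - r ^ 2 * S)..(t₀ - r ^ 2 * (3 / 4)), ∫ x in ball x₀ (r / 2), u x t ^ q) ≤
      r ^ (N + 2) * (Real.exp B * (u y τ + ε)) ^ q := by
    intro ε hε
    obtain ⟨g, hg, hpos, hgu, hE⟩ := scaled hN hs hΛ hT hΩ hK hsol hR hsub hu hr hr1 hrR (S := S) (by linarith) hS2 hε
    refine (bound_S hg hpos hr hq0 hS0 hε hu hS2 hgu).trans ?_
    refine mul_le_mul_of_nonneg_left ?_ (by positivity)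
    have := hB S hS0 hS2 g hg hpos hE x1 hx1m t1 ⟨ht1a, hS1⟩
    rwa [hgu x1 (ball_subset_closedBall (ball_subset_ball (by norm_num) hx1m)) t1 (by rw [abs_of_pos (by linarith)]; exact hS1.le), et, ex] at this
  rw [show t₀ - 3 * r ^ 2 / 4 - r ^ 2 * (S - 3 / 4) = t₀ - r ^ 2 * S by ring, show t₀ - 3 * r ^ 2 / 4 = t₀ - r ^ 2 * (3 / 4) by ring]
  have hc : Continuous (fun ε : ℝ => r ^ (N + 2) * (Real.exp B * (u y τ + ε)) ^ q) :=
    continuous_const.mul ((continuous_const.mul (continuous_const.add continuous_id)).rpow_const fun _ => Or.inr hq0.le)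
  have hlim := hc.continuousWithinAt (s := Ioi 0) (x := (0 : ℝ))
  have := ge_of_tendsto (x := nhdsWithin 0 (Ioi 0)) hlim (by
    filter_upwards [self_mem_nhdsWithin] with ε h
    exact hε ε h)
  simpa using this

end final2

theorem stmt_17 (N : ℕ) (hN : 2 ≤ N) (s Λ : ℝ) (hs : s ∈ Set.Ioo (0 : ℝ) 1)
    (hΛ : 1 ≤ Λ) (q : ℝ) (hq0 : 0 < q) (hq1 : q < 2 - 2 / kappa N) :
    ∃ C : ℝ, 0 < C ∧
      ∀ (T : ℝ) (Ω : Set (E N)) (K : E N → E N → ℝ → ℝ) (u : E N → ℝ → ℝ)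
        (x₀ : E N) (R r t₀ : ℝ),
        0 < T → IsOpen Ω → Bornology.IsBounded Ω →
        KernelOK N s Λ T K → IsWeakSupersolution N T K Ω u →
        Metric.ball x₀ R ⊆ Ω → Set.Ioo (t₀ - r ^ 2) (t₀ + r ^ 2) ⊆ Set.Ioo 0 T →
        (∀ x : E N, ∀ t ∈ Set.Ioo (t₀ - r ^ 2) (t₀ + r ^ 2), 0 ≤ u x t) →
        0 < r → r ≤ 1 → r < R / 2 →
        (⨍ p in (Metric.ball x₀ (r / 2)) ×ˢ Set.Ioo (t₀ - r ^ 2) (t₀ - 3 * r ^ 2 / 4),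
            u p.1 p.2 ^ q) ^ (1 / q) ≤
          C * essInf (fun p : E N × ℝ => u p.1 p.2)
                (volume.restrict
                  ((Metric.ball x₀ (r / 2)) ×ˢ Set.Ioo (t₀ + 3 * r ^ 2 / 4) (t₀ + r ^ 2))) := by
  have hq2 := q_lt hN hq1
  obtain ⟨B, hB⟩ := pointwise hN hs hΛ hq0 hq2
  set ω : ℝ := (volume (ball (0 : E N) (1 / 2))).toReal / 4 with hω
  have hω0 : 0 < ω := div_pos (ENNReal.toReal_pos (measure_ball_pos _ _ (by norm_num)).ne' measure_ball_lt_top.ne) (by norm_num)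
  have hωq : 0 < (ω⁻¹) ^ (1 / q) := Real.rpow_pos_of_pos (inv_pos.2 hω0) _
  have hCpos : 0 < (ω⁻¹) ^ (1 / q) * Real.exp B := mul_pos hωq (Real.exp_pos B)
  refine ⟨(ω⁻¹) ^ (1 / q) * Real.exp B, hCpos, ?_⟩
  intro T Ω K u x₀ R r t₀ hT hΩ _ hK hsol hR hsub hu hr hr1 hrR
  have hr2 : 0 < r ^ 2 := by positivity
  have hpt := hB T Ω K u x₀ R r t₀ hT hΩ hK hsol hR hsub hu hr hr1 hrR
  have hvol : (volume (ball x₀ (r / 2) ×ˢ Ioo (t₀ - r ^ 2) (t₀ - 3 * r ^ 2 / 4))).toReal = r ^ (N + 2) * ω := by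
    rw [Measure.volume_eq_prod, Measure.prod_prod, ENNReal.toReal_mul, Real.volume_Ioo,
      show r / 2 = r * (1 / 2) by ring, Measure.addHaar_ball_mul_of_pos volume x₀ hr, ENNReal.toReal_mul,
      ENNReal.toReal_ofReal (by positivity), ENNReal.toReal_ofReal (by linarith), finrank_euclideanSpace, Fintype.card_fin, hω]
    ring
  set avg := ⨍ p in (Metric.ball x₀ (r / 2)) ×ˢ Set.Ioo (t₀ - r ^ 2) (t₀ - 3 * r ^ 2 / 4), u p.1 p.2 ^ q with havg
  have havg0 : 0 ≤ avg := by
    rw [havg, setAverage_eq, smul_eq_mul]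
    refine mul_nonneg (inv_nonneg.2 measureReal_nonneg) (setIntegral_nonneg (measurableSet_ball.prod measurableSet_Ioo) fun p hp => ?_)
    exact Real.rpow_nonneg (hu _ _ ⟨hp.2.1, by linarith [hp.2.2]⟩) _
  have hmain : ∀ y ∈ ball x₀ (r / 2), ∀ τ ∈ Ioo (t₀ + 3 * r ^ 2 / 4) (t₀ + r ^ 2),
      avg ^ (1 / q) ≤ (ω⁻¹) ^ (1 / q) * Real.exp B * u y τ := by
    intro y hy τ hτ
    have hu0 : 0 ≤ u y τ := hu y τ ⟨by linarith [hτ.1], hτ.2⟩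
    have h1 := hpt y hy τ hτ
    have h2 : avg ≤ ω⁻¹ * (Real.exp B * u y τ) ^ q := by
      rw [havg, setAverage_eq, smul_eq_mul, Measure.real, hvol, inv_mul_le_iff₀ (by positivity)]
      refine h1.trans (le_of_eq ?_)
      field_simp
    refine (Real.rpow_le_rpow havg0 h2 (by positivity)).trans (le_of_eq ?_)
    have h3 : 0 ≤ Real.exp B * u y τ := mul_nonneg (Real.exp_pos B).le hu0
    rw [Real.mul_rpow (inv_pos.2 hω0).le (Real.rpow_nonneg h3 _), ← Real.rpow_mul h3, mul_one_div_cancel hq0.ne', Real.rpow_one, mul_assoc]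
  have hmV : MeasurableSet (ball x₀ (r / 2) ×ˢ Ioo (t₀ + 3 * r ^ 2 / 4) (t₀ + r ^ 2)) := measurableSet_ball.prod measurableSet_Ioo
  have hne : volume (ball x₀ (r / 2) ×ˢ Ioo (t₀ + 3 * r ^ 2 / 4) (t₀ + r ^ 2)) ≠ 0 := by
    rw [Measure.volume_eq_prod, Measure.prod_prod, Real.volume_Ioo]
    refine mul_ne_zero (measure_ball_pos _ _ (by positivity)).ne' ?_
    rw [Ne, ENNReal.ofReal_eq_zero]; push Not; linarith
  haveI hnb : (ae (volume.restrict (ball x₀ (r / 2) ×ˢ Ioo (t₀ + 3 * r ^ 2 / 4) (t₀ + r ^ 2)))).NeBot := by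
    rw [ae_neBot, Ne, Measure.restrict_eq_zero]; exact hne
  rw [← div_le_iff₀' hCpos]
  refine le_essInf_of_ae_le _ ?_ ?_
  · refine (ae_restrict_iff' hmV).2 (.of_forall fun p hp => ?_)
    rw [div_le_iff₀' hCpos]
    exact hmain p.1 hp.1 p.2 hp.2
  · obtain ⟨M, hM⟩ := hsol.2.1
    refine Filter.IsBoundedUnder.isCoboundedUnder_ge ⟨M, ?_⟩
    rw [Filter.eventually_map]
    refine (ae_restrict_iff' hmV).2 (.of_forall fun p hp => ?_)
    exact (le_abs_self _).trans (hM p.1 p.2 (hsub ⟨by linarith [hp.2.1], hp.2.2⟩))
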